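/- arXiv:2507.19617 — 2 statements merged into one kernel-verified Lean document; each statement's English description precedes it below -/
import Mathlib

section
/- Let d ≥ 2 and set d̃ = d+1. Let V = ⊕_{i=1}^d V_i be a graded vector space of forms in R with dimension vector δ = (δ_1,…,δ_d) and let σ = max{2, δ_1, …, δ_d}. Then V is contained in a K-subalgebra of R generated by an R_3-sequence of homogeneous forms of degrees at most d and of length at most d̃ ↑^{d²+d−2} (d̃^σ). -/
open MvPolynomial

/-- Knuth's up-arrow `knuth a k b = a ↑^k b`, with `a ↑^1 b = a ^ b`,
`a ↑^(k+1) 1 = a` and `a ↑^(k+1) (b+1) = a ↑^k (a ↑^(k+1) b)`. -/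
def knuth (a : ℕ) : ℕ → ℕ → ℕ
  | 0, b => a ^ b
  | 1, b => a ^ b
  | _+2, 0 => 1
  | _+2, 1 => a
  | k+2, b+2 => knuth a (k+1) (knuth a (k+2) (b+1))
  termination_by k b => (k, b)

/-- A (Noetherian) local ring is regular iff its maximal ideal can be generated by
`ringKrullDim` many elements. -/
def IsRegularLocal (S : Type*) [CommRing S] : Prop :=
  IsNoetherianRing S ∧ IsLocalRing S ∧
    ∃ s : Finset S, (Ideal.span (s : Set S)).IsMaximal ∧
      (s.card : WithBot (WithTop ℕ)) = ringKrullDim S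

/-- Serre's condition `R_η`: the localization at every prime of height at most `η`
is a regular local ring. -/
def SerreReg (η : ℕ) (S : Type*) [CommRing S] : Prop :=
  ∀ p : PrimeSpectrum S, Order.height p ≤ (η : ℕ∞) →
    IsRegularLocal (Localization.AtPrime p.asIdeal)

/-- `y` is an `R_η`-sequence: it generates a proper ideal and the quotient by each
initial segment satisfies Serre's condition `R_η`. -/
def IsSerreSeq (η : ℕ) {S : Type*} [CommRing S] {n : ℕ} (y : Fin n → S) : Prop :=
  Ideal.span (Set.range y) ≠ ⊤ ∧
    ∀ m : ℕ, m ≤ n →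
      SerreReg η (S ⧸ Ideal.span (y '' {j : Fin n | (j : ℕ) < m}))

namespace SmallSubalg

open IsLocalRing MvPolynomial

set_option linter.unusedSectionVars false

section LocalAlgebra

variable {S : Type*} [CommRing S] [IsLocalRing S]

/-- The quotient by `I` has dimension at most `n`, via systems of parameters. -/
def DimLE (n : ℕ) (I : Ideal S) : Prop :=
  ∃ t : Finset S, t.card ≤ n ∧ (∀ x ∈ t, x ∈ maximalIdeal S) ∧
    maximalIdeal S ≤ (I ⊔ Ideal.span (t : Set S)).radical

theorem DimLE.mono {n : ℕ} {I J : Ideal S} (h : DimLE n I) (hIJ : I ≤ J) : DimLE n J := by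
  obtain ⟨t, h1, h2, h3⟩ := h
  exact ⟨t, h1, h2, h3.trans (Ideal.radical_mono (sup_le_sup_right hIJ _))⟩

theorem DimLE.of_sup {n : ℕ} {I : Ideal S} {a : S} (ha : a ∈ maximalIdeal S)
    (h : DimLE n (I ⊔ Ideal.span {a})) : DimLE (n + 1) I := by
  classical
  obtain ⟨t, h1, h2, h3⟩ := h
  refine ⟨insert a t, (Finset.card_insert_le _ _).trans (by omega), ?_, ?_⟩
  · intro x hx
    rcases Finset.mem_insert.1 hx with rfl | hx
    exacts [ha, h2 x hx]
  · refine h3.trans (Ideal.radical_mono ?_)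
    rw [Finset.coe_insert, Ideal.span_insert, sup_assoc]

theorem DimLE.exists_sup {n : ℕ} {I : Ideal S} (h : DimLE (n + 1) I) :
    ∃ a ∈ maximalIdeal S, DimLE n (I ⊔ Ideal.span {a}) := by
  classical
  obtain ⟨t, h1, h2, h3⟩ := h
  rcases t.eq_empty_or_nonempty with rfl | ⟨a, ha⟩
  · exact ⟨0, zero_mem _, ∅, by simp, by simp, by simpa using h3⟩
  · refine ⟨a, h2 a ha, t.erase a, by rw [Finset.card_erase_of_mem ha]; omega,
      fun x hx => h2 x (Finset.mem_of_mem_erase hx), h3.trans (Ideal.radical_mono ?_)⟩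
    rw [sup_assoc, ← Ideal.span_insert, ← Finset.coe_insert, Finset.insert_erase ha]

theorem DimLE.succ {n k : ℕ} {I : Ideal S} (h : DimLE n I) (hk : n ≤ k) : DimLE k I := by
  obtain ⟨t, h1, h2, h3⟩ := h
  exact ⟨t, h1.trans hk, h2, h3⟩

variable [IsNoetherianRing S]

theorem dimLE_iff {n : ℕ} {I : Ideal S} :
    DimLE n I ↔ ringKrullDim (S ⧸ I) ≤ n := by
  classical
  by_cases hI : I = ⊤
  · subst hI
    have : Subsingleton (S ⧸ (⊤ : Ideal S)) := Ideal.Quotient.subsingleton_iff.2 rfl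
    simp only [ringKrullDim_eq_bot_of_subsingleton, bot_le, iff_true]
    exact ⟨∅, by simp, by simp, by simp [Ideal.radical_top]⟩
  have : Nontrivial (S ⧸ I) := Ideal.Quotient.nontrivial_iff.2 hI
  have : IsLocalRing (S ⧸ I) := .of_surjective' (Ideal.Quotient.mk I) Ideal.Quotient.mk_surjective
  have hmap : (maximalIdeal (S ⧸ I)).comap (Ideal.Quotient.mk I) = maximalIdeal S := by
    have := IsLocalRing.eq_maximalIdeal
      (Ideal.comap_isMaximal_of_surjective (Ideal.Quotient.mk I) Ideal.Quotient.mk_surjective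
        (K := maximalIdeal (S ⧸ I)))
    exact this
  rw [← maximalIdeal_height_eq_ringKrullDim]
  constructor
  · rintro ⟨t, h1, h2, h3⟩
    have hmin : maximalIdeal (S ⧸ I) ∈
        (Ideal.span ((t.image (Ideal.Quotient.mk I) : Finset (S ⧸ I)) : Set (S ⧸ I))).minimalPrimes := by
      refine ⟨⟨inferInstance, ?_⟩, ?_⟩
      · rw [Ideal.span_le]
        intro x hx
        simp only [Finset.coe_image, Set.mem_image, Finset.mem_coe] at hx
        obtain ⟨y, hy, rfl⟩ := hx
        have := h2 y hy
        rw [← hmap] at this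
        exact this
      · rintro q ⟨hq1, hq2⟩ -
        rw [← Ideal.comap_le_comap_iff_of_surjective (Ideal.Quotient.mk I)
          Ideal.Quotient.mk_surjective, hmap]
        refine h3.trans ?_
        have : (q.comap (Ideal.Quotient.mk I)).IsPrime := inferInstance
        rw [Ideal.IsPrime.radical_le_iff this]
        refine sup_le ?_ ?_
        · intro x hx
          simp [Ideal.mem_comap, Ideal.Quotient.eq_zero_iff_mem.2 hx]
        · rw [Ideal.span_le]
          intro x hx
          exact hq2 (Ideal.subset_span (by simpa using ⟨x, hx, rfl⟩))
    have := Ideal.height_le_card_of_mem_minimalPrimes_span_finset hmin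
    have h5 : (maximalIdeal (S ⧸ I)).height ≤ (n : ℕ∞) :=
      this.trans (by exact_mod_cast Finset.card_image_le.trans h1)
    exact_mod_cast h5
  · intro h
    have h' : (maximalIdeal (S ⧸ I)).height ≤ (n : ℕ∞) := by exact_mod_cast h
    obtain ⟨s, hs1, hs2⟩ :=
      Ideal.exists_finset_card_eq_height_of_isNoetherianRing (maximalIdeal (S ⧸ I))
    have hrad : maximalIdeal (S ⧸ I) ≤ (Ideal.span (s : Set (S ⧸ I))).radical := by
      rw [Ideal.radical_eq_sInf]
      refine le_sInf ?_
      rintro J ⟨hJ1, hJ2⟩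
      exact hs1.2 ⟨hJ2, hJ1⟩ (le_maximalIdeal hJ2.ne_top)
    refine ⟨s.image Quotient.out, ?_, ?_, ?_⟩
    · refine Finset.card_image_le.trans ?_
      rw [← hs2] at h'
      exact_mod_cast h'
    · intro x hx
      obtain ⟨y, hy, rfl⟩ := Finset.mem_image.1 hx
      rw [← hmap, Ideal.mem_comap]
      have : (Ideal.Quotient.mk I) (Quotient.out y) = y := Quotient.out_eq y
      rw [this]
      exact hs1.1.2 (Ideal.subset_span hy)
    · intro x hx
      rw [← hmap, Ideal.mem_comap] at hx
      obtain ⟨k, hk⟩ := hrad hx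
      refine ⟨k, ?_⟩
      have e : Ideal.span (s : Set (S ⧸ I)) = Ideal.map (Ideal.Quotient.mk I)
          (Ideal.span ((s.image Quotient.out : Finset S) : Set S)) := by
        rw [Ideal.map_span]
        congr 1
        ext y
        simp only [Finset.coe_image, Set.mem_image, Finset.mem_coe]
        constructor
        · intro hy
          exact ⟨_, ⟨y, hy, rfl⟩, Quotient.out_eq y⟩
        · rintro ⟨_, ⟨z, hz, rfl⟩, rfl⟩
          have : (Ideal.Quotient.mk I) (Quotient.out z) = z := Quotient.out_eq z
          rwa [this]
      rw [e, ← map_pow, ← Ideal.mem_comap,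
        Ideal.comap_map_of_surjective' _ Ideal.Quotient.mk_surjective, Ideal.mk_ker, sup_comm] at hk
      exact hk

theorem DimLE.of_lt {k : ℕ} {p q : Ideal S} [p.IsPrime] [q.IsPrime] (hpq : p < q)
    (h : DimLE (k + 1) p) : DimLE k q := by
  rw [dimLE_iff] at h ⊢
  have := ringKrullDim_succ_le_of_surjective (R := S ⧸ p) (Ideal.Quotient.factor hpq.le)
    (Ideal.Quotient.factor_surjective hpq.le)
    (r := Ideal.Quotient.mk p (SetLike.exists_of_lt hpq).choose) ?_ ?_
  · have h2 := this.trans h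
    have : ((k + 1 : ℕ) : WithBot ℕ∞) = (k : WithBot ℕ∞) + 1 := by push_cast; rfl
    rw [this] at h2
    exact ENat.WithBot.add_le_add_one_right_iff.1 h2
  · rw [mem_nonZeroDivisors_iff_ne_zero, Ne, Ideal.Quotient.eq_zero_iff_mem]
    exact (SetLike.exists_of_lt hpq).choose_spec.2
  · rw [Ideal.Quotient.factor_mk, Ideal.Quotient.eq_zero_iff_mem]
    exact (SetLike.exists_of_lt hpq).choose_spec.1

theorem exists_prime_not_dimLE {n : ℕ} {I : Ideal S} (h : ¬ DimLE n I) :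
    ∃ p : Ideal S, p.IsPrime ∧ I ≤ p ∧ ¬ DimLE n p := by
  by_contra! H
  apply h
  rw [dimLE_iff, ringKrullDim_quotient]
  refine iSup_le fun l => ?_
  have h1 := H l.head.1.asIdeal l.head.1.2 l.head.2
  rw [dimLE_iff, ringKrullDim_quotient] at h1
  refine le_trans ?_ h1
  have : ∀ i, l i ∈ {x : PrimeSpectrum.zeroLocus (I : Set S) | l.head ≤ x} :=
    fun i => l.head_le i
  let l' : LTSeries (PrimeSpectrum.zeroLocus (l.head.1.asIdeal : Set S)) :=
    { length := l.length
      toFun := fun i => ⟨(l i).1, l.head_le i⟩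
      step := fun i => l.step i }
  exact le_iSup (fun p : LTSeries (PrimeSpectrum.zeroLocus (l.head.1.asIdeal : Set S)) =>
    (p.length : WithBot ℕ∞)) l'

end LocalAlgebra

section CohenMacaulay

variable {S : Type*} [CommRing S] [IsLocalRing S]

/-- The quotient by `I` is Cohen–Macaulay of dimension `n`: it has a maximal regular
sequence of length `n`, modulo which the ring is Artinian. -/
def IsCM : ℕ → Ideal S → Prop
  | 0, I => I ≠ ⊤ ∧ ∃ k : ℕ, maximalIdeal S ^ k ≤ I
  | n + 1, I => ∃ a ∈ maximalIdeal S, (∀ z, a * z ∈ I → z ∈ I) ∧ IsCM n (I ⊔ Ideal.span {a})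

theorem IsCM.ne_top {n : ℕ} {I : Ideal S} (h : IsCM n I) : I ≠ ⊤ := by
  induction n generalizing I with
  | zero => exact h.1
  | succ n ih =>
    obtain ⟨a, -, -, h⟩ := h
    rintro rfl
    exact ih h (by simp)

theorem IsCM.dimLE {n : ℕ} {I : Ideal S} (h : IsCM n I) : DimLE n I := by
  induction n generalizing I with
  | zero =>
    obtain ⟨-, k, hk⟩ := h
    refine ⟨∅, by simp, by simp, fun x hx => ⟨k, ?_⟩⟩
    simpa using hk (Ideal.pow_mem_pow hx k)
  | succ n ih =>
    obtain ⟨a, ha, -, h⟩ := h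
    exact (ih h).of_sup ha

theorem mem_sup_span {I : Ideal S} {a x : S} :
    x ∈ I ⊔ Ideal.span {a} ↔ ∃ i ∈ I, ∃ y, x = i + a * y := by
  rw [Submodule.mem_sup]
  constructor
  · rintro ⟨i, hi, z, hz, rfl⟩
    obtain ⟨y, rfl⟩ := Ideal.mem_span_singleton.1 hz
    exact ⟨i, hi, y, rfl⟩
  · rintro ⟨i, hi, y, rfl⟩
    exact ⟨i, hi, _, Ideal.mem_span_singleton.2 ⟨y, rfl⟩, rfl⟩

variable [IsNoetherianRing S]

theorem le_of_forall_exists {I N : Ideal S} {a : S} (ha : a ∈ maximalIdeal S)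
    (h : ∀ z ∈ N, ∃ i ∈ I, ∃ y ∈ N, z = i + a * y) : N ≤ I := by
  refine Submodule.le_of_le_smul_of_le_jacobson_bot (I := maximalIdeal S) (N := I) (N' := N)
    (IsNoetherian.noetherian N) (IsLocalRing.maximalIdeal_le_jacobson _) ?_
  intro z hz
  obtain ⟨i, hi, y, hy, rfl⟩ := h z hz
  exact add_mem (Submodule.mem_sup_left hi)
    (Submodule.mem_sup_right (Submodule.smul_mem_smul ha hy))

theorem swap_left {I : Ideal S} {a b : S} (ha : a ∈ maximalIdeal S)
    (h1 : ∀ z, a * z ∈ I → z ∈ I)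
    (h2 : ∀ z, b * z ∈ I ⊔ Ideal.span {a} → z ∈ I ⊔ Ideal.span {a}) :
    ∀ z, b * z ∈ I → z ∈ I := by
  let N : Ideal S := I.colon {b}
  have hN : ∀ z, z ∈ N ↔ b * z ∈ I := fun z => by
    rw [Submodule.mem_colon_singleton, smul_eq_mul, mul_comm]
  suffices N ≤ I from fun z hz => this ((hN z).2 hz)
  refine le_of_forall_exists ha fun z hz => ?_
  rw [hN] at hz
  obtain ⟨i, hi, y, rfl⟩ := mem_sup_span.1 (h2 z (Submodule.mem_sup_left hz))
  refine ⟨i, hi, y, (hN y).2 (h1 _ ?_), rfl⟩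
  have : a * (b * y) = b * (i + a * y) - b * i := by ring
  rw [this]
  exact sub_mem hz (I.mul_mem_left _ hi)

theorem swap_right {I : Ideal S} {a b : S}
    (h1 : ∀ z, a * z ∈ I → z ∈ I)
    (h2 : ∀ z, b * z ∈ I ⊔ Ideal.span {a} → z ∈ I ⊔ Ideal.span {a}) :
    ∀ z, a * z ∈ I ⊔ Ideal.span {b} → z ∈ I ⊔ Ideal.span {b} := by
  intro z hz
  obtain ⟨i, hi, y, e⟩ := mem_sup_span.1 hz
  have hy : b * y ∈ I ⊔ Ideal.span {a} :=
    mem_sup_span.2 ⟨-i, neg_mem hi, z, by rw [e]; ring⟩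
  obtain ⟨i', hi', y', e'⟩ := mem_sup_span.1 (h2 y hy)
  have : z - b * y' ∈ I := by
    apply h1
    have : a * (z - b * y') = i + b * i' := by
      rw [mul_sub, e, e']; ring
    rw [this]
    exact add_mem hi (I.mul_mem_left _ hi')
  exact mem_sup_span.2 ⟨_, this, y', by ring⟩

theorem DimLE.sup_mul {n : ℕ} {I : Ideal S} {a f : S} (ha : DimLE n (I ⊔ Ideal.span {a}))
    (hf : DimLE n (I ⊔ Ideal.span {f})) : DimLE n (I ⊔ Ideal.span {a * f}) := by
  by_contra h
  obtain ⟨p, hp, hle, hn⟩ := exists_prime_not_dimLE h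
  have hI : I ≤ p := le_sup_left.trans hle
  have : a * f ∈ p := hle (Submodule.mem_sup_right (Ideal.mem_span_singleton_self _))
  rcases hp.mem_or_mem this with h' | h'
  · exact hn (ha.mono (sup_le hI ((Ideal.span_singleton_le_iff_mem _).2 h')))
  · exact hn (hf.mono (sup_le hI ((Ideal.span_singleton_le_iff_mem _).2 h')))

theorem IsCM.sup_of_dimLE {n : ℕ} {I : Ideal S} {f : S} (h : IsCM (n + 1) I)
    (hf : f ∈ maximalIdeal S) (hd : DimLE n (I ⊔ Ideal.span {f})) :
    (∀ z, f * z ∈ I → z ∈ I) ∧ IsCM n (I ⊔ Ideal.span {f}) := by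
  induction n generalizing I f with
  | zero =>
    obtain ⟨a, ha, hz, -⟩ := id h
    have hrad : maximalIdeal S ≤ (I ⊔ Ideal.span {f}).radical := by
      obtain ⟨t, h1, h2, h3⟩ := hd
      rw [Finset.card_eq_zero.1 (Nat.le_zero.1 h1)] at h3
      simpa using h3
    constructor
    · intro z hfz
      obtain ⟨j, hj⟩ := hrad ha
      obtain ⟨i, hi, y, e⟩ := mem_sup_span.1 hj
      have hz' : a ^ j * z ∈ I := by
        rw [e]
        have : (i + f * y) * z = i * z + y * (f * z) := by ring
        rw [this]
        exact add_mem (I.mul_mem_right _ hi) (I.mul_mem_left _ hfz)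
      clear e hj
      induction j with
      | zero => simpa using hz'
      | succ j ih => exact ih (hz _ (by rwa [← mul_assoc, ← pow_succ']))
    · refine ⟨?_, ?_⟩
      · have hI := le_maximalIdeal h.ne_top
        intro e
        have : (⊤ : Ideal S) ≤ maximalIdeal S := by
          rw [← e]
          exact sup_le hI ((Ideal.span_singleton_le_iff_mem _).2 hf)
        exact (maximalIdeal.isMaximal S).ne_top (top_le_iff.1 this)
      · exact Ideal.exists_pow_le_of_le_radical_of_fg hrad (IsNoetherian.noetherian _)
  | succ n ih =>
    obtain ⟨a, ha, hz, hcm⟩ := id h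
    obtain ⟨b, hb, hdb⟩ := (hcm.dimLE.sup_mul hd).exists_sup
    have haf : Ideal.span {a * f} ≤ Ideal.span {a} :=
      (Ideal.span_singleton_le_iff_mem _).2 (Ideal.mem_span_singleton.2 ⟨f, rfl⟩)
    have haf' : Ideal.span {a * f} ≤ Ideal.span {f} :=
      (Ideal.span_singleton_le_iff_mem _).2 (Ideal.mem_span_singleton.2 ⟨a, mul_comm _ _⟩)
    obtain ⟨h1, h2⟩ := ih hcm hb
      (hdb.mono (sup_le_sup_right (sup_le_sup_left haf _) _))
    have hbI := swap_left ha hz h1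
    have haI := swap_right hz h1
    have hcmb : IsCM (n + 1) (I ⊔ Ideal.span {b}) := ⟨a, ha, haI, by rwa [sup_right_comm]⟩
    obtain ⟨h3, h4⟩ := ih hcmb hf (by
      rw [sup_right_comm]
      exact hdb.mono (sup_le_sup_right (sup_le_sup_left haf' _) _))
    exact ⟨swap_left hb hbI h3, b, hb, swap_right hbI h3, by rwa [sup_right_comm]⟩

theorem exists_prime_colon {R : Type*} [CommRing R] [IsNoetherianRing R] {I J : Ideal R} {z : R}
    (hz : z ∉ I) (hJ : ∀ x ∈ J, x * z ∈ I) :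
    ∃ p : Ideal R, p.IsPrime ∧ J ≤ p ∧ ∃ w ∉ I, ∀ x, x ∈ p ↔ x * w ∈ I := by
  have hz' : Ideal.Quotient.mk I z ≠ 0 := fun h => hz (Ideal.Quotient.eq_zero_iff_mem.1 h)
  obtain ⟨P, hP, hle⟩ := exists_le_isAssociatedPrime_of_isNoetherianRing R
    (Ideal.Quotient.mk I z) hz'
  obtain ⟨hPp, w, hw⟩ := isAssociatedPrime_iff.1 hP
  obtain ⟨w, rfl⟩ := Ideal.Quotient.mk_surjective w
  have key : ∀ x v, x ∈ (⊥ : Submodule R (R ⧸ I)).colon {Ideal.Quotient.mk I v} ↔ x * v ∈ I := by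
    intro x v
    rw [Submodule.mem_colon_singleton, Submodule.mem_bot, ← Ideal.Quotient.eq_zero_iff_mem,
      map_mul, Algebra.smul_def]
    rfl
  refine ⟨P, hPp, fun x hx => hle ((key x z).2 (hJ x hx)), w, ?_, ?_⟩
  · intro hwI
    refine hPp.ne_top ((Ideal.eq_top_iff_one _).2 ?_)
    rw [hw, key, one_mul]
    exact hwI
  · intro x
    rw [hw, key]

theorem IsCM.le_of_colon {n : ℕ} {I p : Ideal S} [p.IsPrime] {z : S} (h : IsCM n I) (hz : z ∉ I)
    (hp : ∀ x ∈ p, x * z ∈ I) {k : ℕ} (hk : DimLE k p) : n ≤ k := by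
  induction n generalizing I p z k with
  | zero => exact Nat.zero_le _
  | succ n ih =>
    obtain ⟨a, ha, hreg, hcm⟩ := id h
    have hap : a ∉ p := fun h => hz (hreg z (hp a h))
    obtain ⟨w, hw, hwI⟩ : ∃ w, (∀ x ∈ p, x * w ∈ I) ∧ w ∉ I ⊔ Ideal.span {a} := by
      by_contra! H
      let N : Ideal S := I.colon (p : Set S)
      have hN : ∀ z, z ∈ N ↔ ∀ x ∈ p, x * z ∈ I := fun z => by
        rw [Submodule.mem_colon]
        simp [mul_comm]
      have hNI : N ≤ I := by
        refine le_of_forall_exists ha fun v hv => ?_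
        rw [hN] at hv
        obtain ⟨i, hi, y, rfl⟩ := mem_sup_span.1 (H v hv)
        refine ⟨i, hi, y, (hN y).2 fun x hx => hreg _ ?_, rfl⟩
        have e : a * (x * y) = x * (i + a * y) - x * i := by ring
        rw [e]
        exact sub_mem (hv x hx) (I.mul_mem_left _ hi)
      exact hz (hNI ((hN z).2 hp))
    obtain ⟨q, hq, hpq, v, hv, hqv⟩ := exists_prime_colon (J := p ⊔ Ideal.span {a}) hwI (by
      intro x hx
      obtain ⟨i, hi, y, rfl⟩ := mem_sup_span.1 hx
      rw [add_mul]
      refine add_mem (Submodule.mem_sup_left (hw i hi)) (Submodule.mem_sup_right ?_)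
      exact Ideal.mem_span_singleton.2 ⟨y * w, by ring⟩)
    have haq : a ∈ q := hpq (Submodule.mem_sup_right (Ideal.mem_span_singleton_self _))
    have hlt : p < q := lt_of_le_of_ne (le_sup_left.trans hpq) fun e => hap (e ▸ haq)
    cases k with
    | zero =>
      exfalso
      obtain ⟨t, h1, h2, h3⟩ := hk
      rw [Finset.card_eq_zero.1 (Nat.le_zero.1 h1)] at h3
      simp only [Finset.coe_empty, Ideal.span_empty, bot_le, sup_of_le_left] at h3
      rw [Ideal.IsPrime.radical inferInstance] at h3
      exact hap (h3 ha)
    | succ k => exact Nat.succ_le_succ (ih hcm hv (fun x => (hqv x).1) (hk.of_lt hlt))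

theorem eq_and_isCM_of_le_sup {n : ℕ} {I q : Ideal S} [hq : q.IsPrime] {t : Finset S}
    (ht : t.card ≤ n) (hm : maximalIdeal S ≤ I ⊔ Ideal.span (t : Set S))
    (htm : ∀ x ∈ t, x ∈ maximalIdeal S)
    (hIq : I ≤ q) (hdim : ∀ k, DimLE k q → n ≤ k) : I = q ∧ IsCM n I := by
  classical
  induction n generalizing I q t with
  | zero =>
    rw [Finset.card_eq_zero.1 (Nat.le_zero.1 ht)] at hm
    simp only [Finset.coe_empty, Ideal.span_empty, bot_le, sup_of_le_left] at hm
    have hqm := le_maximalIdeal hq.ne_top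
    have e : I = maximalIdeal S := le_antisymm (hIq.trans hqm) hm
    refine ⟨le_antisymm hIq (hqm.trans hm), ?_, 1, by simpa using hm⟩
    rw [e]
    exact (maximalIdeal.isMaximal S).ne_top
  | succ n ih =>
    have hqm := le_maximalIdeal hq.ne_top
    obtain ⟨x, hxt, hxq⟩ : ∃ x ∈ t, x ∉ q := by
      by_contra! H
      have : maximalIdeal S ≤ q := hm.trans (sup_le hIq (Ideal.span_le.2 H))
      have := hdim 0 ⟨∅, by simp, by simp, by
        simpa using this.trans Ideal.le_radical⟩
      omega
    have hxm := htm x hxt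
    obtain ⟨q', hq', hle, hd'⟩ : ∃ q' : Ideal S, q'.IsPrime ∧ q ⊔ Ideal.span {x} ≤ q' ∧
        ∀ k, DimLE k q' → n ≤ k := by
      cases n with
      | zero =>
        exact ⟨maximalIdeal S, inferInstance,
          sup_le hqm ((Ideal.span_singleton_le_iff_mem _).2 hxm), fun _ _ => Nat.zero_le _⟩
      | succ n =>
        have : ¬ DimLE n (q ⊔ Ideal.span {x}) := fun h => by
          have := hdim _ (h.of_sup hxm)
          omega
        obtain ⟨q', h1, h2, h3⟩ := exists_prime_not_dimLE this
        refine ⟨q', h1, h2, fun k hk => ?_⟩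
        by_contra hlt
        exact h3 (hk.succ (by omega))
    obtain ⟨e, hcm⟩ := ih (I := I ⊔ Ideal.span {x}) (q := q') (t := t.erase x)
      (by rw [Finset.card_erase_of_mem hxt]; omega)
      (by rwa [sup_assoc, ← Ideal.span_insert, ← Finset.coe_insert, Finset.insert_erase hxt])
      (fun y hy => htm y (Finset.mem_of_mem_erase hy))
      (sup_le (hIq.trans (le_sup_left.trans hle)) (le_sup_right.trans hle)) hd'
    have hqI : q ≤ I := by
      refine le_of_forall_exists hxm fun z hz => ?_
      have : z ∈ I ⊔ Ideal.span {x} := by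
        rw [e]
        exact hle (Submodule.mem_sup_left hz)
      obtain ⟨i, hi, y, rfl⟩ := mem_sup_span.1 this
      refine ⟨i, hi, y, ?_, rfl⟩
      exact (hq.mem_or_mem ((q.add_mem_iff_right (hIq hi)).1 hz)).resolve_left hxq
    have hIeq : I = q := le_antisymm hIq hqI
    refine ⟨hIeq, x, hxm, fun z hz => ?_, hcm⟩
    rw [hIeq] at hz ⊢
    exact (hq.mem_or_mem hz).resolve_left hxq

end CohenMacaulay

section Regular

theorem height_add_le_of_not_dimLE {S : Type*} [CommRing S] [IsNoetherianRing S] [IsLocalRing S]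
    {k : ℕ} {q : Ideal S} [hq : q.IsPrime] (h : ¬ DimLE k q) :
    q.height + (k + 1 : ℕ) ≤ (maximalIdeal S).height := by
  have hlt : q < maximalIdeal S := lt_of_le_of_ne (le_maximalIdeal hq.ne_top) fun e => h
    ⟨∅, by simp, by simp, by simpa [e] using Ideal.le_radical⟩
  induction k generalizing q with
  | zero => simpa using Ideal.height_add_one_le_of_lt_of_isPrime hlt
  | succ k ih =>
    obtain ⟨a, ha, haq⟩ := SetLike.exists_of_lt hlt
    obtain ⟨q', h1, h2, h3⟩ := exists_prime_not_dimLE (fun h' => h (DimLE.of_sup ha h'))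
    have hlt' : q < q' := lt_of_le_of_ne (le_sup_left.trans h2) fun e => haq (by
      rw [e]; exact h2 (Submodule.mem_sup_right (Ideal.mem_span_singleton_self _)))
    have hltm : q' < maximalIdeal S := lt_of_le_of_ne (le_maximalIdeal h1.ne_top) fun e => h3
      ⟨∅, by simp, by simp, by simpa [e] using Ideal.le_radical⟩
    have := ih h3 hltm
    refine le_trans ?_ this
    have h4 := Ideal.height_add_one_le_of_lt_of_isPrime hlt'
    calc q.height + (k + 1 + 1 : ℕ) = q.height + 1 + (k + 1 : ℕ) := by push_cast; ring
      _ ≤ _ := by gcongr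

variable (S : Type*) [CommRing S] [IsRegularLocalRing S]

theorem exists_isCM_of_regular : ∃ n : ℕ, (maximalIdeal S).height = n ∧
    IsCM n (⊥ : Ideal S) ∧ (⊥ : Ideal S).IsPrime := by
  have hreg := IsRegularLocalRing.spanFinrank_maximalIdeal (R := S)
  set n := (maximalIdeal S).spanFinrank with hn
  obtain ⟨t, ht1, ht2⟩ := Submodule.FG.exists_span_finset_card_eq_spanFinrank
    (IsNoetherian.noetherian (maximalIdeal S))
  rw [← maximalIdeal_height_eq_ringKrullDim] at hreg
  have hreg' : (maximalIdeal S).height = n := by exact_mod_cast hreg.symm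
  have hdim : ∀ k, DimLE k (⊥ : Ideal S) → n ≤ k := by
    rintro k ⟨s, h1, h2, h3⟩
    rw [bot_sup_eq] at h3
    have hmin : maximalIdeal S ∈ (Ideal.span (s : Set S)).minimalPrimes := by
      refine ⟨⟨inferInstance, Ideal.span_le.2 h2⟩, ?_⟩
      rintro q ⟨hq1, hq2⟩ -
      exact h3.trans ((Ideal.IsPrime.radical_le_iff hq1).2 hq2)
    have := Ideal.height_le_card_of_mem_minimalPrimes_span_finset hmin
    rw [hreg'] at this
    have : n ≤ s.card := by exact_mod_cast this
    omega
  obtain ⟨q, hq, hqd⟩ : ∃ q : Ideal S, q.IsPrime ∧ ∀ k, DimLE k q → n ≤ k := by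
    rcases Nat.eq_zero_or_pos n with h0 | h0
    · exact ⟨maximalIdeal S, inferInstance, fun k _ => by omega⟩
    · obtain ⟨q, h1, -, h3⟩ := exists_prime_not_dimLE (n := n - 1) (I := (⊥ : Ideal S))
        fun h => by have := hdim _ h; omega
      refine ⟨q, h1, fun k hk => ?_⟩
      by_contra hlt
      exact h3 (hk.succ (by omega))
  obtain ⟨e, hcm⟩ := eq_and_isCM_of_le_sup (I := ⊥) (q := q) (t := t) (n := n) (by omega)
    (by rw [bot_sup_eq]; exact ht2.ge) (fun x hx => by rw [← ht2]; exact Ideal.subset_span hx)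
    bot_le hqd
  exact ⟨n, hreg', hcm, e ▸ hq⟩

theorem isDomain_of_regular : IsDomain S := by
  obtain ⟨n, -, -, h⟩ := exists_isCM_of_regular S
  exact IsDomain.of_bot_isPrime S

variable {S}

theorem DimLE.of_sup_span {n : ℕ} {I : Ideal S} {t : Finset S} (ht : ∀ x ∈ t, x ∈ maximalIdeal S)
    (h : DimLE n (I ⊔ Ideal.span (t : Set S))) : DimLE (n + t.card) I := by
  classical
  obtain ⟨s, h1, h2, h3⟩ := h
  refine ⟨s ∪ t, (Finset.card_union_le _ _).trans (by omega), ?_, ?_⟩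
  · intro x hx
    rcases Finset.mem_union.1 hx with hx | hx
    exacts [h2 x hx, ht x hx]
  · refine h3.trans (Ideal.radical_mono ?_)
    rw [Finset.coe_union, Ideal.span_union, sup_assoc, sup_comm (Ideal.span (t : Set S))]

theorem IsCM.sup_span {n : ℕ} {I : Ideal S} {t : Finset S} (ht : ∀ x ∈ t, x ∈ maximalIdeal S)
    (h : IsCM (n + t.card) I) (hd : DimLE n (I ⊔ Ideal.span (t : Set S))) :
    IsCM n (I ⊔ Ideal.span (t : Set S)) := by
  classical
  induction t using Finset.induction_on generalizing I with
  | empty => simpa using h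
  | insert a t hat ih =>
    rw [Finset.card_insert_of_notMem hat, ← add_assoc] at h
    rw [Finset.coe_insert, Ideal.span_insert, ← sup_assoc] at hd ⊢
    have ht' : ∀ x ∈ t, x ∈ maximalIdeal S := fun x hx => ht x (Finset.mem_insert_of_mem hx)
    exact ih ht' (h.sup_of_dimLE (ht a (Finset.mem_insert_self _ _)) (hd.of_sup_span ht')).2 hd

theorem isCM_span {t : Finset S} (ht : ∀ x ∈ t, x ∈ maximalIdeal S)
    (hh : (t.card : ℕ∞) ≤ (Ideal.span (t : Set S)).height) :
    ∃ k : ℕ, (maximalIdeal S).height = (k + t.card : ℕ) ∧ IsCM k (Ideal.span (t : Set S)) := by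
  obtain ⟨n, hn, hcm, -⟩ := exists_isCM_of_regular S
  have hle : t.card ≤ n := by
    have := hh.trans (Ideal.height_mono (Ideal.span_le.2 ht))
    rw [hn] at this
    exact_mod_cast this
  obtain ⟨k, rfl⟩ := Nat.exists_eq_add_of_le' hle
  refine ⟨k, hn, ?_⟩
  rw [← bot_sup_eq (Ideal.span (t : Set S))]
  refine hcm.sup_span ht ?_
  by_contra h
  obtain ⟨q, h1, h2, h3⟩ := exists_prime_not_dimLE h
  have h4 := height_add_le_of_not_dimLE h3
  rw [bot_sup_eq] at h2
  have h5 := hh.trans (Ideal.height_mono h2)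
  rw [hn] at h4
  have h6 : ((t.card + (k + 1) : ℕ) : ℕ∞) ≤ (k + t.card : ℕ) := by
    refine le_trans ?_ h4
    push_cast
    gcongr
  have : t.card + (k + 1) ≤ k + t.card := by exact_mod_cast h6
  omega

theorem le_of_dimLE_prime {p : Ideal S} [hp : p.IsPrime] {k : ℕ} (hk : DimLE k p) :
    (maximalIdeal S).height ≤ p.height + k := by
  obtain ⟨J, hJ, hr, hh⟩ := Ideal.exists_spanRank_eq_and_height_eq p hp.ne_top
  obtain ⟨t, ht1, ht2⟩ := Submodule.FG.exists_span_finset_card_eq_spanFinrank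
    (IsNoetherian.noetherian J)
  have htJ : Ideal.span (t : Set S) = J := ht2
  have hrank : (t.card : ℕ∞) = p.height := by
    have h1 := (Submodule.FG.spanRank_eq_spanFinrank (IsNoetherian.noetherian J))
    rw [hr, ← ht1] at h1
    exact_mod_cast h1.symm
  have htp : ∀ x ∈ t, x ∈ maximalIdeal S := fun x hx =>
    le_maximalIdeal hp.ne_top (hJ (htJ ▸ Ideal.subset_span hx))
  obtain ⟨c, hc, hcm⟩ := isCM_span htp (by rw [htJ, hh, hrank])
  have hmin : p ∈ J.minimalPrimes := Ideal.mem_minimalPrimes_of_height_le hJ hh.ge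
  rw [htJ] at hcm
  have hass : p ∈ associatedPrimes S (S ⧸ J) := by
    apply Module.associatedPrimes.minimalPrimes_annihilator_subset_associatedPrimes
    rwa [Ideal.annihilator_quotient]
  obtain ⟨hPp, w, hw⟩ := isAssociatedPrime_iff.1 hass
  obtain ⟨w, rfl⟩ := Ideal.Quotient.mk_surjective w
  have key : ∀ x, x ∈ p ↔ x * w ∈ J := by
    intro x
    rw [hw, Submodule.mem_colon_singleton, Submodule.mem_bot, ← Ideal.Quotient.eq_zero_iff_mem,
      map_mul, Algebra.smul_def]
    rfl
  have := hcm.le_of_colon (p := p) (z := w)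
    (fun h => hp.ne_top ((Ideal.eq_top_iff_one _).2 ((key 1).2 (by simpa using h))))
    (fun x => (key x).1) hk
  rw [hc, ← hrank]
  norm_cast
  omega

end Regular

section RegularRing

variable {R : Type*} [CommRing R] [IsRegularRing R]

/-- A sequence of `r` elements of height `r` in a regular ring generates an unmixed ideal. -/
theorem mem_span_of_colon_height {t : Finset R} {J : Ideal R} {z : R}
    (ht : (t.card : ℕ∞) ≤ (Ideal.span (t : Set R)).height)
    (hJ : ∀ x ∈ J, x * z ∈ Ideal.span (t : Set R)) (hh : (t.card + 1 : ℕ∞) ≤ J.height) :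
    z ∈ Ideal.span (t : Set R) := by
  classical
  by_contra hz
  obtain ⟨p, hp, hJp, w, hw, key⟩ := exists_prime_colon hz hJ
  have hIp : Ideal.span (t : Set R) ≤ p := fun x hx => (key x).2 (Ideal.mul_mem_right _ _ hx)
  let S := Localization.AtPrime p
  have : IsRegularLocalRing S := inferInstance
  let t' : Finset S := t.image (algebraMap R S)
  have hspan : Ideal.span (t' : Set S) = (Ideal.span (t : Set R)).map (algebraMap R S) := by
    rw [Ideal.map_span, Finset.coe_image]
  have hcard : t'.card ≤ t.card := Finset.card_image_le
  have hm : (maximalIdeal S).height = p.height := by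
    rw [← IsLocalization.height_under p.primeCompl, Localization.AtPrime.under_maximalIdeal]
  have hmap : p.map (algebraMap R S) = maximalIdeal S := Localization.AtPrime.map_eq_maximalIdeal
  have htm : ∀ x ∈ t', x ∈ maximalIdeal S := by
    intro x hx
    rw [← hmap]
    have : x ∈ Ideal.span (t' : Set S) := Ideal.subset_span hx
    rw [hspan] at this
    exact Ideal.map_mono hIp this
  have hht : (t'.card : ℕ∞) ≤ (Ideal.span (t' : Set S)).height := by
    refine le_trans (by exact_mod_cast hcard) (ht.trans ?_)
    rw [hspan, ← IsLocalization.height_under p.primeCompl (A := S)]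
    exact Ideal.height_mono Ideal.le_comap_map
  obtain ⟨k, hk, hcm⟩ := isCM_span htm hht
  have hk0 : k ≤ 0 := by
    refine hcm.le_of_colon (p := maximalIdeal S) (z := algebraMap R S w) ?_ ?_
      ⟨∅, by simp, by simp, by simpa using Ideal.le_radical⟩
    · rw [hspan, IsLocalization.algebraMap_mem_map_algebraMap_iff p.primeCompl]
      rintro ⟨m, hm, hmw⟩
      exact hm ((key m).2 hmw)
    · have : maximalIdeal S ≤ (Ideal.span (t' : Set S)).colon {algebraMap R S w} := by
        rw [← hmap, Ideal.map_le_iff_le_comap]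
        intro x hx
        rw [Ideal.mem_comap, Submodule.mem_colon_singleton, smul_eq_mul, ← map_mul, hspan]
        exact Ideal.mem_map_of_mem _ ((key x).1 hx)
      intro x hx
      simpa [Submodule.mem_colon_singleton] using this hx
  have h1 := hh.trans (Ideal.height_mono hJp)
  rw [← hm, hk] at h1
  have : t.card + 1 ≤ k + t'.card := by exact_mod_cast h1
  omega

theorem exists_prime_height_le {P M : Ideal R} [hP : P.IsPrime] [hM : M.IsPrime] (hPM : P ≤ M)
    {t : Finset R} (ht : ∀ x ∈ t, x ∈ M) :
    ∃ P' : Ideal R, P'.IsPrime ∧ P ≤ P' ∧ (∀ x ∈ t, x ∈ P') ∧ P' ≤ M ∧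
      P'.height ≤ P.height + t.card := by
  classical
  let S := Localization.AtPrime M
  have : IsRegularLocalRing S := inferInstance
  let t' : Finset S := t.image (algebraMap R S)
  have hcard : t'.card ≤ t.card := Finset.card_image_le
  have hm : (maximalIdeal S).height = M.height := by
    rw [← IsLocalization.height_under M.primeCompl, Localization.AtPrime.under_maximalIdeal]
  have hmap : M.map (algebraMap R S) = maximalIdeal S := Localization.AtPrime.map_eq_maximalIdeal
  have htm : ∀ x ∈ t', x ∈ maximalIdeal S := by
    intro x hx
    obtain ⟨y, hy, rfl⟩ := Finset.mem_image.1 hx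
    rw [← hmap]
    exact Ideal.mem_map_of_mem _ (ht y hy)
  have hdisj : Disjoint (M.primeCompl : Set R) (P : Set R) :=
    Set.disjoint_left.2 fun x hx hxP => hx (hPM hxP)
  let PS : Ideal S := P.map (algebraMap R S)
  have hPS : PS.IsPrime := IsLocalization.isPrime_of_isPrime_disjoint M.primeCompl S P hP hdisj
  have hPSh : PS.height = P.height := IsLocalization.height_map_of_disjoint M.primeCompl P hdisj
  have hMfin : M.height ≠ ⊤ := Ideal.height_ne_top hM.ne_top
  have hPfin : P.height ≠ ⊤ := Ideal.height_ne_top hP.ne_top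
  obtain ⟨n, hn⟩ := ENat.ne_top_iff_exists.1 hMfin
  obtain ⟨h, hh⟩ := ENat.ne_top_iff_exists.1 hPfin
  rcases le_or_gt n (h + t.card) with hle | hlt
  · refine ⟨M, hM, hPM, ht, le_rfl, ?_⟩
    rw [← hn, ← hh]
    exact_mod_cast hle
  obtain ⟨k, hk⟩ : ∃ k, n = h + t.card + (k + 1) := ⟨n - (h + t.card) - 1, by omega⟩
  have hnd : ¬ DimLE k (PS ⊔ Ideal.span (t' : Set S)) := by
    intro hd
    have := le_of_dimLE_prime (hd.of_sup_span htm)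
    rw [hPSh, hm, ← hn, ← hh] at this
    have : n ≤ h + (k + t'.card) := by exact_mod_cast this
    omega
  obtain ⟨Q, hQ, hPQ, hQd⟩ := exists_prime_not_dimLE hnd
  have h1 := height_add_le_of_not_dimLE hQd
  have hQM := IsLocalRing.le_maximalIdeal hQ.ne_top
  refine ⟨Q.under R, inferInstance, ?_, ?_, ?_, ?_⟩
  · exact Ideal.map_le_iff_le_comap.1 (le_sup_left.trans hPQ)
  · intro x hx
    exact hPQ (Submodule.mem_sup_right (Ideal.subset_span (Finset.mem_image_of_mem _ hx)))
  · exact (Ideal.comap_mono hQM).trans (Localization.AtPrime.under_maximalIdeal (I := M)).le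
  · rw [IsLocalization.height_under M.primeCompl, ← hh]
    rw [hm, ← hn, hk] at h1
    have hQfin : Q.height ≠ ⊤ := Ideal.height_ne_top hQ.ne_top
    obtain ⟨q, hq⟩ := ENat.ne_top_iff_exists.1 hQfin
    rw [← hq] at h1 ⊢
    have : q + (k + 1) ≤ h + t.card + (k + 1) := by exact_mod_cast h1
    have : q ≤ h + t.card := by omega
    exact_mod_cast this

end RegularRing

theorem isRegularLocal_of_isRegularLocalRing (S : Type*) [CommRing S] [h : IsRegularLocalRing S] :
    IsRegularLocal S := by
  refine ⟨inferInstance, inferInstance, ?_⟩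
  obtain ⟨t, ht1, ht2⟩ := Submodule.FG.exists_span_finset_card_eq_spanFinrank
    (IsNoetherian.noetherian (maximalIdeal S))
  have ht2' : Ideal.span (t : Set S) = maximalIdeal S := ht2
  refine ⟨t, by rw [ht2']; infer_instance, ?_⟩
  rw [ht1]
  exact h.spanFinrank_maximalIdeal

theorem height_maximalIdeal_atPrime {A : Type*} [CommRing A] (p : Ideal A) [p.IsPrime] :
    (maximalIdeal (Localization.AtPrime p)).height = p.height := by
  have h := IsLocalization.height_under p.primeCompl (maximalIdeal (Localization.AtPrime p))
  rw [Localization.AtPrime.under_maximalIdeal] at h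
  exact h.symm

section Jacobian

variable {K : Type*} [Field K] {N : ℕ} {ι : Type*} [Fintype ι]

/-- The rows of the Jacobian matrix of `y` are linearly dependent modulo the prime `P`. -/
def JacDep (y : ι → MvPolynomial (Fin N) K) (P : Ideal (MvPolynomial (Fin N) K)) : Prop :=
  ∃ a : ι → MvPolynomial (Fin N) K, (∃ i, a i ∉ P) ∧ ∀ k, ∑ i, a i * pderiv k (y i) ∈ P

theorem pderiv_mem_of_mem_sq {P : Ideal (MvPolynomial (Fin N) K)} {f : MvPolynomial (Fin N) K}
    (hf : f ∈ P ^ 2) (k : Fin N) : pderiv k f ∈ P := by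
  rw [pow_two] at hf
  refine Submodule.mul_induction_on hf ?_ ?_
  · intro a ha b hb
    rw [Derivation.leibniz, smul_eq_mul, smul_eq_mul]
    exact add_mem (P.mul_mem_right _ ha) (P.mul_mem_right _ hb)
  · intro a b ha hb
    rw [map_add]
    exact add_mem ha hb

theorem coeff_mem_of_not_jacDep {y : ι → MvPolynomial (Fin N) K}
    {P : Ideal (MvPolynomial (Fin N) K)} [hP : P.IsPrime]
    (hy : ∀ i, y i ∈ P) (hind : ¬ JacDep y P) (c : ι → Localization.AtPrime P)
    (hc : ∑ i, c i * algebraMap _ (Localization.AtPrime P) (y i) ∈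
      maximalIdeal (Localization.AtPrime P) ^ 2) (i : ι) :
    c i ∈ maximalIdeal (Localization.AtPrime P) := by
  obtain ⟨s, hs⟩ := IsLocalization.exist_integer_multiples_of_finite P.primeCompl c
  choose a ha using hs
  have h1 : algebraMap _ (Localization.AtPrime P) (∑ i, a i * y i) ∈
      (P ^ 2).map (algebraMap _ (Localization.AtPrime P)) := by
    rw [Ideal.map_pow, Localization.AtPrime.map_eq_maximalIdeal, map_sum]
    have : ∑ i, algebraMap _ (Localization.AtPrime P) (a i * y i) =
        algebraMap _ (Localization.AtPrime P) (s : MvPolynomial (Fin N) K) *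
        ∑ i, c i * algebraMap _ (Localization.AtPrime P) (y i) := by
      rw [Finset.mul_sum]
      refine Finset.sum_congr rfl fun i _ => ?_
      rw [map_mul, ha, Algebra.smul_def, mul_assoc]
    rw [this]
    exact Ideal.mul_mem_left _ _ hc
  rw [IsLocalization.algebraMap_mem_map_algebraMap_iff P.primeCompl] at h1
  obtain ⟨m, hm, hmem⟩ := h1
  have h2 : ∀ k, ∑ i, (m * a i) * pderiv k (y i) ∈ P := by
    intro k
    have h3 := pderiv_mem_of_mem_sq hmem k
    rw [Finset.mul_sum, map_sum] at h3
    have h4 : ∑ i, pderiv k (m * (a i * y i)) =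
        ∑ i, (m * a i) * pderiv k (y i) + ∑ i, y i * pderiv k (m * a i) := by
      rw [← Finset.sum_add_distrib]
      refine Finset.sum_congr rfl fun i _ => ?_
      rw [← mul_assoc, Derivation.leibniz, smul_eq_mul, smul_eq_mul]
    rw [h4] at h3
    exact (P.add_mem_iff_left (sum_mem fun i _ => P.mul_mem_right _ (hy i))).1 h3
  have h5 : a i ∈ P := by
    by_contra hai
    exact hind ⟨fun i => m * a i, ⟨i, fun h => (hP.mem_or_mem h).elim hm hai⟩, h2⟩
  have h6 : algebraMap _ (Localization.AtPrime P) (a i) ∈ maximalIdeal (Localization.AtPrime P) := by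
    rw [← Localization.AtPrime.map_eq_maximalIdeal]
    exact Ideal.mem_map_of_mem _ h5
  rw [ha, Algebra.smul_def] at h6
  refine ((maximalIdeal.isMaximal _).isPrime.mem_or_mem h6).resolve_left fun h7 => ?_
  rw [IsLocalization.AtPrime.to_map_mem_maximal_iff (Localization.AtPrime P) P] at h7
  exact s.2 h7

theorem exists_generators_of_not_jacDep {y : ι → MvPolynomial (Fin N) K}
    {P : Ideal (MvPolynomial (Fin N) K)} [hP : P.IsPrime]
    (hy : ∀ i, y i ∈ P) (hind : ¬ JacDep y P) :
    ∃ b : Finset (Localization.AtPrime P),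
      ((b.card + Fintype.card ι : ℕ) : ℕ∞) ≤ P.height ∧
      maximalIdeal (Localization.AtPrime P) =
        Ideal.span (Set.range fun i => algebraMap _ (Localization.AtPrime P) (y i)) ⊔
          Ideal.span (b : Set (Localization.AtPrime P)) := by
  classical
  set S := Localization.AtPrime P
  have hmem : ∀ i, algebraMap _ S (y i) ∈ maximalIdeal S := fun i => by
    rw [← Localization.AtPrime.map_eq_maximalIdeal]
    exact Ideal.mem_map_of_mem _ (hy i)
  let v : ι → CotangentSpace S := fun i => (maximalIdeal S).toCotangent ⟨algebraMap _ S (y i), hmem i⟩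
  have hv : LinearIndependent (ResidueField S) v := by
    rw [Fintype.linearIndependent_iff]
    intro g hg i
    choose c hc using fun i => IsLocalRing.residue_surjective (g i)
    have : ∑ i, c i * algebraMap _ S (y i) ∈ maximalIdeal S ^ 2 := by
      have h1 : (maximalIdeal S).toCotangent
          (∑ i, c i • (⟨algebraMap _ S (y i), hmem i⟩ : maximalIdeal S)) = 0 := by
        rw [map_sum, ← hg]
        refine Finset.sum_congr rfl fun i _ => ?_
        rw [map_smul, ← hc]
        rfl
      rw [Ideal.toCotangent_eq_zero] at h1
      simpa using h1
    rw [← hc, IsLocalRing.residue_eq_zero_iff]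
    exact coeff_mem_of_not_jacDep hy hind c this i
  let E := hv.linearIndepOn_id.extend (Set.subset_univ (Set.range v))
  let B : Module.Basis E (ResidueField S) (CotangentSpace S) :=
    Module.Basis.extend hv.linearIndepOn_id
  have hvE : Set.range v ⊆ E := hv.linearIndepOn_id.subset_extend _
  have hfin : Module.Finite (ResidueField S) (CotangentSpace S) := inferInstance
  have hEfin : Finite E := Module.Finite.finite_basis B
  have hEspan : Submodule.span (ResidueField S) E = ⊤ := by
    have := B.span_eq
    rwa [show Set.range B = E from Module.Basis.range_extend _] at this
  have hEcard : E.ncard = Module.finrank (ResidueField S) (CotangentSpace S) := by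
    rw [Module.finrank_eq_nat_card_basis B, Nat.card_coe_set_eq]
  have hdim : ((E.ncard : ℕ) : ℕ∞) = P.height := by
    have h1 := (IsRegularLocalRing.iff_finrank_cotangentSpace S).1 inferInstance
    rw [← hEcard, ← maximalIdeal_height_eq_ringKrullDim] at h1
    have h2 : (maximalIdeal S).height = P.height := by
      rw [← IsLocalization.height_under P.primeCompl, Localization.AtPrime.under_maximalIdeal]
    rw [h2] at h1
    exact_mod_cast h1
  let f : CotangentSpace S → maximalIdeal S :=
    Function.surjInv (maximalIdeal S).toCotangent_surjective
  have hf : ∀ w, (maximalIdeal S).toCotangent (f w) = w := Function.surjInv_eq _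
  have hDfin : (E \ Set.range v).Finite := (Set.toFinite E).subset Set.sdiff_subset
  let b : Finset S := hDfin.toFinset.image fun w => (f w : S)
  have hbcard : b.card + Fintype.card ι ≤ E.ncard := by
    have h1 : b.card ≤ (E \ Set.range v).ncard := by
      rw [Set.ncard_eq_toFinset_card _ hDfin]
      exact Finset.card_image_le
    have h2 := Set.ncard_sdiff_add_ncard_of_subset hvE (Set.toFinite E)
    have h3 : (Set.range v).ncard = Fintype.card ι := by
      rw [← Nat.card_coe_set_eq, Nat.card_range_of_injective hv.injective, Nat.card_eq_fintype_card]
    omega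
  refine ⟨b, ?_, ?_⟩
  · rw [← hdim]
    exact_mod_cast hbcard
  · let s : Set (maximalIdeal S) := Set.range (fun i => ⟨algebraMap _ S (y i), hmem i⟩) ∪
      f '' (E \ Set.range v)
    have hs : (maximalIdeal S).toCotangent '' s = E := by
      rw [Set.image_union, ← Set.range_comp, Set.image_image]
      simp only [hf, Set.image_id']
      exact Set.union_sdiff_cancel hvE
    have h1 := IsLocalRing.CotangentSpace.span_image_eq_top_iff.1 (hs ▸ hEspan)
    have h2 : maximalIdeal S = Submodule.map (maximalIdeal S).subtype (Submodule.span S s) := by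
      rw [h1, Submodule.map_top, Submodule.range_subtype]
    conv_lhs => rw [h2]
    rw [Submodule.map_span, Set.image_union, Submodule.span_union]
    congr 2
    · rw [← Set.range_comp]
      rfl
    · simp only [b, Finset.coe_image, Set.Finite.coe_toFinset, Set.image_image]
      rfl

theorem card_le_height_of_not_jacDep {y : ι → MvPolynomial (Fin N) K}
    {P : Ideal (MvPolynomial (Fin N) K)} [hP : P.IsPrime]
    (hy : ∀ i, y i ∈ P) (hind : ¬ JacDep y P) : (Fintype.card ι : ℕ∞) ≤ P.height := by
  obtain ⟨b, hb, -⟩ := exists_generators_of_not_jacDep hy hind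
  refine le_trans ?_ hb
  exact_mod_cast Nat.le_add_left _ _

theorem height_comap_mk_le {y : ι → MvPolynomial (Fin N) K}
    {I : Ideal (MvPolynomial (Fin N) K)} (hI : I = Ideal.span (Set.range y))
    (q : Ideal (MvPolynomial (Fin N) K ⧸ I)) [hq : q.IsPrime] :
    (q.comap (Ideal.Quotient.mk I)).height ≤ q.height + Fintype.card ι := by
  have hIP : I ≤ q.comap (Ideal.Quotient.mk I) := by
    rw [← Ideal.map_le_iff_le_comap, Ideal.map_quotient_self]
    exact bot_le
  have h1 := Ideal.height_le_height_add_spanFinrank_of_le hIP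
  rw [Ideal.map_comap_of_surjective _ Ideal.Quotient.mk_surjective q] at h1
  refine h1.trans ?_
  gcongr
  have h2 := Submodule.spanFinrank_span_le_ncard_of_finite (R := MvPolynomial (Fin N) K)
    (Set.finite_range y)
  have h3 : (Set.range y).ncard ≤ Fintype.card ι := by
    rw [← Set.image_univ, ← Nat.card_eq_fintype_card, ← Set.ncard_univ]
    exact Set.ncard_image_le (Set.toFinite _)
  rw [hI]
  exact h2.trans h3

/-- The Jacobian criterion: the quotient by `y` is regular at `P`. -/
theorem isRegularLocalRing_of_not_jacDep {y : ι → MvPolynomial (Fin N) K}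
    {I : Ideal (MvPolynomial (Fin N) K)} (hI : I = Ideal.span (Set.range y))
    (q : Ideal (MvPolynomial (Fin N) K ⧸ I)) [hq : q.IsPrime]
    (hind : ¬ JacDep y (q.comap (Ideal.Quotient.mk I))) :
    IsRegularLocalRing (Localization.AtPrime q) := by
  classical
  set P := q.comap (Ideal.Quotient.mk I) with hPdef
  have hPp : P.IsPrime := inferInstance
  have hy : ∀ i, y i ∈ P := fun i => by
    rw [hPdef, Ideal.mem_comap, Ideal.Quotient.eq_zero_iff_mem.2 (hI ▸ Ideal.subset_span ⟨i, rfl⟩)]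
    exact zero_mem _
  have hIP : I ≤ P := hI ▸ Ideal.span_le.2 (by rintro _ ⟨i, rfl⟩; exact hy i)
  have hmapP : P.map (Ideal.Quotient.mk I) = q :=
    Ideal.map_comap_of_surjective _ Ideal.Quotient.mk_surjective q
  have hht : P.height ≤ q.height + Fintype.card ι := height_comap_mk_le hI q
  obtain ⟨b, hb, hm⟩ := exists_generators_of_not_jacDep hy hind
  let φ : Localization.AtPrime P →+* Localization.AtPrime q :=
    Localization.localRingHom P q (Ideal.Quotient.mk I) rfl
  have hφ : Function.Surjective φ := by
    intro z
    obtain ⟨⟨a, s⟩, rfl⟩ := IsLocalization.mk'_surjective q.primeCompl z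
    obtain ⟨a, rfl⟩ := Ideal.Quotient.mk_surjective a
    obtain ⟨s, hs⟩ := s
    obtain ⟨s, rfl⟩ := Ideal.Quotient.mk_surjective s
    exact ⟨IsLocalization.mk' _ a ⟨s, hs⟩, Localization.localRingHom_mk' _ _ _ _ _ _⟩
  have hmax : maximalIdeal (Localization.AtPrime q) =
      Ideal.span ((b.image φ : Finset (Localization.AtPrime q)) : Set (Localization.AtPrime q)) := by
    have h1 : (maximalIdeal (Localization.AtPrime P)).map φ =
        maximalIdeal (Localization.AtPrime q) := by
      rw [← Localization.AtPrime.map_eq_maximalIdeal, ← Localization.AtPrime.map_eq_maximalIdeal,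
        Ideal.map_map]
      have h0 : φ.comp (algebraMap _ (Localization.AtPrime P)) =
          (algebraMap _ (Localization.AtPrime q)).comp (Ideal.Quotient.mk I) :=
        RingHom.ext fun x => Localization.localRingHom_to_map P q _ rfl x
      rw [h0, ← Ideal.map_map, hmapP]
    rw [← h1, hm, Ideal.map_sup, Ideal.map_span, Ideal.map_span, Finset.coe_image,
      sup_eq_right, Ideal.span_le]
    rintro _ ⟨_, ⟨i, rfl⟩, rfl⟩
    have : φ (algebraMap _ _ (y i)) = algebraMap _ _ (Ideal.Quotient.mk I (y i)) :=
      Localization.localRingHom_to_map _ _ _ _ _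
    rw [this, Ideal.Quotient.eq_zero_iff_mem.2 (hI ▸ Ideal.subset_span ⟨i, rfl⟩), map_zero]
    exact zero_mem _
  apply IsRegularLocalRing.of_spanFinrank_maximalIdeal_le
  rw [← maximalIdeal_height_eq_ringKrullDim]
  rw [height_maximalIdeal_atPrime q]
  have h1 : (maximalIdeal (Localization.AtPrime q)).spanFinrank ≤ b.card := by
    rw [hmax]
    refine (Submodule.spanFinrank_span_le_ncard_of_finite (Finset.finite_toSet _)).trans ?_
    rw [Set.ncard_coe_finset]
    exact Finset.card_image_le
  have h2 := hb.trans hht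
  have h3 : (b.card : ℕ∞) ≤ q.height := by
    push_cast at h2
    exact (ENat.add_le_add_iff_right (ENat.natCast_ne_top _)).1 h2
  have h4 : (((maximalIdeal (Localization.AtPrime q)).spanFinrank : ℕ) : ℕ∞) ≤ q.height :=
    le_trans (by exact_mod_cast h1) h3
  exact_mod_cast h4

end Jacobian

section Good

variable {K : Type*} [Field K] {N : ℕ} {ι : Type*} [Fintype ι]

theorem jacDep_iff {y : ι → MvPolynomial (Fin N) K} {P : Ideal (MvPolynomial (Fin N) K)} :
    JacDep y P ↔ ¬ LinearIndependent (MvPolynomial (Fin N) K ⧸ P)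
      (fun i (k : Fin N) => Ideal.Quotient.mk P (pderiv k (y i))) := by
  rw [Fintype.not_linearIndependent_iff]
  constructor
  · rintro ⟨a, ⟨i, hi⟩, ha⟩
    refine ⟨fun i => Ideal.Quotient.mk P (a i), ?_, i, fun h => hi (Ideal.Quotient.eq_zero_iff_mem.1 h)⟩
    ext k
    simp only [Finset.sum_apply, Pi.smul_apply, smul_eq_mul, Pi.zero_apply, ← map_mul, ← map_sum]
    exact Ideal.Quotient.eq_zero_iff_mem.2 (ha k)
  · rintro ⟨g, hg, i, hi⟩
    choose a ha using fun i => Ideal.Quotient.mk_surjective (g i)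
    refine ⟨a, ⟨i, fun h => hi ?_⟩, fun k => ?_⟩
    · rw [← ha, Ideal.Quotient.eq_zero_iff_mem.2 h]
    · have h := congrFun hg k
      simp only [Finset.sum_apply, Pi.smul_apply, smul_eq_mul, Pi.zero_apply, ← ha, ← map_mul,
        ← map_sum] at h
      exact Ideal.Quotient.eq_zero_iff_mem.1 h

theorem exists_smul_right_inverse [DecidableEq ι] {A : Type*} [CommRing A] [IsDomain A] {n : ℕ}
    {v : ι → Fin n → A} (hv : LinearIndependent A v) :
    ∃ (s : A) (w : Fin n → ι → A), s ≠ 0 ∧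
      ∀ i j, ∑ k, v i k * w k j = s * (Pi.single i 1 : ι → A) j := by
  let L := FractionRing A
  have hv' : LinearIndependent L (fun i ↦ algebraMap A L ∘ v i) :=
    linearIndependent_algebraMap_comp_iff.2 hv
  let f : (ι → L) →ₗ[L] (Fin n → L) := Fintype.linearCombination L (fun i ↦ algebraMap A L ∘ v i)
  have hf : LinearMap.ker f = ⊥ :=
    LinearMap.ker_eq_bot.2 (linearIndependent_iff_injective_fintypeLinearCombination.1 hv')
  obtain ⟨g, hg⟩ := LinearMap.exists_leftInverse_of_injective f hf
  obtain ⟨s, hs⟩ := IsLocalization.exist_integer_multiples_of_finite (nonZeroDivisors A)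
    (fun kj : Fin n × ι => g (Pi.single kj.1 1) kj.2)
  choose w hw using hs
  refine ⟨s, fun k j => w (k, j), nonZeroDivisors.ne_zero s.2, fun i j => ?_⟩
  apply IsFractionRing.injective A L
  rw [map_sum, map_mul]
  have h1 : g (fun k => algebraMap A L (v i k)) = Pi.single i 1 := by
    have h2 : f (Pi.single i 1) = fun k => algebraMap A L (v i k) := by
      simp only [f, Fintype.linearCombination_apply_single, one_smul]
      rfl
    rw [← h2, ← LinearMap.comp_apply, hg]
    rfl
  have h3 : (fun k => algebraMap A L (v i k)) =
      ∑ k, algebraMap A L (v i k) • (Pi.single k 1 : Fin n → L) := by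
    ext k
    simp [Finset.sum_apply, Pi.single_apply, Algebra.smul_def]
  rw [h3, map_sum] at h1
  have h4 := congrFun h1 j
  simp only [map_smul, Finset.sum_apply, Pi.smul_apply, smul_eq_mul] at h4
  have h5 : algebraMap A L ((Pi.single i 1 : ι → A) j) = (Pi.single i 1 : ι → L) j := by
    by_cases h : j = i
    · subst h; simp
    · simp [h]
  rw [h5, ← h4, Finset.mul_sum]
  refine Finset.sum_congr rfl fun k _ => ?_
  rw [map_mul, hw, Algebra.smul_def]
  ring

theorem JacDep.mono {y : ι → MvPolynomial (Fin N) K} {P P' : Ideal (MvPolynomial (Fin N) K)}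
    [P.IsPrime] [P'.IsPrime] (h : JacDep y P) (hle : P ≤ P') : JacDep y P' := by
  classical
  by_contra hcon
  rw [jacDep_iff, not_not] at hcon
  obtain ⟨s, w, hs, hw⟩ := exists_smul_right_inverse hcon
  choose b hb using fun k j => Ideal.Quotient.mk_surjective (w k j)
  obtain ⟨a, ⟨i0, hi0⟩, ha⟩ := h
  let M : Matrix ι ι (MvPolynomial (Fin N) K) := fun i j => ∑ k, pderiv k (y i) * b k j
  have hM : (Ideal.Quotient.mk P').mapMatrix M = s • (1 : Matrix ι ι _) := by
    ext i j
    rw [RingHom.mapMatrix_apply, Matrix.map_apply, Matrix.smul_apply, smul_eq_mul,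
      Matrix.one_eq_pi_single, ← hw i j]
    simp [M, hb]
  have hdet : M.det ∉ P' := by
    intro hd
    have h1 : (Ideal.Quotient.mk P') M.det = s ^ Fintype.card ι := by
      rw [RingHom.map_det, hM, Matrix.det_smul, Matrix.det_one, mul_one]
    rw [Ideal.Quotient.eq_zero_iff_mem.2 hd] at h1
    exact pow_ne_zero _ hs h1.symm
  have h2 : ∀ j, Matrix.vecMul a M j ∈ P := by
    intro j
    have : Matrix.vecMul a M j = ∑ k, b k j * ∑ i, a i * pderiv k (y i) := by
      simp only [Matrix.vecMul, dotProduct, M, Finset.mul_sum]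
      rw [Finset.sum_comm]
      refine Finset.sum_congr rfl fun k _ => Finset.sum_congr rfl fun i _ => by ring
    rw [this]
    exact Ideal.sum_mem _ fun k _ => P.mul_mem_left _ (ha k)
  have h3 : Matrix.vecMul (Matrix.vecMul a M) M.adjugate = M.det • a := by
    rw [Matrix.vecMul_vecMul, Matrix.mul_adjugate, Matrix.vecMul_smul, Matrix.vecMul_one]
  have h4 : M.det * a i0 ∈ P := by
    rw [← smul_eq_mul, ← Pi.smul_apply, ← h3]
    simp only [Matrix.vecMul, dotProduct] at h2 ⊢
    exact Ideal.sum_mem _ fun j _ => P.mul_mem_right _ (h2 j)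
  exact ((Ideal.IsPrime.mem_or_mem ‹_› h4).resolve_left fun h => hdet (hle h)) |> hi0

/-- An ideal is closed under taking homogeneous components. -/
def HomIdeal (P : Ideal (MvPolynomial (Fin N) K)) : Prop :=
  ∀ f ∈ P, ∀ e, homogeneousComponent e f ∈ P

theorem not_linearIndependent_of_injective {A B : Type*} [CommRing A] [CommRing B] [IsDomain B]
    {n : ℕ} (φ : A →+* B) (hφ : Function.Injective φ) {v : ι → Fin n → A} {b : ι → B} {i : ι}
    (hi : b i ≠ 0) (h : ∀ k, ∑ i, b i * φ (v i k) = 0) : ¬ LinearIndependent A v := by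
  let : Algebra A B := φ.toAlgebra
  have : FaithfulSMul A B := (faithfulSMul_iff_algebraMap_injective _ _).2 hφ
  rw [← linearIndependent_algebraMap_comp_iff (S := B), Fintype.not_linearIndependent_iff]
  refine ⟨b, ?_, i, hi⟩
  ext k
  simpa [RingHom.algebraMap_toAlgebra] using h k

section Dilate

variable {A : Type*} [CommRing A] (g : MvPolynomial (Fin N) K →+* A)

/-- The composition of a ring homomorphism with the dilation `x ↦ t x`. -/
noncomputable def dilate : MvPolynomial (Fin N) K →+* Polynomial A :=
  eval₂Hom (Polynomial.C.comp (g.comp C)) fun i => Polynomial.C (g (X i)) * Polynomial.X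

theorem dilate_of_isHomogeneous {f : MvPolynomial (Fin N) K} {e : ℕ} (hf : f.IsHomogeneous e) :
    dilate g f = Polynomial.C (g f) * Polynomial.X ^ e := by
  have key : ∀ m : Fin N →₀ ℕ, m.degree = e → ∀ c : K, dilate g (monomial m c) =
      Polynomial.C (g (monomial m c)) * Polynomial.X ^ e := by
    intro m hm c
    rw [monomial_eq, map_mul, map_mul, map_mul, Finsupp.prod, map_prod, map_prod, map_prod,
      mul_assoc]
    have hX : (Polynomial.X : Polynomial A) ^ e = ∏ i ∈ m.support, Polynomial.X ^ m i := by
      rw [Finset.prod_pow_eq_pow_sum, ← hm, Finsupp.degree_apply]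
    congr 1
    · simp [dilate]
    · rw [hX, ← Finset.prod_mul_distrib]
      refine Finset.prod_congr rfl fun i _ => ?_
      simp [dilate, mul_pow]
  rw [f.as_sum, map_sum, map_sum, map_sum, Finset.sum_mul]
  refine Finset.sum_congr rfl fun m hm => key m ?_ _
  rw [Finsupp.degree_eq_weight_one]
  exact hf (mem_support_iff.1 hm)

theorem coeff_dilate (f : MvPolynomial (Fin N) K) (e : ℕ) :
    (dilate g f).coeff e = g (homogeneousComponent e f) := by
  classical
  conv_lhs => rw [← sum_homogeneousComponent f, map_sum]
  rw [Polynomial.finsetSum_coeff]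
  simp_rw [dilate_of_isHomogeneous g (homogeneousComponent_isHomogeneous _ f),
    Polynomial.coeff_C_mul_X_pow]
  rw [Finset.sum_ite_eq]
  split_ifs with h
  · rfl
  · rw [homogeneousComponent_eq_zero _ _ (by simpa using h), map_zero]

/-- The map induced by `dilate` modulo its kernel. -/
noncomputable def dilateLift :
    MvPolynomial (Fin N) K ⧸ RingHom.ker (dilate g) →+* Polynomial A :=
  RingHom.kerLift (dilate g)

theorem dilateLift_mk (f : MvPolynomial (Fin N) K) :
    dilateLift g (Ideal.Quotient.mk _ f) = dilate g f := rfl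

theorem dilateLift_injective : Function.Injective (dilateLift g) := RingHom.kerLift_injective _

theorem not_linearIndependent_dilate [IsDomain A] {y : ι → MvPolynomial (Fin N) K} {d : ι → ℕ}
    (hd : ∀ i, (y i).IsHomogeneous (d i)) {a : ι → A} {i0 : ι} (hi0 : a i0 ≠ 0)
    (ha : ∀ k, ∑ i, a i * g (pderiv k (y i)) = 0) :
    JacDep y (RingHom.ker (dilate g)) := by
  have hle : ∀ i, d i - 1 ≤ ∑ j, d j := fun i =>
    (Nat.sub_le _ _).trans (Finset.single_le_sum (fun _ _ => Nat.zero_le _) (Finset.mem_univ i))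
  rw [jacDep_iff]
  refine not_linearIndependent_of_injective (dilateLift g) (dilateLift_injective g)
    (b := fun i => Polynomial.C (a i) * Polynomial.X ^ (∑ j, d j - (d i - 1))) (i := i0) ?_
    fun k => ?_
  · refine mul_ne_zero ?_ (pow_ne_zero _ Polynomial.X_ne_zero)
    rwa [Ne, Polynomial.C_eq_zero]
  · have h2 : ∀ i, Polynomial.C (a i) *
        Polynomial.X ^ (∑ j, d j - (d i - 1)) * dilateLift g (Ideal.Quotient.mk _ (pderiv k (y i))) =
        Polynomial.C (a i * g (pderiv k (y i))) * Polynomial.X ^ (∑ j, d j) := by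
      intro i
      rw [dilateLift_mk, dilate_of_isHomogeneous g ((hd i).pderiv), map_mul]
      conv_rhs => rw [← Nat.sub_add_cancel (hle i), pow_add]
      ring
    refine (Finset.sum_congr rfl fun i _ => h2 i).trans ?_
    rw [← Finset.sum_mul, ← map_sum, ha k, map_zero, zero_mul]

end Dilate

/-- The largest homogeneous ideal contained in `P`. -/
noncomputable def homCore (P : Ideal (MvPolynomial (Fin N) K)) : Ideal (MvPolynomial (Fin N) K) :=
  RingHom.ker (dilate (Ideal.Quotient.mk P))

theorem mem_homCore {P : Ideal (MvPolynomial (Fin N) K)} {f : MvPolynomial (Fin N) K} :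
    f ∈ homCore P ↔ ∀ e, homogeneousComponent e f ∈ P := by
  rw [homCore, RingHom.mem_ker, Polynomial.ext_iff]
  simp only [coeff_dilate, Polynomial.coeff_zero, Ideal.Quotient.eq_zero_iff_mem]

theorem homCore_le (P : Ideal (MvPolynomial (Fin N) K)) : homCore P ≤ P := by
  intro f hf
  rw [← sum_homogeneousComponent f]
  exact Ideal.sum_mem _ fun e _ => mem_homCore.1 hf e

theorem homogeneousComponent_homogeneousComponent (f : MvPolynomial (Fin N) K) (e e' : ℕ) :
    homogeneousComponent e' (homogeneousComponent e f) =
      if e' = e then homogeneousComponent e f else 0 := by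
  rw [homogeneousComponent_of_mem (homogeneousComponent_isHomogeneous e f)]

theorem homIdeal_homCore (P : Ideal (MvPolynomial (Fin N) K)) : HomIdeal (homCore P) := by
  intro f hf e
  rw [mem_homCore] at hf ⊢
  intro e'
  rw [homogeneousComponent_homogeneousComponent]
  split_ifs
  · exact hf e
  · exact zero_mem _

instance (P : Ideal (MvPolynomial (Fin N) K)) [P.IsPrime] : (homCore P).IsPrime :=
  RingHom.ker_isPrime _

theorem mem_homCore_of_isHomogeneous {P : Ideal (MvPolynomial (Fin N) K)}
    {f : MvPolynomial (Fin N) K} {e : ℕ} (hf : f.IsHomogeneous e) (h : f ∈ P) :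
    f ∈ homCore P := by
  rw [mem_homCore]
  intro e'
  rw [homogeneousComponent_of_mem hf]
  split_ifs
  · exact h
  · exact zero_mem _

theorem JacDep.homCore {y : ι → MvPolynomial (Fin N) K} {P : Ideal (MvPolynomial (Fin N) K)}
    [P.IsPrime] {d : ι → ℕ} (hd : ∀ i, (y i).IsHomogeneous (d i)) (h : JacDep y P) :
    JacDep y (SmallSubalg.homCore P) := by
  obtain ⟨a, ⟨i0, hi0⟩, ha⟩ := h
  refine not_linearIndependent_dilate (Ideal.Quotient.mk P) hd
    (a := fun i => Ideal.Quotient.mk P (a i)) (i0 := i0)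
    (fun h => hi0 (Ideal.Quotient.eq_zero_iff_mem.1 h)) fun k => ?_
  simp only [← map_mul, ← map_sum]
  exact Ideal.Quotient.eq_zero_iff_mem.2 (ha k)

/-- The locus where `y` vanishes and has dependent differentials has codimension at least
`s` in the zero locus of `y` (when the latter has the expected dimension). -/
def Good (s : ℕ) (y : ι → MvPolynomial (Fin N) K) : Prop :=
  ∀ P : Ideal (MvPolynomial (Fin N) K), P.IsPrime → (∀ i, y i ∈ P) → JacDep y P →
    ((Fintype.card ι + s : ℕ) : ℕ∞) ≤ P.height

/-- All the entries of `y` are forms of positive degree at most `d`. -/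
def Forms (d : ℕ) (y : ι → MvPolynomial (Fin N) K) : Prop :=
  ∀ i, ∃ e : ℕ, 0 < e ∧ e ≤ d ∧ (y i).IsHomogeneous e

theorem good_of_homIdeal {s d : ℕ} {y : ι → MvPolynomial (Fin N) K} (hy : Forms d y)
    (h : ∀ P : Ideal (MvPolynomial (Fin N) K), P.IsPrime → HomIdeal P → (∀ i, y i ∈ P) →
      JacDep y P → ((Fintype.card ι + s : ℕ) : ℕ∞) ≤ P.height) : Good s y := by
  intro P hP hyP hJ
  choose e _ _ he using hy
  exact (h (homCore P) inferInstance (homIdeal_homCore P)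
    (fun i => mem_homCore_of_isHomogeneous (he i) (hyP i)) (hJ.homCore he)).trans
    (Ideal.height_mono (homCore_le P))

/-- The irrelevant ideal. -/
noncomputable def irrel : Ideal (MvPolynomial (Fin N) K) :=
  RingHom.ker (constantCoeff : MvPolynomial (Fin N) K →+* K)

instance : (irrel : Ideal (MvPolynomial (Fin N) K)).IsPrime := RingHom.ker_isPrime _

theorem HomIdeal.le_irrel {P : Ideal (MvPolynomial (Fin N) K)} (hP : HomIdeal P) (h : P ≠ ⊤) :
    P ≤ irrel := by
  intro f hf
  have h1 := hP f hf 0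
  rw [homogeneousComponent_zero] at h1
  rw [irrel, RingHom.mem_ker, constantCoeff_eq]
  by_contra h2
  exact h (Ideal.eq_top_of_isUnit_mem _ h1 ((isUnit_iff_ne_zero.2 h2).map C))

theorem Forms.mem_irrel {d : ℕ} {y : ι → MvPolynomial (Fin N) K} (hy : Forms d y) (i : ι) :
    y i ∈ (irrel : Ideal (MvPolynomial (Fin N) K)) := by
  obtain ⟨e, he, -, h⟩ := hy i
  rw [irrel, RingHom.mem_ker, constantCoeff_eq]
  by_contra h2
  have h3 := h h2
  simp at h3
  omega

theorem Good.comp {s d : ℕ} {κ : Type*} [Fintype κ] {y : ι → MvPolynomial (Fin N) K}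
    (hy : Forms d y) (h : Good s y) (f : κ → ι) (hf : Function.Injective f) : Good s (y ∘ f) := by
  classical
  refine good_of_homIdeal (fun i => hy (f i)) fun P hP hom hyP hJ => ?_
  let c : Finset ι := (Finset.univ.image f)ᶜ
  obtain ⟨P', hP', hPP', ht, -, hh⟩ := exists_prime_height_le (hom.le_irrel hP.ne_top)
    (t := c.image y) (by
      intro x hx
      obtain ⟨i, -, rfl⟩ := Finset.mem_image.1 hx
      exact hy.mem_irrel i)
  have hyP' : ∀ i, y i ∈ P' := by
    intro i
    by_cases hi : i ∈ c
    · exact ht _ (Finset.mem_image_of_mem _ hi)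
    · simp only [c, Finset.mem_compl, Finset.mem_image, Finset.mem_univ, true_and, not_not] at hi
      obtain ⟨j, rfl⟩ := hi
      exact hPP' (hyP j)
  have hJ' : JacDep y P := by
    obtain ⟨a, ⟨j, hj⟩, ha⟩ := hJ
    refine ⟨Function.extend f a 0, ⟨f j, by rwa [hf.extend_apply]⟩, fun k => ?_⟩
    convert ha k using 1
    rw [← Finset.sum_subset (Finset.subset_univ (Finset.univ.image f)),
      Finset.sum_image (fun _ _ _ _ h => hf h)]
    · refine Finset.sum_congr rfl fun i _ => ?_
      rw [hf.extend_apply]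
      rfl
    · intro i _ hi
      rw [Function.extend_apply', Pi.zero_apply, zero_mul]
      simpa using hi
  have h1 := (h P' hP' hyP' (hJ'.mono hPP')).trans hh
  have h2 : (c.image y).card + Fintype.card κ ≤ Fintype.card ι := by
    have h3 : c.card = Fintype.card ι - Fintype.card κ := by
      rw [Finset.card_compl, Finset.card_image_of_injective _ hf, Finset.card_univ]
    have h4 := Finset.card_image_le (s := c) (f := y)
    have h5 := Fintype.card_le_of_injective f hf
    omega
  have h6 : ((Fintype.card κ + s : ℕ) : ℕ∞) + ((c.image y).card : ℕ∞) ≤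
      P.height + ((c.image y).card : ℕ∞) := by
    refine le_trans ?_ h1
    exact_mod_cast (by omega)
  exact (ENat.add_le_add_iff_right (ENat.natCast_ne_top _)).1 h6

theorem Good.isRegularLocalRing {s : ℕ} {y : ι → MvPolynomial (Fin N) K} (h : Good s y)
    {I : Ideal (MvPolynomial (Fin N) K)} (hI : I = Ideal.span (Set.range y))
    (q : Ideal (MvPolynomial (Fin N) K ⧸ I)) [hq : q.IsPrime] (hs : q.height < s) :
    IsRegularLocalRing (Localization.AtPrime q) := by
  refine isRegularLocalRing_of_not_jacDep hI q fun hJ => ?_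
  have h1 := (h _ inferInstance (fun i => ?_) hJ).trans (height_comap_mk_le hI q)
  · rw [Nat.add_comm, Nat.cast_add, ENat.add_le_add_iff_right (ENat.natCast_ne_top _)] at h1
    exact absurd h1 (not_le.2 hs)
  · rw [Ideal.mem_comap, Ideal.Quotient.eq_zero_iff_mem.2 (hI ▸ Ideal.subset_span ⟨i, rfl⟩)]
    exact zero_mem _

theorem Forms.span_ne_top {d : ℕ} {y : ι → MvPolynomial (Fin N) K} (hy : Forms d y) :
    Ideal.span (Set.range y) ≠ ⊤ := by
  refine ne_top_of_le_ne_top (Ideal.IsPrime.ne_top (I := irrel) inferInstance) ?_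
  rw [Ideal.span_le]
  rintro _ ⟨i, rfl⟩
  exact hy.mem_irrel i

theorem isSerreSeq_of_good {n d s : ℕ} {y : Fin n → MvPolynomial (Fin N) K} (hy : Forms d y)
    (h : Good (s + 1) y) : IsSerreSeq s y := by
  refine ⟨hy.span_ne_top, fun m hm p hp => ?_⟩
  have h1 : Good (s + 1) (y ∘ (fun j : {j : Fin n // (j : ℕ) < m} => j.1)) :=
    h.comp hy _ Subtype.val_injective
  have := h1.isRegularLocalRing (I := Ideal.span (y '' {j : Fin n | (j : ℕ) < m}))
    (by rw [Set.range_comp, Subtype.range_coe_subtype]) p.asIdeal (by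
      rw [p.height_eq_orderHeight]
      exact lt_of_le_of_lt hp (by exact_mod_cast Nat.lt_succ_self s))
  exact isRegularLocal_of_isRegularLocalRing _

end Good

theorem le_height_of_forall_isPrime {A : Type*} [CommRing A] {I : Ideal A} {n : ℕ∞}
    (h : ∀ P : Ideal A, P.IsPrime → I ≤ P → n ≤ P.height) : n ≤ I.height := by
  rw [Ideal.height_eq_inf_minimalPrimes]
  exact le_iInf₂ fun P hP => h P hP.1.1 hP.1.2

theorem mem_sup_span_singleton_iff {A : Type*} [CommRing A] {I : Ideal A} {a x : A} :
    x ∈ I ⊔ Ideal.span {a} ↔ ∃ i ∈ I, ∃ y, x = i + a * y := by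
  rw [sup_comm, Ideal.mem_span_singleton_sup]
  constructor
  · rintro ⟨y, i, hi, rfl⟩
    exact ⟨i, hi, y, by ring⟩
  · rintro ⟨i, hi, y, rfl⟩
    exact ⟨y, i, hi, by ring⟩

section Prime

variable {K : Type*} [Field K] {N : ℕ} {ι : Type*} [Fintype ι]

theorem Good.card_le_height {s : ℕ} {y : ι → MvPolynomial (Fin N) K} (h : Good s y) :
    (Fintype.card ι : ℕ∞) ≤ (Ideal.span (Set.range y)).height := by
  refine le_height_of_forall_isPrime fun P hPp hP => ?_
  have hyP : ∀ i, y i ∈ P := fun i => hP (Ideal.subset_span ⟨i, rfl⟩)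
  by_cases hJ : JacDep y P
  · refine le_trans ?_ (h P hPp hyP hJ)
    exact_mod_cast Nat.le_add_right _ _
  · exact card_le_height_of_not_jacDep hyP hJ

theorem coeff_dilate_id (f : MvPolynomial (Fin N) K) (e : ℕ) :
    (dilate (RingHom.id _) f).coeff e = homogeneousComponent e f := coeff_dilate _ f e

theorem homogeneousComponent_mul_of_isHomogeneous {f y : MvPolynomial (Fin N) K} {d : ℕ}
    (hy : y.IsHomogeneous d) (e : ℕ) :
    homogeneousComponent e (f * y) = if d ≤ e then homogeneousComponent (e - d) f * y else 0 := by
  rw [← coeff_dilate_id, map_mul, dilate_of_isHomogeneous _ hy, ← mul_assoc,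
    Polynomial.coeff_mul_X_pow', Polynomial.coeff_mul_C, coeff_dilate_id]
  rfl

theorem homIdeal_span {d : ℕ} {y : ι → MvPolynomial (Fin N) K} (hy : Forms d y) :
    HomIdeal (Ideal.span (Set.range y)) := by
  intro f hf e
  obtain ⟨c, rfl⟩ := Ideal.mem_span_range_iff_exists_fun.1 hf
  rw [map_sum]
  refine Ideal.sum_mem _ fun i _ => ?_
  obtain ⟨d', -, -, h⟩ := hy i
  rw [homogeneousComponent_mul_of_isHomogeneous h]
  split_ifs
  · exact Ideal.mul_mem_left _ _ (Ideal.subset_span ⟨i, rfl⟩)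
  · exact zero_mem _

theorem homogeneousComponent_pow_of_lt {f : MvPolynomial (Fin N) K} (hf : f ∈ irrel) {k n : ℕ}
    (h : k < n) : homogeneousComponent k (f ^ n) = 0 := by
  have h1 : Polynomial.X ∣ dilate (RingHom.id _) f := by
    rw [Polynomial.X_dvd_iff, coeff_dilate_id, homogeneousComponent_zero, ← constantCoeff_eq,
      show constantCoeff f = 0 from hf, C_0]
  rw [← coeff_dilate_id, map_pow]
  exact (Polynomial.X_pow_dvd_iff.1 (pow_dvd_pow_of_dvd h1 n)) k h

theorem HomIdeal.mem_of_isIdempotent {G : Ideal (MvPolynomial (Fin N) K)} (hG : HomIdeal G)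
    {e : MvPolynomial (Fin N) K} (he : e * (1 - e) ∈ G) (h0 : e ∈ irrel) : e ∈ G := by
  have h1 : ∀ n, e - e ^ (n + 1) ∈ G := by
    intro n
    induction n with
    | zero => simp
    | succ n ih =>
      have : e - e ^ (n + 1 + 1) = (e - e ^ (n + 1)) + e ^ n * (e * (1 - e)) := by ring
      rw [this]
      exact add_mem ih (G.mul_mem_left _ he)
  rw [← sum_homogeneousComponent e]
  refine Ideal.sum_mem _ fun k _ => ?_
  have h2 := hG _ (h1 k) k
  rwa [map_sub, homogeneousComponent_pow_of_lt h0 (Nat.lt_succ_self k), sub_zero] at h2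

theorem HomIdeal.mem_or_mem_of_isIdempotent {G : Ideal (MvPolynomial (Fin N) K)}
    (hG : HomIdeal G) (hG' : G ≠ ⊤) {e : MvPolynomial (Fin N) K} (he : e * (1 - e) ∈ G) :
    e ∈ G ∨ 1 - e ∈ G := by
  rcases Ideal.IsPrime.mem_or_mem inferInstance (hG.le_irrel hG' he) with h | h
  · exact Or.inl (hG.mem_of_isIdempotent he h)
  · refine Or.inr (hG.mem_of_isIdempotent ?_ h)
    rwa [sub_sub_cancel, mul_comm]

/-- A nonzerodivisor statement: `y` with `u` appended is Cohen–Macaulay. -/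
theorem exists_avoiding {s : ℕ} {y : ι → MvPolynomial (Fin N) K} (h : Good s y)
    {H : Ideal (MvPolynomial (Fin N) K)}
    (hH : ((Fintype.card ι + 1 : ℕ) : ℕ∞) ≤ H.height) :
    ∃ u ∈ H, ((Fintype.card ι + 1 : ℕ) : ℕ∞) ≤
      (Ideal.span (Set.range y) ⊔ Ideal.span {u}).height := by
  classical
  set G := Ideal.span (Set.range y) with hG
  have hfin : G.minimalPrimes.Finite := Ideal.finite_minimalPrimes_of_isNoetherianRing _ G
  have hht : ∀ P ∈ G.minimalPrimes, P.height ≤ Fintype.card ι := by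
    intro P hP
    have hr : Ideal.span ((Finset.univ.image y : Finset _) : Set (MvPolynomial (Fin N) K)) = G := by
      simp [hG]
    have h1 := Ideal.height_le_card_of_mem_minimalPrimes_span_finset (s := Finset.univ.image y)
      (hr.symm ▸ hP)
    refine h1.trans ?_
    exact_mod_cast (Finset.card_image_le : (Finset.univ.image y).card ≤ _)
  obtain ⟨u, huH, hu⟩ : ∃ u ∈ H, ∀ P ∈ G.minimalPrimes, u ∉ P := by
    by_contra! hcon
    have h1 : (H : Set (MvPolynomial (Fin N) K)) ⊆ ⋃ P ∈ (hfin.toFinset : Set (Ideal (MvPolynomial (Fin N) K))),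
        ((id P : Ideal (MvPolynomial (Fin N) K)) : Set (MvPolynomial (Fin N) K)) := by
      intro u hu
      obtain ⟨P, hP, huP⟩ := hcon u hu
      simp only [Set.mem_iUnion]
      exact ⟨P, by simpa using hP, huP⟩
    rw [Ideal.subset_union_prime (f := id) ⊤ ⊤ (fun P hP _ _ => by
      rw [Set.Finite.mem_toFinset] at hP; exact hP.1.1)] at h1
    obtain ⟨P, hP, hle⟩ := h1
    rw [Set.Finite.mem_toFinset] at hP
    have h2 := hH.trans ((Ideal.height_mono hle).trans (hht P hP))
    exact absurd h2 (by exact_mod_cast (by omega))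
  refine ⟨u, huH, ?_⟩
  refine le_height_of_forall_isPrime fun P hPp hP => ?_
  have hGP : G ≤ P := le_sup_left.trans hP
  obtain ⟨P0, hP0, hle⟩ := Ideal.exists_minimalPrimes_le hGP
  have hP0p : P0.IsPrime := hP0.1.1
  have hlt : P0 < P := lt_of_le_of_ne hle fun he => hu P0 hP0 (he ▸ hP
    (Ideal.mem_sup_right (Ideal.mem_span_singleton_self u)))
  have h1 := Ideal.height_add_one_le_of_lt_of_isPrime hlt
  have h2 : (Fintype.card ι : ℕ∞) ≤ P0.height := h.card_le_height.trans (Ideal.height_mono hP0.1.2)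
  push_cast
  exact (by gcongr : (Fintype.card ι : ℕ∞) + 1 ≤ P0.height + 1).trans h1

theorem Good.mem_span_of_colon {s : ℕ} {y : ι → MvPolynomial (Fin N) K} (h : Good s y)
    {J : Ideal (MvPolynomial (Fin N) K)} {z : MvPolynomial (Fin N) K}
    (hJ : ∀ x ∈ J, x * z ∈ Ideal.span (Set.range y))
    (hh : ((Fintype.card ι + 1 : ℕ) : ℕ∞) ≤ J.height) : z ∈ Ideal.span (Set.range y) := by
  classical
  have hr : ((Finset.univ.image y : Finset _) : Set (MvPolynomial (Fin N) K)) = Set.range y := by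
    simp
  have hc : (Finset.univ.image y).card ≤ Fintype.card ι := Finset.card_image_le
  have := mem_span_of_colon_height (t := Finset.univ.image y) (J := J) (z := z)
    (by rw [hr]; exact le_trans (by exact_mod_cast hc) h.card_le_height) (by rwa [hr])
    (le_trans (by exact_mod_cast Nat.succ_le_succ hc) hh)
  rwa [hr] at this

theorem Good.mem_span_sup_of_colon {y : ι → MvPolynomial (Fin N) K}
    {u : MvPolynomial (Fin N) K}
    (hu : ((Fintype.card ι + 1 : ℕ) : ℕ∞) ≤
      (Ideal.span (Set.range y) ⊔ Ideal.span {u}).height)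
    {J : Ideal (MvPolynomial (Fin N) K)} {z : MvPolynomial (Fin N) K}
    (hJ : ∀ x ∈ J, x * z ∈ Ideal.span (Set.range y) ⊔ Ideal.span {u})
    (hh : ((Fintype.card ι + 2 : ℕ) : ℕ∞) ≤ J.height) :
    z ∈ Ideal.span (Set.range y) ⊔ Ideal.span {u} := by
  classical
  have hr : Ideal.span ((insert u (Finset.univ.image y) : Finset _) :
      Set (MvPolynomial (Fin N) K)) = Ideal.span (Set.range y) ⊔ Ideal.span {u} := by
    rw [Finset.coe_insert, Ideal.span_insert, sup_comm]
    simp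
  have hc : (insert u (Finset.univ.image y)).card ≤ Fintype.card ι + 1 :=
    (Finset.card_insert_le _ _).trans (Nat.succ_le_succ Finset.card_image_le)
  have := mem_span_of_colon_height (t := insert u (Finset.univ.image y)) (J := J) (z := z)
    (by rw [hr]; exact le_trans (by exact_mod_cast hc) hu) (by rwa [hr])
    (le_trans (by exact_mod_cast Nat.succ_le_succ hc) hh)
  rwa [hr] at this

theorem Good.isRegularLocalRing_of_height_lt {s : ℕ} {y : ι → MvPolynomial (Fin N) K}
    (h : Good s y) {I : Ideal (MvPolynomial (Fin N) K)} (hI : I = Ideal.span (Set.range y))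
    (Q : Ideal (MvPolynomial (Fin N) K)) [Q.IsPrime] (hQ : I ≤ Q)
    (hs : Q.height < ((Fintype.card ι + s : ℕ) : ℕ∞)) :
    ∃ q : Ideal (MvPolynomial (Fin N) K ⧸ I), ∃ _ : q.IsPrime,
      q.comap (Ideal.Quotient.mk I) = Q ∧ IsRegularLocalRing (Localization.AtPrime q) := by
  have hq : (Q.map (Ideal.Quotient.mk I)).IsPrime :=
    Ideal.map_isPrime_of_surjective Ideal.Quotient.mk_surjective (by rwa [Ideal.mk_ker])
  have hc : (Q.map (Ideal.Quotient.mk I)).comap (Ideal.Quotient.mk I) = Q := by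
    rw [Ideal.comap_map_of_surjective _ Ideal.Quotient.mk_surjective, ← RingHom.ker_eq_comap_bot,
      Ideal.mk_ker, sup_eq_left.2 hQ]
  refine ⟨_, hq, hc, isRegularLocalRing_of_not_jacDep hI _ fun hJ => ?_⟩
  rw [hc] at hJ
  refine absurd (h Q inferInstance (fun i => hQ (hI ▸ Ideal.subset_span ⟨i, rfl⟩)) hJ) (not_le.2 hs)

/-- Elements of an ideal `J` that vanish locally at `Q` are killed by one element outside `Q`. -/
theorem exists_notMem_mul_mem {A : Type*} [CommRing A] {G J Q : Ideal A} [Q.IsPrime] (hJ : J.FG)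
    (h : ∀ j ∈ J, ∃ s ∉ Q, s * j ∈ G) : ∃ s ∉ Q, ∀ j ∈ J, s * j ∈ G := by
  classical
  obtain ⟨t, rfl⟩ := hJ
  have h' : ∀ j : t, ∃ s ∉ Q, s * (j : A) ∈ G := fun j => h j (Ideal.subset_span j.2)
  choose s hs hsG using h'
  refine ⟨∏ j, s j, fun hmem => ?_, fun j hj => ?_⟩
  · obtain ⟨j, -, hj⟩ := (Ideal.IsPrime.prod_mem_iff (p := Q)).1 hmem
    exact hs j hj
  · refine Submodule.span_induction (p := fun j _ => (∏ j, s j) * j ∈ G) ?_ ?_ ?_ ?_ hj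
    · intro x hx
      rw [← Finset.mul_prod_erase _ _ (Finset.mem_univ (⟨x, hx⟩ : t)), mul_assoc, mul_comm, mul_assoc]
      refine G.mul_mem_left _ ?_
      rw [mul_comm]
      exact hsG ⟨x, hx⟩
    · simp
    · intro x y _ _ hx hy
      rw [mul_add]
      exact add_mem hx hy
    · intro a x _ hx
      rw [smul_eq_mul, mul_left_comm]
      exact G.mul_mem_left _ hx

theorem Good.isPrime_span {d : ℕ} {y : ι → MvPolynomial (Fin N) K} (hy : Forms d y)
    (h : Good 2 y) : (Ideal.span (Set.range y)).IsPrime := by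
  set G := Ideal.span (Set.range y) with hG
  refine ⟨hy.span_ne_top, fun {a b} hab => ?_⟩
  by_contra! hcon
  obtain ⟨ha, hb⟩ := hcon
  let J : Ideal (MvPolynomial (Fin N) K) :=
    { carrier := {x | x * a ∈ G}
      add_mem' := fun {x x'} hx hx' => by
        simp only [Set.mem_ofPred_eq, add_mul] at *; exact add_mem hx hx'
      zero_mem' := by simp
      smul_mem' := fun c x hx => by
        simp only [Set.mem_ofPred_eq, smul_eq_mul, mul_assoc] at *; exact G.mul_mem_left _ hx }
  let I : Ideal (MvPolynomial (Fin N) K) :=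
    { carrier := {x | ∀ j ∈ J, x * j ∈ G}
      add_mem' := fun {x x'} hx hx' j hj => by
        rw [add_mul]; exact add_mem (hx j hj) (hx' j hj)
      zero_mem' := fun j _ => by simp
      smul_mem' := fun c x hx j hj => by
        rw [smul_eq_mul, mul_assoc]; exact G.mul_mem_left _ (hx j hj) }
  have haI : a ∈ I := fun j hj => by rw [mul_comm]; exact hj
  have hbJ : b ∈ J := show b * a ∈ G by rwa [mul_comm]
  have hGJ : G ≤ J := fun x hx => G.mul_mem_right _ hx
  have hIJ : ∀ i ∈ I, ∀ j ∈ J, i * j ∈ G := fun i hi j hj => hi j hj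
  have hH : ((Fintype.card ι + 2 : ℕ) : ℕ∞) ≤ (I ⊔ J).height := by
    refine le_height_of_forall_isPrime fun Q hQp hQ => ?_
    by_contra! hlt
    have hIQ : I ≤ Q := le_sup_left.trans hQ
    have hJQ : J ≤ Q := le_sup_right.trans hQ
    obtain ⟨q, hq, hqQ, hreg⟩ := h.isRegularLocalRing_of_height_lt hG Q (hGJ.trans hJQ) hlt
    have hdom := isDomain_of_regular (Localization.AtPrime q)
    have hzero : ∀ x, algebraMap _ (Localization.AtPrime q) (Ideal.Quotient.mk G x) = 0 ↔
        ∃ s ∉ Q, s * x ∈ G := by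
      intro x
      rw [IsLocalization.map_eq_zero_iff q.primeCompl]
      constructor
      · rintro ⟨⟨m, hm⟩, hmx⟩
        obtain ⟨m, rfl⟩ := Ideal.Quotient.mk_surjective m
        refine ⟨m, fun hmQ => hm (by rw [← hqQ] at hmQ; exact hmQ), ?_⟩
        rw [← Ideal.Quotient.eq_zero_iff_mem, map_mul]
        exact hmx
      · rintro ⟨s, hs, hsx⟩
        refine ⟨⟨Ideal.Quotient.mk G s, fun hmem => hs (by rw [← hqQ]; exact hmem)⟩, ?_⟩
        rw [← Ideal.Quotient.eq_zero_iff_mem, map_mul] at hsx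
        exact hsx
    have ha0 : algebraMap _ (Localization.AtPrime q) (Ideal.Quotient.mk G a) ≠ 0 := by
      rw [Ne, hzero]
      rintro ⟨s, hs, hsa⟩
      exact hs (hJQ hsa)
    obtain ⟨s, hs, hsJ⟩ := exists_notMem_mul_mem (G := G) (Q := Q)
      (IsNoetherian.noetherian J) (fun j hj => by
        rw [← hzero]
        have h1 : algebraMap _ (Localization.AtPrime q) (Ideal.Quotient.mk G (j * a)) = 0 := by
          rw [Ideal.Quotient.eq_zero_iff_mem.2 (show j * a ∈ G from hj), map_zero]
        rw [map_mul, map_mul] at h1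
        exact (mul_eq_zero.1 h1).resolve_right ha0)
    exact hs (hIQ hsJ)
  have hH1 : ((Fintype.card ι + 1 : ℕ) : ℕ∞) ≤ (I ⊔ J).height :=
    le_trans (by exact_mod_cast Nat.le_succ _) hH
  obtain ⟨u, huH, hu⟩ := exists_avoiding h hH1
  obtain ⟨i, hi, j, hj, rfl⟩ := Submodule.mem_sup.1 huH
  have hjm : j ∈ G ⊔ Ideal.span {i + j} := by
    refine Good.mem_span_sup_of_colon hu (J := I ⊔ J) (fun v hv => ?_) hH
    obtain ⟨i', hi', j', hj', rfl⟩ := Submodule.mem_sup.1 hv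
    have : (i' + j') * j = (i' * j - i * j') + (i + j) * j' := by ring
    rw [this]
    exact add_mem (Ideal.mem_sup_left (sub_mem (hIJ _ hi' _ hj) (hIJ _ hi _ hj')))
      (Ideal.mem_sup_right (Ideal.mul_mem_right _ _ (Ideal.mem_span_singleton_self _)))
  obtain ⟨g, hg, e, he⟩ := mem_sup_span_singleton_iff.1 hjm
  have hv : ∀ i' ∈ I, ∀ j' ∈ J, (i' + j') * e - j' ∈ G := by
    intro i' hi' j' hj'
    refine h.mem_span_of_colon (J := G ⊔ Ideal.span {i + j}) (fun x hx => ?_) hu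
    obtain ⟨g', hg', x, rfl⟩ := mem_sup_span_singleton_iff.1 hx
    have h1 : (g' + (i + j) * x) * ((i' + j') * e - j') = g' * ((i' + j') * e - j') +
        x * ((i' * j - i * j') - (i' + j') * g) := by
      have : j = g + (i + j) * e := he
      linear_combination (-(x * (i' + j'))) * this
    rw [h1]
    exact add_mem (G.mul_mem_right _ hg') (G.mul_mem_left _ (sub_mem (sub_mem (hIJ _ hi' _ hj)
      (hIJ _ hi _ hj')) (G.mul_mem_left _ hg)))
  have hid : e * (1 - e) ∈ G := by
    refine h.mem_span_of_colon (J := I ⊔ J) (fun v hvm => ?_) hH1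
    obtain ⟨i', hi', j', hj', rfl⟩ := Submodule.mem_sup.1 hvm
    have h1 := hv i' hi' j' hj'
    have h2 := hv 0 I.zero_mem j' hj'
    have : (i' + j') * (e * (1 - e)) = (1 - e) * ((i' + j') * e - j') - ((0 + j') * e - j') := by
      ring
    rw [this]
    exact sub_mem (G.mul_mem_left _ h1) h2
  rcases (homIdeal_span hy).mem_or_mem_of_isIdempotent hy.span_ne_top hid with he | he
  · apply hb
    have h1 := hv 0 I.zero_mem b hbJ
    have : b = (0 + b) * e - ((0 + b) * e - b) := by ring
    rw [this]
    exact sub_mem (G.mul_mem_left _ he) h1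
  · apply ha
    have h1 := hv a haI 0 J.zero_mem
    have : a = a * (1 - e) + ((a + 0) * e - 0) := by ring
    rw [this]
    exact add_mem (G.mul_mem_left _ he) h1

end Prime

section PthPower

/-- In characteristic `p`, an element outside the subfield of `p`-th powers has a nonzero
differential over some subfield containing all `p`-th powers. -/
theorem exists_subfield_kaehlerDifferential_ne_zero {L : Type*} [Field L] {p : ℕ} [Fact p.Prime]
    [CharP L p] {f : L} (hf : ∀ l : L, l ^ p ≠ f) :
    ∃ E : Subfield L, (∀ l : L, l ^ p ∈ E) ∧ KaehlerDifferential.D E L f ≠ 0 := by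
  have hp : p.Prime := Fact.out
  have hpp : ∀ l : L, l ^ p ∈ (frobenius L p).fieldRange := fun l => ⟨l, rfl⟩
  obtain ⟨E, hFE, hE⟩ := zorn_le_nonempty₀ {E : Subfield L | f ∉ E} (fun c hc hch E hEc =>
    ⟨sSup c, fun hmem => by
      rw [Subfield.mem_sSup_of_directedOn ⟨E, hEc⟩ hch.directedOn] at hmem
      obtain ⟨E', hE', hfE'⟩ := hmem
      exact hc hE' hfE', fun z hz => le_sSup hz⟩) (frobenius L p).fieldRange
    (by rintro ⟨l, hl⟩; exact hf l hl)
  have hpE : ∀ l : L, l ^ p ∈ E := fun l => hFE (hpp l)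
  have hfE : f ∉ E := hE.1
  refine ⟨E, hpE, fun hD => ?_⟩
  have hirr : ∀ x : L, x ∉ E →
      Irreducible (Polynomial.X ^ p - Polynomial.C (⟨x ^ p, hpE x⟩ : E)) := fun x hx =>
    X_pow_sub_C_irreducible_of_prime hp fun b hb => hx (by
      have h1 : (b : L) ^ p = x ^ p := congrArg Subtype.val hb
      have h2 : (b : L) = x := frobenius_inj L p h1
      exact h2 ▸ b.2)
  have hroot : ∀ x : L, Polynomial.aeval x
      (Polynomial.X ^ p - Polynomial.C (⟨x ^ p, hpE x⟩ : E)) = 0 := fun x => by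
    rw [map_sub, map_pow, Polynomial.aeval_X, Polynomial.aeval_C]
    exact sub_self _
  have hxint : ∀ x : L, IsIntegral E x := fun x =>
    ⟨_, Polynomial.monic_X_pow_sub_C _ hp.ne_zero, hroot x⟩
  have hrank : ∀ x : L, x ∉ E → Module.finrank E (IntermediateField.adjoin E {x}) = p :=
    fun x hx => by
      rw [IntermediateField.adjoin.finrank (hxint x),
        ← minpoly.eq_of_irreducible_of_monic (hirr x hx) (hroot x)
          (Polynomial.monic_X_pow_sub_C _ hp.ne_zero), Polynomial.natDegree_X_pow_sub_C]
  have htop : IntermediateField.adjoin E {f} = ⊤ := by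
    refine top_le_iff.1 fun x _ => ?_
    by_cases hx : x ∈ E
    · exact (IntermediateField.adjoin E {f}).algebraMap_mem ⟨x, hx⟩
    have hfx : f ∈ IntermediateField.adjoin E {x} := by
      by_contra hcon
      have hle : E ≤ (IntermediateField.adjoin E {x}).toSubfield := fun e he =>
        (IntermediateField.adjoin E {x}).algebraMap_mem ⟨e, he⟩
      exact hx (hE.2 (y := (IntermediateField.adjoin E {x}).toSubfield) hcon hle
        (IntermediateField.mem_adjoin_simple_self E x))
    have := IntermediateField.adjoin.finiteDimensional (hxint x)
    have heq := IntermediateField.eq_of_le_of_finrank_eq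
      (F := IntermediateField.adjoin E {f}) (E := IntermediateField.adjoin E {x})
      (by rw [IntermediateField.adjoin_le_iff]; simpa using hfx)
      (by rw [hrank f hfE, hrank x hx])
    rw [heq]
    exact IntermediateField.mem_adjoin_simple_self E x
  have hfin : FiniteDimensional E L := by
    have := IntermediateField.adjoin.finiteDimensional (hxint f)
    rw [htop] at this
    exact Module.Finite.equiv (IntermediateField.topEquiv (F := E) (E := L)).toLinearEquiv
  have halg : Algebra.adjoin E {f} = ⊤ := by
    rw [← IntermediateField.adjoin_simple_toSubalgebra_of_isAlgebraic (hxint f).isAlgebraic, htop]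
    rfl
  have hD0 : ∀ x : L, KaehlerDifferential.D E L x = 0 := fun x => by
    have : x ∈ Algebra.adjoin E {f} := halg ▸ trivial
    exact Derivation.eqOn_adjoin (D1 := KaehlerDifferential.D E L) (D2 := 0)
      (by intro y hy; rw [Set.mem_singleton_iff.1 hy]; simpa using hD) this
  have hun : Algebra.FormallyUnramified E L := by
    refine ⟨subsingleton_of_forall_eq 0 fun w => ?_⟩
    have hw : w ∈ Submodule.span L (Set.range (KaehlerDifferential.D E L)) :=
      KaehlerDifferential.span_range_derivation E L ▸ trivial
    have hr : Set.range (KaehlerDifferential.D E L) ⊆ {0} := by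
      rintro _ ⟨x, rfl⟩; exact hD0 x
    simpa using Submodule.span_mono hr hw
  have hsep : Algebra.IsSeparable E L := Algebra.FormallyUnramified.isSeparable E L
  have hs := Algebra.IsSeparable.isSeparable E f
  rw [IsSeparable, ← minpoly.eq_of_irreducible_of_monic (hirr f hfE) (hroot f)
    (Polynomial.monic_X_pow_sub_C _ hp.ne_zero)] at hs
  rw [Polynomial.separable_def] at hs
  simp only [Polynomial.derivative_sub, Polynomial.derivative_X_pow, CharP.cast_eq_zero,
    Polynomial.derivative_C, map_zero, zero_mul, sub_zero] at hs
  exact (hirr f hfE).not_isUnit (isCoprime_zero_right.1 hs)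

variable {K : Type*} [Field K] {N : ℕ}

theorem exists_pow_eq_of_pderiv {L : Type*} [Field L] {p : ℕ} [Fact p.Prime]
    [CharP L p] (g : MvPolynomial (Fin N) K →+* L) (hK : ∀ c : K, ∃ b : K, b ^ p = c)
    {F : MvPolynomial (Fin N) K} (hF : ∀ k, g (pderiv k F) = 0) : ∃ l : L, l ^ p = g F := by
  by_contra! hcon
  obtain ⟨E, hpE, hE⟩ := exists_subfield_kaehlerDifferential_ne_zero hcon
  refine hE ?_
  have hC : ∀ c : K, KaehlerDifferential.D E L (g (C c)) = 0 := fun c => by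
    obtain ⟨b, rfl⟩ := hK c
    have h1 : g (C (b ^ p)) = algebraMap E L ⟨g (C b) ^ p, hpE _⟩ := by
      rw [map_pow, map_pow]; rfl
    rw [h1, Derivation.map_algebraMap]
  have key : ∀ G : MvPolynomial (Fin N) K, KaehlerDifferential.D E L (g G) =
      ∑ k, g (pderiv k G) • KaehlerDifferential.D E L (g (X k)) := fun G => by
    induction G using MvPolynomial.induction_on with
    | C c => simp [hC]
    | add P Q hP hQ => simp [hP, hQ, add_smul, Finset.sum_add_distrib]
    | mul_X P j hP =>
      rw [map_mul, Derivation.leibniz, hP]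
      simp only [Derivation.leibniz, smul_eq_mul, map_add, map_mul, add_smul,
        Finset.sum_add_distrib, pderiv_X, Finset.smul_sum, smul_smul]
      congr 1
      rw [Finset.sum_eq_single j]
      · simp
      · intro k _ hk
        simp [hk.symm]
      · simp
  rw [key]
  simp [hF]

theorem exists_prime_lt_lt {A : Type*} [CommRing A] (q : Ideal A) [q.IsPrime] (h : 2 ≤ q.height) :
    ∃ q₀ q₁ : Ideal A, q₀.IsPrime ∧ q₁.IsPrime ∧ q₀ < q₁ ∧ q₁ < q := by
  have h1 : ((2 : ℕ) : ℕ∞) ≤ Order.height (⟨q, inferInstance⟩ : PrimeSpectrum A) := by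
    rw [← PrimeSpectrum.height_eq_orderHeight]
    exact_mod_cast h
  obtain ⟨l, hl, hlen⟩ := Order.exists_series_of_le_height _ h1
  refine ⟨(l ⟨0, by omega⟩).asIdeal, (l ⟨1, by omega⟩).asIdeal, inferInstance, inferInstance,
    l.strictMono (by simp [Fin.lt_def]), ?_⟩
  have h2 : l ⟨1, by omega⟩ < RelSeries.last l := l.strictMono (by simp [Fin.lt_def, hlen])
  rw [hl] at h2
  exact h2

theorem dvd_total_of_height_le_one {A : Type*} [CommRing A] [IsNoetherianRing A] [IsDomain A]
    (q : Ideal A) [q.IsPrime] (h : q.height ≤ 1) [IsRegularLocalRing (Localization.AtPrime q)] :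
    ∀ a b : Localization.AtPrime q, a ∣ b ∨ b ∣ a := by
  have hd : IsDomain (Localization.AtPrime q) :=
    IsLocalization.isDomain_localization q.primeCompl_le_nonZeroDivisors
  suffices hval : ValuationRing (Localization.AtPrime q) from ValuationRing.dvd_total
  refine ((tfae_of_isNoetherianRing_of_isLocalRing_of_isDomain (Localization.AtPrime q)).out 5 1).1 ?_
  have h1 := (IsRegularLocalRing.iff_finrank_cotangentSpace (Localization.AtPrime q)).1 inferInstance
  rw [← maximalIdeal_height_eq_ringKrullDim, height_maximalIdeal_atPrime] at h1
  have h2 : ((Module.finrank (ResidueField (Localization.AtPrime q))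
      (CotangentSpace (Localization.AtPrime q)) : ℕ) : ℕ∞) = q.height := by exact_mod_cast h1
  rw [← h2] at h
  exact_mod_cast h

/-- `R / (y)` is integrally closed under extraction of roots when `y` is good. -/
theorem Good.mem_sup_span_of_pow {ι : Type*} [Fintype ι] {d p : ℕ} (hp : p ≠ 0)
    {y : ι → MvPolynomial (Fin N) K} (hy : Forms d y) (h : Good 2 y)
    {a b F : MvPolynomial (Fin N) K} (hb : b ∉ Ideal.span (Set.range y))
    (hab : a ^ p - b ^ p * F ∈ Ideal.span (Set.range y)) :
    a ∈ Ideal.span (Set.range y) ⊔ Ideal.span {b} := by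
  set G := Ideal.span (Set.range y) with hG
  have hGp : G.IsPrime := h.isPrime_span hy
  have hGh : (Fintype.card ι : ℕ∞) ≤ G.height := h.card_le_height
  have hGb : G < G ⊔ Ideal.span {b} := lt_of_le_of_ne le_sup_left fun he =>
    hb (he ▸ Ideal.mem_sup_right (Ideal.mem_span_singleton_self b))
  let J : Ideal (MvPolynomial (Fin N) K) := (G ⊔ Ideal.span {b}).colon {a}
  have hJ : ∀ x, x ∈ J ↔ x * a ∈ G ⊔ Ideal.span {b} := fun x => by
    rw [Submodule.mem_colon_singleton, smul_eq_mul]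
  refine Good.mem_span_sup_of_colon (J := J) (z := a) ?_ (fun x hx => (hJ x).1 hx) ?_
  · refine le_height_of_forall_isPrime fun P hP hle => ?_
    exact (add_le_add_left hGh 1).trans (Ideal.height_add_one_le_of_lt_of_isPrime (hGb.trans_le hle))
  · refine le_height_of_forall_isPrime fun Q hQ hJQ => ?_
    by_contra hlt
    rw [not_le] at hlt
    have hGJ : G ≤ J := fun x hx => (hJ x).2 (Ideal.mem_sup_left (G.mul_mem_right _ hx))
    obtain ⟨q, hq, hqQ, hreg⟩ := h.isRegularLocalRing_of_height_lt hG Q (hGJ.trans hJQ)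
      (by exact_mod_cast hlt)
    have hq1 : q.height ≤ 1 := by
      by_contra hcon
      rw [not_le] at hcon
      have h2 : 2 ≤ q.height := Order.add_one_le_of_lt hcon
      obtain ⟨q₀, q₁, hq₀, hq₁, h01, h1q⟩ := exists_prime_lt_lt q h2
      have hmono : ∀ I J : Ideal (MvPolynomial (Fin N) K ⧸ G), I < J →
          I.comap (Ideal.Quotient.mk G) < J.comap (Ideal.Quotient.mk G) := fun I J hIJ =>
        (Ideal.orderEmbeddingOfSurjective _ Ideal.Quotient.mk_surjective).strictMono hIJ
      have e1 := Ideal.height_add_one_le_of_lt_of_isPrime (hmono _ _ h01)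
      have e2 := Ideal.height_add_one_le_of_lt_of_isPrime (hmono _ _ h1q)
      rw [hqQ] at e2
      have e0 : G.height ≤ (q₀.comap (Ideal.Quotient.mk G)).height :=
        Ideal.height_mono (by
          conv_lhs => rw [← Ideal.mk_ker (I := G)]
          exact Ideal.comap_mono bot_le)
      refine absurd hlt (not_lt.2 ?_)
      calc ((Fintype.card ι : ℕ) : ℕ∞) + 2 = (Fintype.card ι : ℕ∞) + 1 + 1 := by
            rw [add_assoc, one_add_one_eq_two]
        _ ≤ _ := (add_le_add_left ((add_le_add_left (hGh.trans e0) 1).trans e1) 1).trans e2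
    have hval := dvd_total_of_height_le_one q hq1
    have hdom : IsDomain (Localization.AtPrime q) :=
      IsLocalization.isDomain_localization q.primeCompl_le_nonZeroDivisors
    let φ : MvPolynomial (Fin N) K ⧸ G →+* Localization.AtPrime q := algebraMap _ _
    have hφi : Function.Injective φ :=
      IsLocalization.injective (M := q.primeCompl) (Localization.AtPrime q)
        q.primeCompl_le_nonZeroDivisors
    set α := Ideal.Quotient.mk G a with hα
    set β := Ideal.Quotient.mk G b with hβ
    have hβ0 : φ β ≠ 0 := fun h0 => hb (Ideal.Quotient.eq_zero_iff_mem.1 (hφi (by rw [h0, map_zero])))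
    have hpow : φ α ^ p = φ β ^ p * φ (Ideal.Quotient.mk G F) := by
      have h1 : α ^ p = β ^ p * Ideal.Quotient.mk G F := by
        rw [hα, hβ, ← map_pow, ← map_pow, ← map_mul]
        exact Ideal.Quotient.eq.2 hab
      rw [← map_pow, h1, map_mul, map_pow]
    have hdvd : φ β ∣ φ α := by
      rcases hval (φ β) (φ α) with h1 | ⟨c, hc⟩
      · exact h1
      · have hα0 : φ α ≠ 0 := fun h0 => hβ0 (by rw [hc, h0, zero_mul])
        rw [hc, mul_pow, mul_assoc] at hpow
        have h1 : c ^ p * φ (Ideal.Quotient.mk G F) = 1 :=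
          mul_left_cancel₀ (pow_ne_zero p hα0) (by rw [← hpow, mul_one])
        have hcu : IsUnit c := (isUnit_pow_iff hp).1 (IsUnit.of_mul_eq_one _ h1)
        rw [hc]
        exact (hcu.mul_right_dvd).2 dvd_rfl
    obtain ⟨c, hc⟩ := hdvd
    obtain ⟨c', s, rfl⟩ := IsLocalization.exists_mk'_eq q.primeCompl c
    have h3 : α * (s : MvPolynomial (Fin N) K ⧸ G) = β * c' := by
      refine hφi ?_
      rw [map_mul, map_mul, hc, mul_assoc, IsLocalization.mk'_spec]
    obtain ⟨s', hs'⟩ := Ideal.Quotient.mk_surjective (s : MvPolynomial (Fin N) K ⧸ G)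
    obtain ⟨c'', rfl⟩ := Ideal.Quotient.mk_surjective c'
    have h4 : s' * a - c'' * b ∈ G := by
      rw [← Ideal.Quotient.eq, map_mul, map_mul, hs', mul_comm, h3, mul_comm]
    have h5 : s' ∈ J := by
      rw [hJ, show s' * a = (s' * a - c'' * b) + c'' * b by ring]
      exact add_mem (Ideal.mem_sup_left h4)
        (Ideal.mem_sup_right (Ideal.mem_span_singleton'.2 ⟨c'', rfl⟩))
    have h6 : s' ∈ q.comap (Ideal.Quotient.mk G) := hqQ ▸ hJQ h5
    exact s.2 (hs' ▸ h6)

/-- A polynomial all of whose partial derivatives lie in a good ideal is a `p`-th power modulo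
the ideal, in characteristic `p`. -/
theorem Good.exists_pow_sub_mem {ι : Type*} [Fintype ι] {d p : ℕ} [Fact p.Prime] [CharP K p]
    (hK : ∀ c : K, ∃ b : K, b ^ p = c)
    {y : ι → MvPolynomial (Fin N) K} (hy : Forms d y) (h : Good 2 y)
    {F : MvPolynomial (Fin N) K} (hF : ∀ k, pderiv k F ∈ Ideal.span (Set.range y)) :
    ∃ u, u ^ p - F ∈ Ideal.span (Set.range y) := by
  have hp : p ≠ 0 := (Fact.out : p.Prime).ne_zero
  set G := Ideal.span (Set.range y) with hG
  have hGp : G.IsPrime := h.isPrime_span hy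
  let L := FractionRing (MvPolynomial (Fin N) K ⧸ G)
  let φ : MvPolynomial (Fin N) K →+* L :=
    (algebraMap (MvPolynomial (Fin N) K ⧸ G) L).comp (Ideal.Quotient.mk G)
  have hφ : ∀ x, φ x = 0 ↔ x ∈ G := fun x => by
    rw [← Ideal.Quotient.eq_zero_iff_mem, RingHom.comp_apply,
      map_eq_zero_iff _ (IsFractionRing.injective (MvPolynomial (Fin N) K ⧸ G) L)]
  have hchar : CharP L p := charP_of_injective_ringHom (φ.comp C).injective p
  obtain ⟨l, hl⟩ := exists_pow_eq_of_pderiv (p := p) φ hK (F := F) fun k => (hφ _).2 (hF k)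
  obtain ⟨a, b, hb, rfl⟩ := IsFractionRing.div_surjective (A := MvPolynomial (Fin N) K ⧸ G) l
  obtain ⟨a, rfl⟩ := Ideal.Quotient.mk_surjective a
  obtain ⟨b, rfl⟩ := Ideal.Quotient.mk_surjective b
  change (φ a / φ b) ^ p = φ F at hl
  have hb' : b ∉ G := fun hbG =>
    nonZeroDivisors.ne_zero hb (Ideal.Quotient.eq_zero_iff_mem.2 hbG)
  have hb0 : φ b ≠ 0 := fun h0 => hb' ((hφ b).1 h0)
  have hab : a ^ p - b ^ p * F ∈ G := by
    rw [← hφ, map_sub, map_mul, map_pow, map_pow, ← hl, div_pow,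
      mul_div_cancel₀ _ (pow_ne_zero p hb0), sub_self]
  obtain ⟨g, hg, u, hu⟩ := mem_sup_span_singleton_iff.1 (h.mem_sup_span_of_pow hp hy hb' hab)
  refine ⟨u, ?_⟩
  have h1 : φ a = φ b * φ u := by rw [hu, map_add, (hφ g).2 hg, zero_add, map_mul]
  rw [← hφ, map_sub, map_pow, ← hl, h1, mul_div_cancel_left₀ _ hb0, sub_self]

end PthPower

section LeadingForm

variable {K : Type*} [Field K] {N : ℕ}

theorem exists_homogeneous_combination {ι : Type*} [Fintype ι] {g : ι → MvPolynomial (Fin N) K}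
    {e : ι → ℕ} (he : ∀ i, (g i).IsHomogeneous (e i)) {z : MvPolynomial (Fin N) K} {D : ℕ}
    (hz : z.IsHomogeneous D) (hmem : z ∈ Ideal.span (Set.range g)) :
    ∃ b : ι → MvPolynomial (Fin N) K, (∀ i, (b i).IsHomogeneous (D - e i)) ∧
      (∀ i, D < e i → b i = 0) ∧ z = ∑ i, b i * g i := by
  obtain ⟨a, ha⟩ := Ideal.mem_span_range_iff_exists_fun.1 hmem
  refine ⟨fun i => if e i ≤ D then homogeneousComponent (D - e i) (a i) else 0, fun i => ?_,
    fun i hi => if_neg (not_le.2 hi), ?_⟩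
  · dsimp only
    split_ifs
    · exact homogeneousComponent_isHomogeneous _ _
    · exact isHomogeneous_zero _ _ _
  · have h1 : homogeneousComponent D z = z := by
      rw [homogeneousComponent_of_mem hz, if_pos rfl]
    rw [← h1, ← ha, map_sum]
    refine Finset.sum_congr rfl fun i _ => ?_
    rw [homogeneousComponent_mul_of_isHomogeneous (he i), ite_mul, zero_mul]

/-- All the homogeneous components of degree at least `D` vanish. -/
def Below (D : ℕ) (u : MvPolynomial (Fin N) K) : Prop := ∀ e, D ≤ e → homogeneousComponent e u = 0

theorem exists_below (u : MvPolynomial (Fin N) K) : ∃ D, Below D u :=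
  ⟨u.totalDegree + 1, fun e he => homogeneousComponent_eq_zero e u he⟩

theorem Below.eq_zero {u : MvPolynomial (Fin N) K} (h : Below 0 u) : u = 0 := by
  rw [← sum_homogeneousComponent u]
  exact Finset.sum_eq_zero fun e _ => h e (Nat.zero_le e)

/-- The ideal of a translate of the common zero locus. -/
noncomputable def shiftIdeal {ι : Type*} (g : ι → MvPolynomial (Fin N) K) (c : ι → K) :
    Ideal (MvPolynomial (Fin N) K) := Ideal.span (Set.range fun i => g i - C (c i))

theorem exists_below_sub_mem_shiftIdeal {ι : Type*} [Fintype ι] {d : ℕ}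
    {g : ι → MvPolynomial (Fin N) K}
    (hg : Forms d g) (c : ι → K) {h : MvPolynomial (Fin N) K} {E : ℕ} (hE : Below (E + 1) h)
    (hmem : homogeneousComponent E h ∈ Ideal.span (Set.range g)) :
    ∃ h', Below E h' ∧ h - h' ∈ shiftIdeal g c := by
  choose e he0 _ he using hg
  obtain ⟨b, hb, hb0, hsum⟩ := exists_homogeneous_combination he
    (homogeneousComponent_isHomogeneous E h) hmem
  refine ⟨h - ∑ i, b i * (g i - C (c i)), fun k hk => ?_, ?_⟩
  · have h1 : ∑ i, b i * (g i - C (c i)) = homogeneousComponent E h - ∑ i, C (c i) * b i := by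
      rw [hsum, ← Finset.sum_sub_distrib]
      exact Finset.sum_congr rfl fun i _ => by ring
    have h2 : ∀ i, homogeneousComponent k (b i) = 0 := fun i => by
      by_cases hi : E < e i
      · rw [hb0 i hi, map_zero]
      · rw [homogeneousComponent_of_mem (hb i), if_neg]
        have := he0 i
        omega
    rw [h1, map_sub, map_sub, map_sum, homogeneousComponent_homogeneousComponent]
    simp only [homogeneousComponent_C_mul, h2, mul_zero, Finset.sum_const_zero, sub_zero]
    split_ifs with hkE
    · rw [hkE, sub_self]
    · rw [hE k (by omega), sub_zero]
  · rw [sub_sub_cancel]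
    exact Ideal.sum_mem _ fun i _ => Ideal.mul_mem_left _ _ (Ideal.subset_span ⟨i, rfl⟩)

theorem Good.last_notMem {m d s : ℕ} {g : Fin (m + 1) → MvPolynomial (Fin N) K} (hg : Forms d g)
    (h : Good s g) : g (Fin.last m) ∉ Ideal.span (Set.range (g ∘ Fin.castSucc)) := by
  classical
  intro hmem
  have hle : Ideal.span (Set.range g) ≤ Ideal.span (Set.range (g ∘ Fin.castSucc)) := by
    rw [Ideal.span_le]
    rintro _ ⟨i, rfl⟩
    induction i using Fin.lastCases with
    | last => exact hmem
    | cast i => exact Ideal.subset_span ⟨i, rfl⟩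
  have h1 := h.card_le_height.trans (Ideal.height_mono hle)
  have htop : Ideal.span (Set.range (g ∘ Fin.castSucc)) ≠ ⊤ :=
    Forms.span_ne_top (d := d) fun i => hg i.castSucc
  obtain ⟨P, hP⟩ := Ideal.nonempty_minimalPrimes htop
  have h2 := Ideal.height_le_card_of_mem_minimalPrimes_span_finset
    (s := Finset.univ.image (g ∘ Fin.castSucc)) (p := P) (by rwa [Finset.coe_image, Finset.coe_univ, Set.image_univ])
  have h3 := (h1.trans (Ideal.height_mono hP.1.2)).trans h2
  have h4 : (Finset.univ.image (g ∘ Fin.castSucc)).card ≤ m := by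
    simpa using Finset.card_image_le (s := Finset.univ) (f := g ∘ Fin.castSucc)
  rw [Fintype.card_fin] at h3
  have h5 : m + 1 ≤ (Finset.univ.image (g ∘ Fin.castSucc)).card := by exact_mod_cast h3
  omega

/-- The leading forms of the elements of `(g₁ - c₁, …, gₘ - cₘ)` lie in `(g₁, …, gₘ)`. -/
theorem Good.homogeneousComponent_mem_of_mem_shiftIdeal {d : ℕ} : ∀ {m : ℕ}
    {g : Fin m → MvPolynomial (Fin N) K} (_ : Forms d g) (_ : Good 2 g) (c : Fin m → K)
    {u : MvPolynomial (Fin N) K} {D : ℕ} (_ : Below (D + 1) u) (_ : u ∈ shiftIdeal g c),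
    homogeneousComponent D u ∈ Ideal.span (Set.range g)
  | 0, g, _, _, c, u, D, _, hu => by
    have : Set.range (fun i => g i - C (c i)) = ∅ := Set.range_eq_empty _
    rw [shiftIdeal, this, Ideal.span_empty, Ideal.mem_bot] at hu
    rw [hu, map_zero]
    exact zero_mem _
  | m + 1, g, hg, hgood, c, u, D, hD, hu => by
    classical
    set g' := g ∘ Fin.castSucc with hg'
    set c' := c ∘ Fin.castSucc with hc'
    have hg'F : Forms d g' := fun i => hg i.castSucc
    have hg'G : Good 2 g' := hgood.comp hg _ (Fin.castSucc_injective m)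
    have hprime := hg'G.isPrime_span hg'F
    have hle : Ideal.span (Set.range g') ≤ Ideal.span (Set.range g) :=
      Ideal.span_mono (Set.range_comp_subset_range _ _)
    have hlast := hgood.last_notMem hg
    obtain ⟨e, he0, -, he⟩ := hg (Fin.last m)
    set y := g (Fin.last m) with hy
    have hex : ∃ E h, Below E h ∧ u - h * (y - C (c (Fin.last m))) ∈ shiftIdeal g' c' := by
      have h1 : shiftIdeal g c ≤ shiftIdeal g' c' ⊔ Ideal.span {y - C (c (Fin.last m))} := by
        rw [shiftIdeal, Ideal.span_le]
        rintro _ ⟨i, rfl⟩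
        induction i using Fin.lastCases with
        | last => exact Ideal.mem_sup_right (Ideal.mem_span_singleton_self _)
        | cast i => exact Ideal.mem_sup_left (Ideal.subset_span ⟨i, rfl⟩)
      obtain ⟨v, hv, h, rfl⟩ := mem_sup_span_singleton_iff.1 (h1 hu)
      obtain ⟨E, hE⟩ := exists_below h
      refine ⟨E, h, hE, ?_⟩
      rwa [show v + (y - C (c (Fin.last m))) * h - h * (y - C (c (Fin.last m))) = v by ring]
    obtain ⟨h, hE, hv⟩ := Nat.find_spec hex
    have hmin : ∀ k < Nat.find hex, ¬ ∃ h, Below k h ∧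
      u - h * (y - C (c (Fin.last m))) ∈ shiftIdeal g' c' := fun k hk => Nat.find_min hex hk
    rcases hEeq : Nat.find hex with _ | E
    · rw [hEeq] at hE
      rw [hE.eq_zero, zero_mul, sub_zero] at hv
      exact hle (homogeneousComponent_mem_of_mem_shiftIdeal hg'F hg'G c' hD hv)
    · rw [hEeq] at hE hmin
      have htop : homogeneousComponent E h ∉ Ideal.span (Set.range g') := fun hmem => by
        obtain ⟨h', hh', hsub⟩ := exists_below_sub_mem_shiftIdeal hg'F c' hE hmem
        refine hmin E (Nat.lt_succ_self E) ⟨h', hh', ?_⟩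
        rw [show u - h' * (y - C (c (Fin.last m))) = u - h * (y - C (c (Fin.last m))) +
          (h - h') * (y - C (c (Fin.last m))) by ring]
        exact add_mem hv (Ideal.mul_mem_right _ _ hsub)
      have hcomp : ∀ k, E + 1 ≤ k → homogeneousComponent k (h * (y - C (c (Fin.last m)))) =
          if e ≤ k then homogeneousComponent (k - e) h * y else 0 := fun k hk => by
        rw [mul_sub, map_sub, homogeneousComponent_mul_of_isHomogeneous he, mul_comm h (C _),
          homogeneousComponent_C_mul, hE k hk, mul_zero, sub_zero]
      by_cases hDM : E + e ≤ D
      · have hb : Below (D + 1) (u - h * (y - C (c (Fin.last m)))) := fun k hk => by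
          rw [map_sub, hD k hk, hcomp k (by omega), hE (k - e) (by omega), zero_mul, ite_self,
            sub_zero]
        have h1 := homogeneousComponent_mem_of_mem_shiftIdeal hg'F hg'G c' hb hv
        rw [map_sub, hcomp D (by omega), if_pos (by omega)] at h1
        have h2 := add_mem (hle h1) (Ideal.mul_mem_left (Ideal.span (Set.range g))
          (homogeneousComponent (D - e) h) (Ideal.subset_span ⟨Fin.last m, rfl⟩))
        rwa [← hy, sub_add_cancel] at h2
      · have hb : Below (E + e + 1) (u - h * (y - C (c (Fin.last m)))) := fun k hk => by
          rw [map_sub, hD k (by omega), hcomp k (by omega), hE (k - e) (by omega), zero_mul,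
            ite_self, sub_zero]
        have h1 := homogeneousComponent_mem_of_mem_shiftIdeal hg'F hg'G c' hb hv
        rw [map_sub, hcomp _ (by omega), if_pos (by omega), hD _ (by omega), zero_sub, neg_mem_iff,
          Nat.add_sub_cancel] at h1
        exact absurd (hprime.mem_or_mem h1) (not_or.2 ⟨htop, hlast⟩)

theorem Good.mem_shiftIdeal_of_mul_mem {d m : ℕ} {g : Fin m → MvPolynomial (Fin N) K}
    (hg : Forms d g) (h : Good 2 g) (c : Fin m → K) {w : MvPolynomial (Fin N) K} {e : ℕ}
    (hw : w.IsHomogeneous e) (hwG : w ∉ Ideal.span (Set.range g)) {u : MvPolynomial (Fin N) K}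
    (hu : u * w ∈ shiftIdeal g c) : u ∈ shiftIdeal g c := by
  obtain ⟨D, hD⟩ := exists_below u
  induction D generalizing u with
  | zero => rw [hD.eq_zero]; exact zero_mem _
  | succ D ih =>
    have hb : Below (D + e + 1) (u * w) := fun k hk => by
      rw [homogeneousComponent_mul_of_isHomogeneous hw, hD (k - e) (by omega), zero_mul, ite_self]
    have h1 := h.homogeneousComponent_mem_of_mem_shiftIdeal hg c hb hu
    rw [homogeneousComponent_mul_of_isHomogeneous hw, if_pos (by omega), Nat.add_sub_cancel] at h1
    have h2 := ((h.isPrime_span hg).mem_or_mem h1).resolve_right hwG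
    obtain ⟨u', hu', hsub⟩ := exists_below_sub_mem_shiftIdeal hg c hD h2
    have h3 : u' ∈ shiftIdeal g c := ih (by
      rw [show u' * w = u * w - (u - u') * w by ring]
      exact sub_mem hu (Ideal.mul_mem_right _ _ hsub)) hu'
    exact (sub_add_cancel u u') ▸ add_mem hsub h3

theorem Good.mem_shiftIdeal_of_mul_pow_mem {d m : ℕ} {g : Fin m → MvPolynomial (Fin N) K}
    (hg : Forms d g) (h : Good 2 g) (c : Fin m → K) {w : MvPolynomial (Fin N) K} {e : ℕ}
    (hw : w.IsHomogeneous e) (hwG : w ∉ Ideal.span (Set.range g)) {u : MvPolynomial (Fin N) K} :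
    ∀ n : ℕ, u * w ^ n ∈ shiftIdeal g c → u ∈ shiftIdeal g c
  | 0, hu => by simpa using hu
  | n + 1, hu => h.mem_shiftIdeal_of_mul_pow_mem hg c hw hwG n
      (h.mem_shiftIdeal_of_mul_mem hg c hw hwG (by rwa [mul_assoc, ← pow_succ]))

end LeadingForm

section Collapse

variable {K : Type*} [Field K] {N : ℕ}

theorem exists_minimalPrime_of_submodule [Infinite K] (W : Submodule K (MvPolynomial (Fin N) K))
    {Q : Ideal (MvPolynomial (Fin N) K)} {k : ℕ} (hWQ : ∀ w ∈ W, w ∈ Q)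
    (hQk : Q.height ≤ k) :
    ∃ t ≤ k, ∃ f : Fin t → MvPolynomial (Fin N) K, (∀ i, f i ∈ W) ∧
      ∃ P ∈ (Ideal.span (Set.range f)).minimalPrimes, ∀ w ∈ W, w ∈ P := by
  by_contra! hcon
  have key : ∀ t ≤ k + 1, ∃ f : Fin t → MvPolynomial (Fin N) K, (∀ i, f i ∈ W) ∧
      (t : ℕ∞) ≤ (Ideal.span (Set.range f)).height := by
    intro t
    induction t with
    | zero => exact fun _ => ⟨Fin.elim0, fun i => i.elim0, by simp⟩
    | succ t ih =>
      intro ht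
      obtain ⟨f, hf, hht⟩ := ih (by omega)
      have hc := hcon t (by omega) f hf
      have hfin := Ideal.finite_minimalPrimes_of_isNoetherianRing (MvPolynomial (Fin N) K)
        (Ideal.span (Set.range f))
      have hex : ∃ w ∈ W, ∀ P ∈ (Ideal.span (Set.range f)).minimalPrimes, w ∉ P := by
        by_contra! hall
        have : Finite (Ideal.span (Set.range f)).minimalPrimes := hfin
        let p : (Ideal.span (Set.range f)).minimalPrimes → Submodule K W := fun P =>
          ((P : Ideal (MvPolynomial (Fin N) K)).restrictScalars K).comap W.subtype
        obtain ⟨P, hP⟩ := Subspace.exists_eq_top_of_iUnion_eq_univ (p := p) (by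
          rw [Set.eq_univ_iff_forall]
          intro w
          obtain ⟨P, hP, hwP⟩ := hall w w.2
          exact Set.mem_iUnion.2 ⟨⟨P, hP⟩, hwP⟩)
        obtain ⟨w, hw, hwP⟩ := hc P P.2
        have : (⟨w, hw⟩ : W) ∈ p P := hP ▸ Submodule.mem_top
        exact hwP this
      obtain ⟨w, hw, hwP⟩ := hex
      refine ⟨Fin.cons w f, fun i => ?_, le_height_of_forall_isPrime fun P' hP' hle => ?_⟩
      · induction i using Fin.cases with
        | zero => exact hw
        | succ i => exact hf i
      · have hle' : Ideal.span (Set.range f) ≤ P' := by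
          refine le_trans (Ideal.span_mono ?_) hle
          rintro _ ⟨i, rfl⟩
          exact ⟨i.succ, rfl⟩
        obtain ⟨P, hP, hPP'⟩ := Ideal.exists_minimalPrimes_le hle'
        have := hP.1.1
        have hlt : P < P' := lt_of_le_of_ne hPP' fun he =>
          hwP P hP (he ▸ hle (Ideal.subset_span ⟨0, rfl⟩))
        push_cast
        exact (add_le_add_left (hht.trans (Ideal.height_mono hP.1.2)) 1).trans
          (Ideal.height_add_one_le_of_lt_of_isPrime hlt)
  obtain ⟨f, hf, hht⟩ := key (k + 1) le_rfl
  have h1 := (hht.trans (Ideal.height_mono (Ideal.span_le.2 (by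
    rintro _ ⟨i, rfl⟩; exact hWQ _ (hf i) : Set.range f ⊆ Q)))).trans hQk
  have h2 : k + 1 ≤ k := by exact_mod_cast h1
  omega

theorem Good.mem_span_of_mem_minimalPrimes [IsAlgClosed K] {d m e : ℕ} {ι : Type*}
    {g : Fin m → MvPolynomial (Fin N) K} (hg : Forms d g) (h : Good 2 g)
    {f : ι → MvPolynomial (Fin N) K} (hf : ∀ i, f i ∈ Algebra.adjoin K (Set.range g))
    {P : Ideal (MvPolynomial (Fin N) K)} (hP : P ∈ (Ideal.span (Set.range f)).minimalPrimes)
    {w : MvPolynomial (Fin N) K} (hw : w.IsHomogeneous e) (hwP : w ∈ P) :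
    w ∈ Ideal.span (Set.range g) := by
  by_contra hwG
  obtain ⟨s, hs, hws⟩ := Ideal.iUnion_minimalPrimes.subset (Set.mem_biUnion hP hwP)
  refine hs ?_
  rw [← vanishingIdeal_zeroLocus_eq_radical (K := K), mem_vanishingIdeal_iff]
  intro x hx
  let c : Fin m → K := fun i => aeval x (g i)
  obtain ⟨n, hn⟩ := hws
  have hle : Ideal.span (Set.range f) ≤ shiftIdeal g c := by
    rw [Ideal.span_le]
    rintro _ ⟨i, rfl⟩
    have h0 : aeval x (f i) = 0 := hx _ (Ideal.subset_span ⟨i, rfl⟩)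
    have key : ∀ z ∈ Algebra.adjoin K (Set.range g), z - C (aeval x z) ∈ shiftIdeal g c := by
      intro z hz
      induction hz using Algebra.adjoin_induction with
      | mem z hz =>
        obtain ⟨j, rfl⟩ := hz
        exact Ideal.subset_span ⟨j, rfl⟩
      | algebraMap r => simp [algebraMap_eq]
      | add a b _ _ ha hb =>
        rw [map_add, map_add, add_sub_add_comm]
        exact add_mem ha hb
      | mul a b _ _ ha hb =>
        rw [map_mul, map_mul, show a * b - C (aeval x a) * C (aeval x b) =
          (a - C (aeval x a)) * b + C (aeval x a) * (b - C (aeval x b)) by ring]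
        exact add_mem (Ideal.mul_mem_right _ _ ha) (Ideal.mul_mem_left _ _ hb)
    simpa [h0] using key _ (hf i)
  have h1 : s ^ n ∈ shiftIdeal g c := h.mem_shiftIdeal_of_mul_pow_mem hg c hw hwG n (by
    rw [← mul_pow, mul_comm]; exact hle hn)
  have h2 : shiftIdeal g c ≤ RingHom.ker (aeval (R := K) x) := by
    rw [shiftIdeal, Ideal.span_le]
    rintro _ ⟨i, rfl⟩
    simp [c, RingHom.mem_ker]
  have h3 : aeval x (s ^ n) = 0 := h2 h1
  rw [map_pow] at h3
  exact eq_zero_of_pow_eq_zero h3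

/-- Every finite family of `n` forms of degree at most `d` lies in the subalgebra generated by a
good family of at most `T (n + s)` forms of degree at most `d`. -/
def Regularizable (K : Type*) [Field K] (N d : ℕ) (T : ℕ → ℕ) : Prop :=
  ∀ (n s : ℕ) (y : Fin n → MvPolynomial (Fin N) K), Forms d y →
    ∃ m ≤ T (n + s), ∃ g : Fin m → MvPolynomial (Fin N) K, Forms d g ∧ Good s g ∧
      ∀ i, y i ∈ Algebra.adjoin K (Set.range g)

theorem Regularizable.exists_pderiv_mem [IsAlgClosed K] {d k : ℕ} {T : ℕ → ℕ} (hT : Monotone T)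
    (hreg : Regularizable K N d T) {F : MvPolynomial (Fin N) K} (hF : F.IsHomogeneous (d + 1))
    {Q : Ideal (MvPolynomial (Fin N) K)} [Q.IsPrime] (hFQ : ∀ j, pderiv j F ∈ Q)
    (hQk : Q.height ≤ k) :
    ∃ m ≤ T (k + 2), ∃ g : Fin m → MvPolynomial (Fin N) K, Forms d g ∧ Good 2 g ∧
      ∀ j, pderiv j F ∈ Ideal.span (Set.range g) := by
  have hhom : ∀ j, (pderiv j F).IsHomogeneous d := fun j => hF.pderiv
  rcases Nat.eq_zero_or_pos d with rfl | hd
  · refine ⟨0, Nat.zero_le _, Fin.elim0, fun i => i.elim0, fun P _ _ ⟨a, ⟨i, _⟩, _⟩ => i.elim0,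
      fun j => ?_⟩
    have h1 := totalDegree_eq_zero_iff_eq_C.1 ((totalDegree_zero_iff_isHomogeneous _).2 (hhom j))
    have h2 : coeff 0 (pderiv j F) = 0 := by
      by_contra h2
      have h3 := hFQ j
      rw [h1] at h3
      exact ‹Q.IsPrime›.ne_top
        (Ideal.eq_top_of_isUnit_mem _ h3 ((isUnit_iff_ne_zero.2 h2).map C))
    rw [h1, h2, map_zero]
    exact zero_mem _
  · let W := Submodule.span K (Set.range fun j => pderiv j F)
    have hWQ : W ≤ Q.restrictScalars K := Submodule.span_le.2 (by rintro _ ⟨j, rfl⟩; exact hFQ j)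
    have hWhom : W ≤ homogeneousSubmodule (Fin N) K d :=
      Submodule.span_le.2 (by rintro _ ⟨j, rfl⟩; exact hhom j)
    have hinf : Infinite K := IsAlgClosed.instInfinite
    obtain ⟨t, ht, f, hf, P, hP, hWP⟩ := exists_minimalPrime_of_submodule W (fun w hw => hWQ hw) hQk
    obtain ⟨m, hm, g, hg, hgood, hfg⟩ := hreg t 2 f fun i => ⟨d, hd, le_rfl, hWhom (hf i)⟩
    exact ⟨m, hm.trans (hT (by omega)), g, hg, hgood, fun j =>
      hgood.mem_span_of_mem_minimalPrimes hg hfg hP (hhom j)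
        (hWP _ (Submodule.subset_span ⟨j, rfl⟩))⟩

theorem exists_forms_mem_adjoin {m d : ℕ} {g : Fin m → MvPolynomial (Fin N) K} (hg : Forms d g)
    {F : MvPolynomial (Fin N) K} (hF : F.IsHomogeneous (d + 1))
    (hFg : F ∈ Ideal.span (Set.range g)) :
    ∃ b : Fin m → MvPolynomial (Fin N) K, Forms d b ∧
      F ∈ Algebra.adjoin K (Set.range (Sum.elim g b)) := by
  choose e he0 hed he using hg
  obtain ⟨b, hb, -, rfl⟩ := exists_homogeneous_combination he hF hFg
  refine ⟨b, fun i => ⟨d + 1 - e i, ?_, ?_, hb i⟩, ?_⟩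
  · have := hed i
    omega
  · have := he0 i
    omega
  · exact Subalgebra.sum_mem _ fun i _ => Subalgebra.mul_mem _
      (Algebra.subset_adjoin ⟨Sum.inr i, rfl⟩) (Algebra.subset_adjoin ⟨Sum.inl i, rfl⟩)

theorem homogeneousComponent_mul_pow_char {p : ℕ} [Fact p.Prime] [CharP K p]
    (u : MvPolynomial (Fin N) K) (e : ℕ) :
    homogeneousComponent (e * p) (u ^ p) = homogeneousComponent e u ^ p := by
  have hp : 0 < p := (Fact.out : p.Prime).pos
  conv_lhs => rw [← sum_homogeneousComponent u, sum_pow_char, map_sum]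
  have h1 : ∀ j, homogeneousComponent (e * p) (homogeneousComponent j u ^ p) =
      if e = j then homogeneousComponent j u ^ p else 0 := fun j => by
    rw [homogeneousComponent_of_mem ((homogeneousComponent_isHomogeneous j u).pow p)]
    simp only [Nat.mul_left_inj hp.ne']
  simp only [h1]
  rw [Finset.sum_ite_eq]
  split_ifs with h
  · rfl
  · rw [homogeneousComponent_eq_zero, zero_pow hp.ne']
    rw [Finset.mem_range] at h
    omega

/-- A form all of whose derivatives vanish on a subvariety of small codimension lies in the
subalgebra generated by few forms of smaller degree. -/
theorem Regularizable.exists_mem_adjoin [IsAlgClosed K] {d k : ℕ} {T : ℕ → ℕ} (hT : Monotone T)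
    (hreg : Regularizable K N d T) {F : MvPolynomial (Fin N) K} (hF : F.IsHomogeneous (d + 1))
    {Q : Ideal (MvPolynomial (Fin N) K)} [Q.IsPrime] (hFQ : ∀ j, pderiv j F ∈ Q)
    (hQk : Q.height ≤ k) :
    ∃ m ≤ 2 * T (k + 2) + 1, ∃ z : Fin m → MvPolynomial (Fin N) K, Forms d z ∧
      F ∈ Algebra.adjoin K (Set.range z) := by
  obtain ⟨m, hm, g, hg, hgood, hFg⟩ := hreg.exists_pderiv_mem hT hF hFQ hQk
  by_cases hd : ((d + 1 : ℕ) : K) = 0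
  · obtain ⟨p, hp⟩ := CharP.exists K
    have hpd : p ∣ d + 1 := (CharP.cast_eq_zero_iff K p (d + 1)).1 hd
    have hp0 : p ≠ 0 := by
      rintro rfl
      simp at hpd
    have hpp : Fact p.Prime := ⟨(CharP.char_is_prime_or_zero K p).resolve_right hp0⟩
    obtain ⟨e, he⟩ := hpd
    obtain ⟨u, hu⟩ := hgood.exists_pow_sub_mem (p := p)
      (fun c => IsAlgClosed.exists_pow_nat_eq c hpp.out.pos) hg hFg
    have he0 : 0 < e := Nat.pos_of_ne_zero fun h => by simp [h] at he
    have hed : e ≤ d := by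
      have := Nat.mul_le_mul_right e hpp.out.two_le
      omega
    set w := homogeneousComponent e u with hw
    have hwe : w.IsHomogeneous e := homogeneousComponent_isHomogeneous e u
    have hwp : (w ^ p).IsHomogeneous (d + 1) := by
      rw [he, mul_comm]
      exact hwe.pow p
    have h1 : F - w ^ p ∈ Ideal.span (Set.range g) := by
      have h2 := neg_mem (homIdeal_span hg _ hu (d + 1))
      have h3 : homogeneousComponent (d + 1) (u ^ p) = w ^ p := by
        rw [he, mul_comm, homogeneousComponent_mul_pow_char]
      rwa [map_sub, neg_sub, homogeneousComponent_of_mem hF, if_pos rfl, h3] at h2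
    obtain ⟨b, hb, hFb⟩ := exists_forms_mem_adjoin hg (hF.sub hwp) h1
    let z : (Fin m ⊕ Fin m) ⊕ Unit → MvPolynomial (Fin N) K := Sum.elim (Sum.elim g b) fun _ => w
    have hcard : Fintype.card ((Fin m ⊕ Fin m) ⊕ Unit) = m + m + 1 := by simp
    refine ⟨m + m + 1, by omega, z ∘ (Fintype.equivFinOfCardEq hcard).symm, fun i => ?_, ?_⟩
    · rw [Function.comp_apply]
      rcases (Fintype.equivFinOfCardEq hcard).symm i with (j | j) | j
      · exact hg j
      · exact hb j
      · exact ⟨e, he0, hed, hwe⟩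
    · rw [Set.range_comp, (Fintype.equivFinOfCardEq hcard).symm.range_eq_univ, Set.image_univ,
        ← sub_add_cancel F (w ^ p)]
      have hwz : w ∈ Set.range z := ⟨Sum.inr (), rfl⟩
      refine Subalgebra.add_mem _ (Algebra.adjoin_mono ?_ hFb)
        (Subalgebra.pow_mem _ (Algebra.subset_adjoin hwz) p)
      rintro _ ⟨i, rfl⟩
      exact ⟨Sum.inl i, rfl⟩
  · have h1 : F ∈ Ideal.span (Set.range g) := by
      have h2 := hF.sum_X_mul_pderiv
      rw [nsmul_eq_mul] at h2
      have h3 : C ((d + 1 : ℕ) : K) * F ∈ Ideal.span (Set.range g) := by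
        rw [map_natCast, ← h2]
        exact Ideal.sum_mem _ fun j _ => Ideal.mul_mem_left _ _ (hFg j)
      have h4 := Ideal.mul_mem_left _ (C ((d + 1 : ℕ) : K)⁻¹) h3
      rwa [← mul_assoc, ← C_mul, inv_mul_cancel₀ hd, C_1, one_mul] at h4
    obtain ⟨b, hb, hFb⟩ := exists_forms_mem_adjoin hg hF h1
    have hcard : Fintype.card (Fin m ⊕ Fin m) = m + m := by simp
    refine ⟨m + m, by omega, Sum.elim g b ∘ (Fintype.equivFinOfCardEq hcard).symm, fun i => ?_, ?_⟩
    · rw [Function.comp_apply]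
      rcases (Fintype.equivFinOfCardEq hcard).symm i with j | j
      · exact hg j
      · exact hb j
    · rwa [Set.range_comp, (Fintype.equivFinOfCardEq hcard).symm.range_eq_univ, Set.image_univ]

end Collapse

section LinearCombination

variable {K : Type*} [Field K] {N : ℕ} {ι : Type*} [Fintype ι]

theorem height_map_C_le {R : Type*} [CommRing R] [IsNoetherianRing R] (P : Ideal R)
    [hP : P.IsPrime] :
    (P.map (C : R →+* MvPolynomial ι R)).IsPrime ∧
      (P.map (C : R →+* MvPolynomial ι R)).height ≤ P.height := by
  have hprime : (P.map (C : R →+* MvPolynomial ι R)).IsPrime := by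
    rw [← Ideal.Quotient.isDomain_iff_prime]
    exact (quotientEquivQuotientMvPolynomial (σ := ι) P).symm.toMulEquiv.isDomain _
  refine ⟨hprime, ?_⟩
  have hover : (P.map (C : R →+* MvPolynomial ι R)).LiesOver P := ⟨by
    ext f
    rw [Ideal.under_def, Ideal.mem_comap, algebraMap_eq, mem_map_C_iff]
    refine ⟨fun h m => ?_, fun h => by simpa using h 0⟩
    classical
    rw [coeff_C]
    split_ifs
    · exact h
    · exact P.zero_mem⟩
  have h := Ideal.height_le_height_add_of_liesOver P (P.map (C : R →+* MvPolynomial ι R))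
  have h0 : ((P.map (C : R →+* MvPolynomial ι R)).map
      (Ideal.Quotient.mk (P.map (algebraMap R (MvPolynomial ι R))))) = ⊥ := by
    rw [algebraMap_eq, Ideal.map_quotient_self]
  have hnt : Nontrivial (MvPolynomial ι R ⧸ P.map (algebraMap R (MvPolynomial ι R))) :=
    Ideal.Quotient.nontrivial_iff.2 hprime.ne_top
  rwa [h0, Ideal.height_bot, add_zero] at h

theorem height_comap_C_le {R : Type*} [CommRing R] [IsNoetherianRing R]
    (P : Ideal (MvPolynomial ι R)) [hP : P.IsPrime] :
    (P.comap (C : R →+* MvPolynomial ι R)).height ≤ P.height := by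
  have hover : P.LiesOver (P.comap (C : R →+* MvPolynomial ι R)) := ⟨rfl⟩
  rw [Ideal.height_eq_height_add_of_liesOver_of_hasGoingDown
    (P.comap (C : R →+* MvPolynomial ι R)) P]
  exact le_self_add

/-- A dependency between differentials modulo a homogeneous prime may be taken homogeneous. -/
theorem exists_homogeneous_dependency {y : ι → MvPolynomial (Fin N) K} {e : ι → ℕ} {d : ℕ}
    (he0 : ∀ i, 0 < e i) (hed : ∀ i, e i ≤ d) (hy : ∀ i, (y i).IsHomogeneous (e i))
    {P : Ideal (MvPolynomial (Fin N) K)} (hP : HomIdeal P)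
    {a : ι → MvPolynomial (Fin N) K} (ha : ∀ k, ∑ i, a i * pderiv k (y i) ∈ P) {i0 : ι}
    (hi0 : a i0 ∉ P) (hd : e i0 = d) :
    ∃ (D : ℕ) (b : ι → MvPolynomial (Fin N) K), (∀ i, (b i).IsHomogeneous (D + (d - e i))) ∧
      b i0 ∉ P ∧ ∀ k, ∑ i, b i * pderiv k (y i) ∈ P := by
  obtain ⟨D, hD⟩ : ∃ D, homogeneousComponent D (a i0) ∉ P := by
    by_contra! h
    refine hi0 ?_
    rw [← sum_homogeneousComponent (a i0)]
    exact Ideal.sum_mem _ fun D _ => h D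
  refine ⟨D, fun i => homogeneousComponent (D + (d - e i)) (a i),
    fun i => homogeneousComponent_isHomogeneous _ _, by beta_reduce; rwa [hd, Nat.sub_self, add_zero], fun k => ?_⟩
  have h := hP _ (ha k) (D + (d - 1))
  rw [map_sum] at h
  have h3 : ∀ i, homogeneousComponent (D + (d - 1)) (a i * pderiv k (y i)) =
      homogeneousComponent (D + (d - e i)) (a i) * pderiv k (y i) := fun i => by
    have h1 := he0 i
    have h2 := hed i
    have h4 : D + (d - 1) - (e i - 1) = D + (d - e i) := by omega
    rw [homogeneousComponent_mul_of_isHomogeneous (hy i).pderiv, if_pos (by omega), h4]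
  simpa only [h3] using h

/-- If the differentials of the forms `y i` are dependent modulo a homogeneous prime `P`, the
dependency involving a form of top degree `d`, then a `K`-linear combination of the forms of
degree `d` has a differential vanishing modulo a prime of only slightly larger height. -/
theorem exists_pderiv_linearCombination_mem [IsAlgClosed K]
    {y : ι → MvPolynomial (Fin N) K} {e : ι → ℕ} {d : ℕ}
    (he0 : ∀ i, 0 < e i) (hed : ∀ i, e i ≤ d) (hy : ∀ i, (y i).IsHomogeneous (e i))
    {P : Ideal (MvPolynomial (Fin N) K)} [hPp : P.IsPrime] (hP : HomIdeal P)
    {a : ι → MvPolynomial (Fin N) K} (ha : ∀ k, ∑ i, a i * pderiv k (y i) ∈ P) {i0 : ι}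
    (hi0 : a i0 ∉ P) (hd : e i0 = d) :
    ∃ c : ι → K, (∀ i, e i < d → c i = 0) ∧ c i0 = 1 ∧
      ∃ Q : Ideal (MvPolynomial (Fin N) K), Q.IsPrime ∧
        Q.height ≤ P.height + (2 * Fintype.card ι : ℕ) ∧
        ∀ k, pderiv k (∑ i, C (c i) * y i) ∈ Q := by
  classical
  obtain ⟨D, b, hb, hb0, hbP⟩ := exists_homogeneous_dependency he0 hed hy hP ha hi0 hd
  let L := FractionRing (MvPolynomial (Fin N) K ⧸ P)
  let g : MvPolynomial (Fin N) K →+* L :=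
    (algebraMap (MvPolynomial (Fin N) K ⧸ P) L).comp (Ideal.Quotient.mk P)
  have hg : ∀ f, g f = 0 ↔ f ∈ P := fun f => by
    rw [RingHom.comp_apply, FaithfulSMul.algebraMap_eq_zero_iff, Ideal.Quotient.eq_zero_iff_mem]
  have hgb : g (b i0) ≠ 0 := fun h => hb0 ((hg _).1 h)
  let r : ι → L := fun i => g (b i) / g (b i0)
  let ψ : MvPolynomial ι K →+* L := eval₂Hom (g.comp C) fun i => if e i = d then r i else 0
  have hψ : RingHom.ker ψ ≠ ⊤ := RingHom.ker_ne_top ψ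
  obtain ⟨c, hc⟩ : ∃ c : ι → K, ∀ f ∈ RingHom.ker ψ, eval c f = 0 := by
    by_contra! h
    refine hψ ?_
    rw [← Ideal.radical_eq_top, ← vanishingIdeal_zeroLocus_eq_radical (K := K)]
    rw [Ideal.eq_top_iff_one, mem_vanishingIdeal_iff]
    intro x hx
    obtain ⟨f, hf, hfx⟩ := h x
    refine absurd ?_ hfx
    have := hx f hf
    exact (DFunLike.congr_fun (coe_aeval_eq_eval x) f).symm.trans this
  have hclow : ∀ i, e i < d → c i = 0 := fun i hi => by
    have := hc (X i) (by rw [RingHom.mem_ker, coe_eval₂Hom, eval₂_X, if_neg hi.ne])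
    rwa [eval_X] at this
  have hci0 : c i0 = 1 := by
    have := hc (X i0 - 1) (by
      rw [RingHom.mem_ker, map_sub, map_one, coe_eval₂Hom, eval₂_X, if_pos hd, sub_eq_zero]
      exact div_self hgb)
    rwa [map_sub, map_one, eval_X, sub_eq_zero] at this
  refine ⟨c, hclow, hci0, ?_⟩
  let Θ : MvPolynomial ι (MvPolynomial (Fin N) K) →+* Polynomial L :=
    eval₂Hom (dilate g) fun i => Polynomial.C (r i) * Polynomial.X ^ (d - e i)
  let ev : MvPolynomial ι (MvPolynomial (Fin N) K) →+* K := eval₂Hom constantCoeff c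
  have hle : RingHom.ker Θ ≤ RingHom.ker ev := by
    intro f hf
    have h1 : (Polynomial.evalRingHom 0).comp Θ = ψ.comp (map constantCoeff) := by
      refine MvPolynomial.ringHom_ext (fun f => ?_) fun i => ?_
      · have : (Polynomial.evalRingHom 0).comp (dilate g) = (g.comp C).comp constantCoeff := by
          refine MvPolynomial.ringHom_ext (fun x => ?_) fun i => ?_
          · simp [dilate]
          · simp [dilate]
        simpa [Θ, ψ] using DFunLike.congr_fun this f
      · have := hed i
        simp only [RingHom.comp_apply, Θ, ψ, coe_eval₂Hom, eval₂_X, map_X,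
          Polynomial.coe_evalRingHom, Polynomial.eval_mul, Polynomial.eval_C, Polynomial.eval_pow,
          Polynomial.eval_X]
        split_ifs with h
        · simp [h]
        · rw [zero_pow (by omega), mul_zero]
    have h2 : map constantCoeff f ∈ RingHom.ker ψ := by
      rw [RingHom.mem_ker, ← RingHom.comp_apply, ← h1, RingHom.comp_apply, RingHom.mem_ker.1 hf,
        map_zero]
    have h3 := hc _ h2
    rwa [eval_map] at h3
  have hPΘ : P.map C ≤ RingHom.ker Θ := by
    rw [Ideal.map_le_iff_le_comap]
    intro f hf
    rw [Ideal.mem_comap, RingHom.mem_ker, coe_eval₂Hom, eval₂_C]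
    ext n
    rw [coeff_dilate, Polynomial.coeff_zero, hg]
    exact hP f hf n
  have hrel : ∀ i, C (b i0) * X i - C (b i) ∈ RingHom.ker Θ := fun i => by
    rw [RingHom.mem_ker, map_sub, map_mul, coe_eval₂Hom, eval₂_C, eval₂_C, eval₂_X,
      dilate_of_isHomogeneous g (hb i0), dilate_of_isHomogeneous g (hb i), hd, Nat.sub_self,
      add_zero, sub_eq_zero, pow_add]
    have h1 : g (b i) = g (b i0) * r i := (mul_div_cancel₀ _ hgb).symm
    rw [h1, map_mul]
    ring
  have hb0Θ : C (b i0) ∉ RingHom.ker Θ := by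
    rw [RingHom.mem_ker, coe_eval₂Hom, eval₂_C, dilate_of_isHomogeneous g (hb i0)]
    exact mul_ne_zero (Polynomial.C_ne_zero.2 hgb) (pow_ne_zero _ Polynomial.X_ne_zero)
  obtain ⟨hPC, hPCh⟩ := height_map_C_le (ι := ι) P
  have hΘp : (RingHom.ker Θ).IsPrime := RingHom.ker_isPrime Θ
  have hevp : (RingHom.ker ev).IsPrime := RingHom.ker_isPrime ev
  obtain ⟨Q₁, hQ₁, hPQ₁, hrelQ₁, hQ₁Θ, hQ₁h⟩ := exists_prime_height_le hPΘ
    (t := Finset.univ.image fun i => C (b i0) * X i - C (b i)) fun x hx => by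
      obtain ⟨i, -, rfl⟩ := Finset.mem_image.1 hx
      exact hrel i
  obtain ⟨Q₂, hQ₂, hPQ₂, hcQ₂, -, hQ₂h⟩ := exists_prime_height_le (hQ₁Θ.trans hle)
    (t := Finset.univ.image fun i => X i - C (C (c i))) fun x hx => by
      obtain ⟨i, -, rfl⟩ := Finset.mem_image.1 hx
      rw [RingHom.mem_ker, map_sub, coe_eval₂Hom, eval₂_X, eval₂_C, constantCoeff_C, sub_self]
  refine ⟨Q₂.comap C, inferInstance, (height_comap_C_le Q₂).trans ?_, fun k => ?_⟩
  · refine hQ₂h.trans ?_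
    refine (add_le_add_left (hQ₁h.trans (add_le_add_left hPCh _)) _).trans ?_
    rw [add_assoc]
    gcongr
    rw [two_mul]
    push_cast
    gcongr <;> exact_mod_cast Finset.card_image_le
  · have h1 : ∑ i, X i * C (pderiv k (y i)) ∈ Q₁ := by
      refine (hQ₁.mem_or_mem (x := C (b i0)) ?_).resolve_left fun h => hb0Θ (hQ₁Θ h)
      have h2 : C (b i0) * ∑ i, X i * C (pderiv k (y i)) =
          ∑ i, (C (b i0) * X i - C (b i)) * C (pderiv k (y i)) +
            C (∑ i, b i * pderiv k (y i)) := by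
        rw [map_sum, ← Finset.sum_add_distrib, Finset.mul_sum]
        refine Finset.sum_congr rfl fun i _ => ?_
        rw [map_mul]
        ring
      rw [h2]
      refine add_mem (Ideal.sum_mem _ fun i _ => Ideal.mul_mem_right _ _
        (hrelQ₁ _ (Finset.mem_image_of_mem _ (Finset.mem_univ i)))) ?_
      exact hPQ₁ (Ideal.mem_map_of_mem _ (hbP k))
    have h3 : C (pderiv k (∑ i, C (c i) * y i)) =
        ∑ i, X i * C (pderiv k (y i)) - ∑ i, (X i - C (C (c i))) * C (pderiv k (y i)) := by
      rw [← Finset.sum_sub_distrib, map_sum, map_sum]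
      refine Finset.sum_congr rfl fun i _ => ?_
      rw [pderiv_C_mul, map_mul]
      ring
    rw [Ideal.mem_comap, h3]
    exact sub_mem (hPQ₂ h1) (Ideal.sum_mem _ fun i _ => Ideal.mul_mem_right _ _
      (hcQ₂ _ (Finset.mem_image_of_mem _ (Finset.mem_univ i))))

end LinearCombination

section Regularization

variable {K : Type*} [Field K] {N : ℕ}

/-- Bound for the effect of the elimination of one form of top degree. -/
def step (T : ℕ → ℕ) (x : ℕ) : ℕ := T (x + 2 * T (3 * x + 2) + 1) + x

theorem step_monotone {T : ℕ → ℕ} (hT : Monotone T) : Monotone (step T) := by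
  intro x y h
  have h1 : T (3 * x + 2) ≤ T (3 * y + 2) := hT (by omega)
  have h2 : T (x + 2 * T (3 * x + 2) + 1) ≤ T (y + 2 * T (3 * y + 2) + 1) := hT (by omega)
  unfold step
  omega

theorem le_step (T : ℕ → ℕ) (x : ℕ) : x ≤ step T x := Nat.le_add_left _ _

theorem Regularizable.zero : Regularizable K N 0 id := by
  intro n s y hy
  refine ⟨0, Nat.zero_le _, Fin.elim0, fun i => i.elim0, fun P _ _ ⟨a, ⟨i, _⟩, _⟩ => i.elim0,
    fun i => ?_⟩
  obtain ⟨e, h0, h1, -⟩ := hy i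
  omega

/-- If adjoining forms of degree `d + 1` to a good family of smaller degree destroys goodness,
one of the forms can be replaced by few forms of smaller degree. -/
theorem Regularizable.exists_of_not_good [IsAlgClosed K] {d : ℕ} {T : ℕ → ℕ} (hT : Monotone T)
    (hreg : Regularizable K N d T) {l s a : ℕ} {low : Fin l → MvPolynomial (Fin N) K}
    {top : Fin a → MvPolynomial (Fin N) K} (hlow : Forms d low)
    (htop : ∀ j, (top j).IsHomogeneous (d + 1)) (hgood : Good (s + a) low)
    (hnot : ¬ Good s (Sum.elim low top)) :
    ∃ (j0 : Fin a) (c : Fin a → K), c j0 = 1 ∧ ∃ m ≤ 2 * T (3 * (l + s + a) + 2) + 1,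
      ∃ z : Fin m → MvPolynomial (Fin N) K, Forms d z ∧
        ∑ j, C (c j) * top j ∈ Algebra.adjoin K (Set.range z) := by
  choose e he0 hed he using hlow
  let y : Fin l ⊕ Fin a → MvPolynomial (Fin N) K := Sum.elim low top
  let e' : Fin l ⊕ Fin a → ℕ := Sum.elim e fun _ => d + 1
  have hy0 : ∀ i, 0 < e' i := by
    rintro (i | j)
    exacts [he0 i, Nat.succ_pos d]
  have hyd : ∀ i, e' i ≤ d + 1 := by
    rintro (i | j)
    exacts [(hed i).trans (Nat.le_succ d), le_rfl]
  have hyh : ∀ i, (y i).IsHomogeneous (e' i) := by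
    rintro (i | j)
    exacts [he i, htop j]
  obtain ⟨P, hP, hom, hyP, ⟨b, ⟨i, hi⟩, hb⟩, hlt⟩ : ∃ P : Ideal (MvPolynomial (Fin N) K),
      P.IsPrime ∧ HomIdeal P ∧ (∀ i, y i ∈ P) ∧ JacDep y P ∧
        P.height < ((Fintype.card (Fin l ⊕ Fin a) + s : ℕ) : ℕ∞) := by
    by_contra! h
    exact hnot (good_of_homIdeal (fun i => ⟨e' i, hy0 i, hyd i, hyh i⟩) h)
  have hcard : Fintype.card (Fin l ⊕ Fin a) = l + a := by simp
  rw [hcard] at hlt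
  obtain ⟨j0, hj0⟩ : ∃ j0, b (Sum.inr j0) ∉ P := by
    by_contra! hall
    refine absurd (hgood P hP (fun i => hyP (Sum.inl i)) ⟨fun i => b (Sum.inl i), ?_, fun k => ?_⟩)
      (not_le.2 ?_)
    · rcases i with i | j
      · exact ⟨i, hi⟩
      · exact absurd (hall j) hi
    · have h := hb k
      rw [Fintype.sum_sum_type] at h
      exact (Ideal.add_mem_iff_left _
        (Ideal.sum_mem _ fun j _ => Ideal.mul_mem_right _ _ (hall j))).1 h
    · rw [Fintype.card_fin]
      refine hlt.trans_le ?_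
      exact_mod_cast (by omega : l + a + s ≤ l + (s + a))
  obtain ⟨c, hclow, hc1, Q, hQ, hQh, hQF⟩ :=
    exists_pderiv_linearCombination_mem hy0 hyd hyh hom hb hj0 rfl
  have hsum : ∑ i, C (c i) * y i = ∑ j, C (c (Sum.inr j)) * top j := by
    rw [Fintype.sum_sum_type, Finset.sum_eq_zero, zero_add]
    · rfl
    · intro i _
      rw [hclow (Sum.inl i) (Nat.lt_succ_of_le (hed i)), map_zero, zero_mul]
  rw [hsum] at hQF
  have hF : (∑ j, C (c (Sum.inr j)) * top j).IsHomogeneous (d + 1) :=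
    IsHomogeneous.sum _ _ _ fun j _ => (htop j).C_mul _
  have hQk : Q.height ≤ (3 * (l + s + a) : ℕ) := by
    refine hQh.trans ((add_le_add_left hlt.le _).trans ?_)
    rw [hcard]
    exact_mod_cast (by omega : l + a + s + 2 * (l + a) ≤ 3 * (l + s + a))
  obtain ⟨m, hm, z, hz, hFz⟩ := hreg.exists_mem_adjoin hT hF hQF hQk
  exact ⟨j0, fun j => c (Sum.inr j), hc1, m, hm, z, hz, hFz⟩

theorem Regularizable.exists_good_of_low_of_top [IsAlgClosed K] {d : ℕ} {T : ℕ → ℕ}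
    (hT : Monotone T) (hreg : Regularizable K N d T) (s : ℕ) :
    ∀ (a l x : ℕ) (low : Fin l → MvPolynomial (Fin N) K) (top : Fin a → MvPolynomial (Fin N) K),
      Forms d low → (∀ j, (top j).IsHomogeneous (d + 1)) → Good (s + a) low → l + s + a ≤ x →
      ∃ m ≤ (step T)^[a] x, ∃ g : Fin m → MvPolynomial (Fin N) K, Forms (d + 1) g ∧ Good s g ∧
        (∀ i, low i ∈ Algebra.adjoin K (Set.range g)) ∧
        ∀ j, top j ∈ Algebra.adjoin K (Set.range g) := by
  intro a
  induction a with
  | zero =>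
    intro l x low top hlow htop hgood hx
    refine ⟨l, ?_, low, fun i => ?_, hgood, fun i => Algebra.subset_adjoin ⟨i, rfl⟩,
      fun j => j.elim0⟩
    · rw [Function.iterate_zero, id]
      omega
    · obtain ⟨e, h0, h1, h2⟩ := hlow i
      exact ⟨e, h0, h1.trans (Nat.le_succ d), h2⟩
  | succ a ih =>
    intro l x low top hlow htop hgood hx
    by_cases hnot : Good s (Sum.elim low top)
    · have hforms : Forms (d + 1) (Sum.elim low top) := by
        rintro (i | j)
        · obtain ⟨e, h0, h1, h2⟩ := hlow i
          exact ⟨e, h0, h1.trans (Nat.le_succ d), h2⟩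
        · exact ⟨d + 1, Nat.succ_pos d, le_rfl, htop j⟩
      have hrange : Set.range (Sum.elim low top ∘ finSumFinEquiv.symm) =
          Set.range (Sum.elim low top) := finSumFinEquiv.symm.surjective.range_comp _
      refine ⟨l + (a + 1), le_trans (b := x) (by omega) (Function.id_le_iterate_of_id_le (le_step T) _ x),
        Sum.elim low top ∘ finSumFinEquiv.symm, fun i => hforms _,
        hnot.comp hforms _ finSumFinEquiv.symm.injective, fun i => ?_, fun j => ?_⟩
      · rw [hrange]
        exact Algebra.subset_adjoin ⟨Sum.inl i, rfl⟩
      · rw [hrange]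
        exact Algebra.subset_adjoin ⟨Sum.inr j, rfl⟩
    · obtain ⟨j0, c, hc, m, hm, z, hz, hFz⟩ :=
        hreg.exists_of_not_good hT hlow htop hgood hnot
      have hforms : Forms d (Sum.elim low z ∘ finSumFinEquiv.symm) := by
        have h : Forms d (Sum.elim low z) := by
          rintro (i | j)
          exacts [hlow i, hz j]
        exact fun i => h _
      obtain ⟨l', hl', low', hlow', hgood', hmem'⟩ := hreg (l + m) (s + a) _ hforms
      have hrange : Set.range (Sum.elim low z ∘ finSumFinEquiv.symm) =
          Set.range (Sum.elim low z) := finSumFinEquiv.symm.surjective.range_comp _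
      have hmem : ∀ i, Sum.elim low z i ∈ Algebra.adjoin K (Set.range low') := fun i => by
        have h := hmem' (finSumFinEquiv i)
        rwa [Function.comp_apply, Equiv.symm_apply_apply] at h
      have hx' : l' + s + a ≤ step T x := by
        have h1 : T (3 * (l + s + (a + 1)) + 2) ≤ T (3 * x + 2) := hT (by omega)
        have h2 : T (l + m + (s + a)) ≤ T (x + 2 * T (3 * x + 2) + 1) := hT (by omega)
        unfold step
        omega
      obtain ⟨n, hn, g, hg, hgg, hlowg, htopg⟩ := ih l' (step T x) low' (top ∘ j0.succAbove) hlow'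
        (fun j => htop _) hgood' hx'
      have hle : Algebra.adjoin K (Set.range low') ≤ Algebra.adjoin K (Set.range g) := by
        refine Algebra.adjoin_le ?_
        rintro _ ⟨i, rfl⟩
        exact hlowg i
      have hlez : Algebra.adjoin K (Set.range z) ≤ Algebra.adjoin K (Set.range g) := by
        refine Algebra.adjoin_le ?_
        rintro _ ⟨i, rfl⟩
        exact hle (hmem (Sum.inr i))
      refine ⟨n, hn, g, hg, hgg, fun i => hle (hmem (Sum.inl i)), fun j => ?_⟩
      rcases Fin.eq_self_or_eq_succAbove j0 j with rfl | ⟨i, rfl⟩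
      · have h1 := hlez hFz
        rw [Fin.sum_univ_succAbove _ j, hc, C_1, one_mul] at h1
        refine (add_mem_cancel_right ?_).1 h1
        exact Subalgebra.sum_mem _ fun i _ => Subalgebra.mul_mem _
          (Subalgebra.algebraMap_mem _ (c (j.succAbove i))) (htopg i)
      · exact htopg i

theorem Regularizable.succ [IsAlgClosed K] {d : ℕ} {T : ℕ → ℕ} (hT : Monotone T)
    (hreg : Regularizable K N d T) :
    Regularizable K N (d + 1) fun x => (step T)^[x + 1] x := by
  classical
  intro n s y hy
  let p : Fin n → Prop := fun i => (y i).IsHomogeneous (d + 1)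
  have hcard : Fintype.card {i // p i} + Fintype.card {i // ¬ p i} = n := by
    rw [← Fintype.card_sum, Fintype.card_congr (Equiv.sumCompl p), Fintype.card_fin]
  let f := Fintype.equivFin {i // p i}
  let f' := Fintype.equivFin {i // ¬ p i}
  set a := Fintype.card {i // p i}
  set b := Fintype.card {i // ¬ p i}
  have hlow : Forms d fun i => y (f'.symm i) := by
    intro i
    obtain ⟨e, h0, h1, h2⟩ := hy (f'.symm i)
    refine ⟨e, h0, Nat.le_of_lt_succ (lt_of_le_of_ne h1 ?_), h2⟩
    rintro rfl
    exact (f'.symm i).2 h2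
  obtain ⟨l, hl, low, hlow', hgood, hmem⟩ := hreg b (s + a) _ hlow
  have hl' : l + s + a ≤ step T (n + s) := by
    have h1 : T (b + (s + a)) ≤ T (n + s + 2 * T (3 * (n + s) + 2) + 1) := hT (by omega)
    unfold step
    omega
  obtain ⟨m, hm, g, hg, hgg, hlowg, htopg⟩ := hreg.exists_good_of_low_of_top hT s a l _ low
    (fun j => y (f.symm j)) hlow' (fun j => (f.symm j).2) hgood hl'
  refine ⟨m, hm.trans ?_, g, hg, hgg, fun i => ?_⟩
  · beta_reduce
    rw [Function.iterate_succ_apply]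
    exact Function.monotone_iterate_of_id_le (le_step T) (by omega : a ≤ n + s) _
  · by_cases hi : p i
    · have h := htopg (f ⟨i, hi⟩)
      rwa [Equiv.symm_apply_apply] at h
    · have h := hmem (f' ⟨i, hi⟩)
      rw [Equiv.symm_apply_apply] at h
      refine Algebra.adjoin_le ?_ h
      rintro _ ⟨j, rfl⟩
      exact hlowg j

end Regularization

section Bounds

theorem knuth_one (b x : ℕ) : knuth b 1 x = b ^ x := by rw [knuth]

theorem knuth_zero_right (b k : ℕ) : knuth b (k + 1) 0 = 1 := by
  cases k with
  | zero => rw [zero_add, knuth_one, pow_zero]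
  | succ k => rw [knuth]

theorem knuth_one_right (b k : ℕ) : knuth b (k + 1) 1 = b := by
  cases k with
  | zero => rw [zero_add, knuth_one, pow_one]
  | succ k => rw [knuth]

theorem knuth_succ_succ (b k x : ℕ) :
    knuth b (k + 2) (x + 1) = knuth b (k + 1) (knuth b (k + 2) x) := by
  cases x with
  | zero => rw [zero_add, knuth_one_right b (k + 1), knuth_zero_right b (k + 1), knuth_one_right]
  | succ x => rw [knuth]

variable {b : ℕ}

theorem three_pow_le_knuth (hb : 3 ≤ b) (k x : ℕ) : 3 ^ x ≤ knuth b (k + 1) x := by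
  induction k generalizing x with
  | zero =>
    rw [zero_add, knuth_one]
    exact Nat.pow_le_pow_left hb x
  | succ k ih =>
    induction x with
    | zero => rw [knuth_zero_right, pow_zero]
    | succ x ihx =>
      rw [knuth_succ_succ]
      exact (Nat.pow_le_pow_right (by norm_num) (le_trans (Nat.lt_pow_self (by norm_num)) ihx)).trans
        (ih _)

theorem lt_knuth (hb : 3 ≤ b) (k x : ℕ) : x < knuth b (k + 1) x :=
  (Nat.lt_pow_self (by norm_num)).trans_le (three_pow_le_knuth hb k x)

theorem two_mul_knuth_le (hb : 3 ≤ b) (k x : ℕ) :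
    2 * knuth b (k + 1) x ≤ knuth b (k + 1) (x + 1) := by
  cases k with
  | zero =>
    rw [zero_add, knuth_one, knuth_one, pow_succ, mul_comm]
    exact Nat.mul_le_mul_left _ (by omega)
  | succ k =>
    rw [knuth_succ_succ]
    have h : ∀ z : ℕ, 2 * z ≤ 3 ^ z := fun z => by
      induction z with
      | zero => simp
      | succ z ih =>
        have := Nat.one_le_pow z 3 (by norm_num)
        rw [pow_succ]
        omega
    exact (h _).trans (three_pow_le_knuth hb k _)

theorem knuth_monotone (hb : 3 ≤ b) (k : ℕ) : Monotone (knuth b (k + 1)) :=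
  monotone_nat_of_le_succ fun x => by
    have := two_mul_knuth_le hb k x
    omega

theorem knuth_level_monotone (hb : 3 ≤ b) (x : ℕ) : Monotone fun k => knuth b (k + 1) x :=
  monotone_nat_of_le_succ fun k => by
    cases x with
    | zero => rw [knuth_zero_right, knuth_zero_right]
    | succ x =>
      rw [knuth_succ_succ]
      exact knuth_monotone hb k (lt_knuth hb (k + 1) x)

theorem mul_add_le_three_pow {a c u : ℕ} (h : a * u + c ≤ 3 ^ u) (ha : a ≤ 3 ^ u) {z : ℕ}
    (hz : u ≤ z) : a * z + c ≤ 3 ^ z := by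
  induction z, hz using Nat.le_induction with
  | base => exact h
  | succ z hz ih =>
    have := ha.trans (Nat.pow_le_pow_right (by norm_num) hz)
    rw [pow_succ, mul_add]
    omega

theorem step_knuth_le (hb : 3 ≤ b) {k : ℕ} {f : ℕ → ℕ}
    (hf : ∀ x, f x ≤ knuth b (k + 1) (8 * x + 7)) {y : ℕ} (hy : 2 ≤ y) :
    step f (knuth b (k + 2) y) ≤ knuth b (k + 2) (y + 4) := by
  set A := knuth b (k + 1)
  have hA : Monotone A := knuth_monotone hb k
  have hA3 : ∀ x, 3 ^ x ≤ A x := three_pow_le_knuth hb k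
  set x := knuth b (k + 2) y with hx
  have hx5 : 5 ≤ x := by
    have h1 : 3 ^ 2 ≤ 3 ^ y := Nat.pow_le_pow_right (by norm_num) hy
    have h2 : 3 ^ y ≤ x := three_pow_le_knuth hb (k + 1) y
    omega
  have h4 : knuth b (k + 2) (y + 4) = A (A (A (A x))) := by
    rw [knuth_succ_succ, knuth_succ_succ, knuth_succ_succ, knuth_succ_succ]
  have h1 : 24 * x + 23 ≤ A x := (mul_add_le_three_pow (by norm_num) (by norm_num) hx5).trans (hA3 x)
  have h2 : f (3 * x + 2) ≤ A (24 * x + 23) := (hf _).trans (hA (by omega))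
  have h3 : 24 * x + 23 < A (24 * x + 23) := lt_knuth hb k _
  have h5 : f (x + 2 * f (3 * x + 2) + 1) ≤ A (31 * A (24 * x + 23)) := (hf _).trans (hA (by omega))
  have h6 : 31 * A (24 * x + 23) < A (31 * A (24 * x + 23)) := lt_knuth hb k _
  have h7 : 2 * A (31 * A (24 * x + 23)) ≤ A (31 * A (24 * x + 23) + 1) := two_mul_knuth_le hb k _
  have h8 : 31 * A (24 * x + 23) + 1 ≤ A (A (24 * x + 23)) :=
    (mul_add_le_three_pow (u := 5) (by norm_num) (by norm_num) (by omega)).trans (hA3 _)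
  rw [h4]
  calc step f x = f (x + 2 * f (3 * x + 2) + 1) + x := rfl
    _ ≤ A (31 * A (24 * x + 23) + 1) := by omega
    _ ≤ A (A (A (24 * x + 23))) := hA h8
    _ ≤ A (A (A (A x))) := hA (hA (hA h1))

/-- Bound for the size of a good family generating a given family of forms of degree at
most `d`. -/
def regBound : ℕ → ℕ → ℕ
  | 0 => id
  | d + 1 => fun x => (step (regBound d))^[x + 1] x

theorem regBound_monotone (d : ℕ) : Monotone (regBound d) := by
  induction d with
  | zero => exact monotone_id
  | succ d ih =>
    intro x y h
    refine ((step_monotone ih).iterate (x + 1) h).trans ?_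
    exact Function.monotone_iterate_of_id_le (le_step _) (by omega : x + 1 ≤ y + 1) y

theorem regBound_le (hb : 3 ≤ b) (d x : ℕ) : regBound d x ≤ knuth b (d + 1) (8 * x + 7) := by
  induction d generalizing x with
  | zero => exact le_trans (by simp only [regBound, id]; omega) (lt_knuth hb 0 _).le
  | succ d ih =>
    have key : ∀ n, (step (regBound d))^[n] x ≤ knuth b (d + 2) (x + 2 + 4 * n) := by
      intro n
      induction n with
      | zero => exact (Nat.le_add_right x 2).trans (lt_knuth hb (d + 1) _).le
      | succ n ihn =>
        rw [Function.iterate_succ_apply']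
        exact (step_monotone (regBound_monotone d) ihn).trans
          (step_knuth_le hb ih (by omega))
    exact (key (x + 1)).trans (knuth_monotone hb (d + 1) (by omega))

theorem mul_add_four_le_pow {d σ : ℕ} (hd : 2 ≤ d) (hσ : 2 ≤ σ) : d * σ + 4 ≤ (d + 1) ^ σ := by
  induction σ, hσ using Nat.le_induction with
  | base => nlinarith
  | succ σ hσ ih =>
    have h := Nat.mul_le_mul_right (d + 1) ih
    have h' : d * 1 ≤ d * (d * σ) := Nat.mul_le_mul_left d (Nat.one_le_iff_ne_zero.2 (by positivity))
    rw [pow_succ]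
    nlinarith

theorem regBound_le_knuth {d σ n : ℕ} (hd : 2 ≤ d) (hσ : 2 ≤ σ) (hn : n ≤ d * σ) :
    regBound d (n + 4) ≤ knuth (d + 1) (d ^ 2 + d - 2) ((d + 1) ^ σ) := by
  have hb : 3 ≤ d + 1 := by omega
  have hX := mul_add_four_le_pow hd hσ
  have hdσ : 2 * 2 ≤ d * σ := Nat.mul_le_mul hd hσ
  obtain ⟨X, hX'⟩ : ∃ X, (d + 1) ^ σ = X + 1 := ⟨(d + 1) ^ σ - 1, by omega⟩
  obtain ⟨L, hL, hdL⟩ : ∃ L, d ^ 2 + d - 2 = L + 1 ∧ d + 1 ≤ L := by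
    have : 2 * d ≤ d ^ 2 := by nlinarith
    exact ⟨d ^ 2 + d - 3, by omega, by omega⟩
  rw [hL, hX']
  calc regBound d (n + 4) ≤ regBound d (X + 1) := regBound_monotone d (by omega)
    _ ≤ knuth (d + 1) (d + 1) (8 * (X + 1) + 7) := regBound_le hb d _
    _ ≤ knuth (d + 1) (d + 1) (knuth (d + 1) (d + 2) X) := by
      refine knuth_monotone hb d (le_trans ?_ (three_pow_le_knuth hb (d + 1) X))
      have := mul_add_le_three_pow (a := 8) (c := 15) (u := 4) (by norm_num) (by norm_num)
        (by omega : 4 ≤ X)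
      omega
    _ = knuth (d + 1) (d + 2) (X + 1) := (knuth_succ_succ _ _ _).symm
    _ ≤ knuth (d + 1) (L + 1) (X + 1) := knuth_level_monotone hb (X + 1) hdL

end Bounds

theorem regularizable_regBound (K : Type*) [Field K] [IsAlgClosed K] (N d : ℕ) :
    Regularizable K N d (regBound d) := by
  induction d with
  | zero => exact Regularizable.zero
  | succ d ih => exact ih.succ (regBound_monotone d)

theorem finite_of_forall_isHomogeneous {K : Type*} [Field K] {N e : ℕ}
    {V : Submodule K (MvPolynomial (Fin N) K)} (hV : ∀ f ∈ V, f.IsHomogeneous e) :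
    Module.Finite K V := by
  have h : V ≤ restrictTotalDegree (Fin N) K e := fun f hf => by
    rw [mem_restrictTotalDegree]
    exact (hV f hf).totalDegree_le
  exact Submodule.finiteDimensional_of_le h

theorem exists_forms_subset_adjoin {K : Type*} [Field K] {N d : ℕ} {δ : Fin d → ℕ}
    {V : Fin d → Submodule K (MvPolynomial (Fin N) K)}
    (hVhom : ∀ i : Fin d, ∀ f ∈ V i, f.IsHomogeneous ((i : ℕ) + 1))
    (hVdim : ∀ i : Fin d, Module.finrank K (V i) = δ i) :
    ∃ n ≤ d * Finset.univ.sup δ, ∃ y : Fin n → MvPolynomial (Fin N) K, Forms d y ∧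
      ∀ i, (V i : Set (MvPolynomial (Fin N) K)) ⊆
        (Algebra.adjoin K (Set.range y) : Subalgebra K (MvPolynomial (Fin N) K)) := by
  have hfin : ∀ i, Module.Finite K (V i) := fun i => finite_of_forall_isHomogeneous (hVhom i)
  let B := fun i => Module.finBasisOfFinrankEq K (V i) (hVdim i)
  let y : (Σ i, Fin (δ i)) → MvPolynomial (Fin N) K := fun p => B p.1 p.2
  have hcard : Fintype.card (Σ i, Fin (δ i)) = ∑ i, δ i := by simp
  let f := Fintype.equivFinOfCardEq hcard
  refine ⟨∑ i, δ i, ?_, y ∘ f.symm, fun j => ?_, fun i v hv => ?_⟩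
  · refine (Finset.sum_le_card_nsmul _ _ _ fun i hi => Finset.le_sup hi).trans_eq ?_
    rw [Finset.card_univ, Fintype.card_fin, smul_eq_mul]
  · exact ⟨(f.symm j).1 + 1, Nat.succ_pos _, (f.symm j).1.2, hVhom _ _ (B _ _).2⟩
  · rw [f.symm.surjective.range_comp]
    have h := congrArg (V i).subtype ((B i).sum_repr ⟨v, hv⟩)
    rw [map_sum] at h
    have hv' : v = ∑ j, (B i).repr ⟨v, hv⟩ j • y ⟨i, j⟩ := h.symm
    rw [SetLike.mem_coe, hv']
    exact Subalgebra.sum_mem _ fun j _ =>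
      Subalgebra.smul_mem _ (Algebra.subset_adjoin (Set.mem_range_self (f := y) ⟨i, j⟩)) _

end SmallSubalg

/-- Small subalgebra bound: a graded vector space `V = ⊕_{i=1}^d V_i` of forms with
dimension vector `δ` and `σ = max{2, δ_1, …, δ_d}` is contained in a `K`-subalgebra
generated by an `R_3`-sequence of forms of degrees at most `d` and length at most
`(d+1) ↑^(d²+d-2) ((d+1)^σ)`. -/
theorem small_subalgebra_R3 {K : Type*} [Field K] [IsAlgClosed K] {N : ℕ}
    (d : ℕ) (hd : 2 ≤ d) (δ : Fin d → ℕ)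
    (V : Fin d → Submodule K (MvPolynomial (Fin N) K))
    (hVhom : ∀ i : Fin d, ∀ f ∈ V i, f.IsHomogeneous ((i : ℕ) + 1))
    (hVdim : ∀ i : Fin d, Module.finrank K (V i) = δ i)
    (σ : ℕ) (hσ : σ = max 2 (Finset.univ.sup δ)) :
    ∃ n : ℕ, n ≤ knuth (d + 1) (d ^ 2 + d - 2) ((d + 1) ^ σ) ∧
      ∃ y : Fin n → MvPolynomial (Fin N) K,
        (∀ j, ∃ e : ℕ, 0 < e ∧ e ≤ d ∧ (y j).IsHomogeneous e) ∧
        IsSerreSeq 3 y ∧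
        ∀ i : Fin d, (V i : Set (MvPolynomial (Fin N) K)) ⊆
          (Algebra.adjoin K (Set.range y) : Subalgebra K (MvPolynomial (Fin N) K)) := by
  obtain ⟨n, hn, y, hy, hV⟩ := SmallSubalg.exists_forms_subset_adjoin hVhom hVdim
  have hσ2 : 2 ≤ σ := hσ ▸ le_max_left _ _
  have hnσ : n ≤ d * σ := hn.trans (Nat.mul_le_mul_left d (hσ ▸ le_max_right _ _))
  obtain ⟨m, hm, g, hg, hgood, hmem⟩ := SmallSubalg.regularizable_regBound K N d n 4 y hy
  refine ⟨m, hm.trans (SmallSubalg.regBound_le_knuth hd hσ2 hnσ), g, hg,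
    SmallSubalg.isSerreSeq_of_good hg hgood, fun i => (hV i).trans (Algebra.adjoin_le ?_)⟩
  rintro _ ⟨j, rfl⟩
  exact hmem j
end

section
/- Let η ≥ 2. Define A_2(η) = η + 2 and, for d ≥ 3, A_d(η) = d↑^{d²−d−1}(3^η). Then for every d ≥ 2 and every nonzero homogeneous form F ∈ R of positive degree at most d with str(F) ≥ A_d(η), the quotient ring R/FR satisfies Serre's condition R_η. -/
open MvPolynomial

/-- `F` has a `k`-collapse: `F = Σ_{i=1}^k f_i g_i` with all `f_i, g_i`
homogeneous of positive degree.  The strength of `F` is `≥ k` iff `F` has no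
`k`-collapse. -/
def HasCollapse {K : Type*} [CommSemiring K] {N : ℕ} (k : ℕ)
    (F : MvPolynomial (Fin N) K) : Prop :=
  ∃ f g : Fin k → MvPolynomial (Fin N) K,
    (∀ i, ∃ d > 0, (f i).IsHomogeneous d) ∧
    (∀ i, ∃ d > 0, (g i).IsHomogeneous d) ∧
    F = ∑ i, f i * g i

open IsLocalRing

theorem mul_le_knuth {a : ℕ} (ha : 2 ≤ a) (k b : ℕ) (hb : 0 < b) : a * b ≤ knuth a k b := by
  have hpow (b : ℕ) (hb : 0 < b) : a * b ≤ a ^ b := by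
    obtain ⟨c, rfl⟩ := Nat.exists_eq_succ_of_ne_zero hb.ne'
    rw [pow_succ']
    exact Nat.mul_le_mul_left a (Nat.lt_pow_self (by omega))
  fun_induction knuth a k b with
  | case1 b => exact hpow b hb
  | case2 b => exact hpow b hb
  | case3 => omega
  | case4 => simp
  | case5 k b ih1 ih2 =>
    have h0 : b + 2 ≤ knuth a (k + 2) (b + 1) := by nlinarith [ih1 (by omega)]
    exact (Nat.mul_le_mul_left a h0).trans (ih2 (by omega))

theorem mul_le_strength_bound {η d e : ℕ} (hd : 2 ≤ d) (hed : e ≤ d) :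
    (η + 1) * (e - 1) ≤ if d = 2 then η + 2 else knuth d (d ^ 2 - d - 1) (3 ^ η) := by
  split_ifs with h
  · have : e - 1 ≤ 1 := by omega
    nlinarith
  · have h3 : η + 1 ≤ 3 ^ η := Nat.lt_pow_self (by norm_num)
    calc (η + 1) * (e - 1) ≤ 3 ^ η * d := Nat.mul_le_mul h3 (by omega)
      _ = d * 3 ^ η := mul_comm _ _
      _ ≤ _ := mul_le_knuth hd _ _ (by positivity)

theorem HasCollapse.of_sum {K : Type*} [CommSemiring K] {N k : ℕ} {ι : Type*} (s : Finset ι)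
    (f g : ι → MvPolynomial (Fin N) K) (hs : s.card ≤ k)
    (hf : ∀ i ∈ s, ∃ d > 0, (f i).IsHomogeneous d)
    (hg : ∀ i ∈ s, ∃ d > 0, (g i).IsHomogeneous d) :
    HasCollapse k (∑ i ∈ s, f i * g i) := by
  let u (h : ι → MvPolynomial (Fin N) K) (j : Fin k) : MvPolynomial (Fin N) K :=
    if hj : j.1 < s.card then h (s.equivFin.symm ⟨j, hj⟩) else 0
  have hu (h : ι → MvPolynomial (Fin N) K) (hh : ∀ i ∈ s, ∃ d > 0, (h i).IsHomogeneous d)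
      (j : Fin k) : ∃ d > 0, (u h j).IsHomogeneous d := by
    by_cases hj : j.1 < s.card
    · simpa only [u, dif_pos hj] using hh _ (s.equivFin.symm ⟨j, hj⟩).2
    · simpa only [u, dif_neg hj] using ⟨1, one_pos, isHomogeneous_zero _ _ _⟩
  refine ⟨u f, u g, hu f hf, hu g hg, ?_⟩
  rw [← s.sum_coe_sort, ← s.equivFin.symm.sum_comp]
  refine Finset.sum_of_injOn (Fin.castLE hs) (Fin.castLE_injective hs).injOn (by simp) ?_ ?_
  · intro j _ hj
    have : ¬ j.1 < s.card := fun h => hj ⟨⟨j, h⟩, by simp, rfl⟩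
    simp [u, this]
  · intro i _
    simp [u]

namespace MvPolynomial

variable {σ R : Type*} [CommRing R]

theorem homogeneousComponent_mul (n : ℕ) (p q : MvPolynomial σ R) :
    homogeneousComponent n (p * q) = ∑ x ∈ Finset.HasAntidiagonal.antidiagonal n,
      homogeneousComponent x.1 p * homogeneousComponent x.2 q := by
  classical
  ext d
  simp only [coeff_homogeneousComponent, coeff_sum, coeff_mul]
  rw [Finset.sum_comm]
  split_ifs with h
  · refine Finset.sum_congr rfl fun y hy => ?_
    rw [Finset.HasAntidiagonal.mem_antidiagonal] at hy
    rw [Finset.sum_eq_single (y.1.degree, y.2.degree)]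
    · simp
    · rintro ⟨a, b⟩ _ hne
      by_cases ha : y.1.degree = a
      · have : y.2.degree ≠ b := fun hb => hne (by simp [ha, hb])
        simp [this]
      · simp [ha]
    · intro hn
      refine absurd ?_ hn
      simp [← h, ← hy]
  · symm
    refine Finset.sum_eq_zero fun y hy => Finset.sum_eq_zero fun x hx => ?_
    rw [Finset.HasAntidiagonal.mem_antidiagonal] at hy hx
    by_cases ha : y.1.degree = x.1
    · have : y.2.degree ≠ x.2 := fun hb => h (by rw [← hy, map_add, ha, hb, hx])
      simp [this]
    · simp [ha]

theorem homogeneousComponent_mul_of_totalDegree_le {m n : ℕ} {p q : MvPolynomial σ R}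
    (hp : p.totalDegree ≤ m) (hq : q.totalDegree ≤ n) :
    homogeneousComponent (m + n) (p * q) =
      homogeneousComponent m p * homogeneousComponent n q := by
  rw [homogeneousComponent_mul, Finset.sum_eq_single (m, n)]
  · rintro ⟨a, b⟩ hab hne
    rw [Finset.HasAntidiagonal.mem_antidiagonal] at hab
    by_cases ha : m < a
    · simp [homogeneousComponent_eq_zero a p (by omega)]
    · have : n < b := by
        by_contra hb
        exact hne (by ext <;> simp <;> omega)
      simp [homogeneousComponent_eq_zero b q (by omega)]
  · simp

theorem homogeneousComponent_pow_of_coeff_zero {p : MvPolynomial σ R} (hp : coeff 0 p = 0)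
    {j k : ℕ} (h : j < k) : homogeneousComponent j (p ^ k) = 0 := by
  induction k generalizing j with
  | zero => omega
  | succ k ih =>
    rw [pow_succ, homogeneousComponent_mul]
    refine Finset.sum_eq_zero fun x hx => ?_
    rw [Finset.HasAntidiagonal.mem_antidiagonal] at hx
    by_cases hk : x.1 < k
    · rw [ih hk, zero_mul]
    · have : x.2 = 0 := by omega
      rw [this, homogeneousComponent_zero, hp, C_0, mul_zero]

/-- Substituting `x + a` for `x` does not change the leading form of a polynomial. -/
theorem homogeneousComponent_translate [Nontrivial R] (a : σ → R) {F : MvPolynomial σ R} {e : ℕ}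
    (hF : F.IsHomogeneous e) :
    homogeneousComponent e (aeval (fun i => X i + C (a i)) F) = F := by
  classical
  set τ : MvPolynomial σ R →ₐ[R] MvPolynomial σ R := aeval (fun i => X i + C (a i)) with hτ
  let M (d : σ →₀ ℕ) : Prop := (τ (monomial d 1)).totalDegree ≤ d.degree ∧
    homogeneousComponent d.degree (τ (monomial d 1)) = monomial d 1
  have key (d : σ →₀ ℕ) : M d := by
    have hmul {d d' : σ →₀ ℕ} (h : M d) (h' : M d') : M (d + d') := by
      have hm : (monomial (d + d') (1 : R)) = monomial d 1 * monomial d' 1 := by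
        simp [monomial_mul]
      simp only [M, hm, map_mul, map_add]
      refine ⟨(totalDegree_mul _ _).trans (add_le_add h.1 h'.1), ?_⟩
      rw [homogeneousComponent_mul_of_totalDegree_le h.1 h'.1, h.2, h'.2]
    have hzero : M 0 := by
      have : τ (monomial 0 1) = C 1 := by rw [← C_apply]; simp
      simp only [M, this, map_zero]
      exact ⟨by simp, by simp [homogeneousComponent_zero]⟩
    have hone (i : σ) : M (Finsupp.single i 1) := by
      have : τ (monomial (Finsupp.single i 1) 1) = X i + C (a i) := by
        change τ (X i) = _
        simp [hτ]
      simp only [M, this, Finsupp.degree_single]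
      refine ⟨(totalDegree_add _ _).trans (by simp), ?_⟩
      rw [map_add, homogeneousComponent_eq_zero 1 (C (a i)) (by simp), add_zero]
      exact homogeneousComponent_eq_self (isHomogeneous_X R i)
    induction d using Finsupp.induction_linear with
    | zero => exact hzero
    | add d d' h h' => exact hmul h h'
    | single i n =>
      induction n with
      | zero => simpa using hzero
      | succ n ih => simpa [Finsupp.single_add] using hmul ih (hone i)
  conv_lhs => rw [F.as_sum]
  conv_rhs => rw [F.as_sum]
  rw [map_sum, map_sum]
  refine Finset.sum_congr rfl fun d hd => ?_
  have hde : d.degree = e := by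
    rw [Finsupp.degree_eq_weight_one]
    exact hF (mem_support_iff.1 hd)
  have hm : monomial d (coeff d F) = coeff d F • monomial d (1 : R) := by simp [smul_monomial]
  rw [hm, map_smul, map_smul, ← hde, (key d).2]

/-- If `t F = ∑ Aᵢ Wᵢ` with the `Aᵢ` and `Wᵢ` vanishing at a point where `t` does not, then the
form `F` collapses; this is seen in the Taylor expansion at that point. -/
theorem _root_.HasCollapse.of_mul_eq_sum {K : Type*} [Field K] {N c e : ℕ}
    {F t : MvPolynomial (Fin N) K} (hF : F.IsHomogeneous e)
    {A W : Fin c → MvPolynomial (Fin N) K} (h : t * F = ∑ i, A i * W i) (x : Fin N → K)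
    (hA : ∀ i, aeval x (A i) = 0) (hW : ∀ i, aeval x (W i) = 0) (ht : aeval x t ≠ 0)
    {k : ℕ} (hk : c * (e - 1) ≤ k) : HasCollapse k F := by
  set τ : MvPolynomial (Fin N) K →ₐ[K] MvPolynomial (Fin N) K :=
    aeval (fun i => X i + C (x i)) with hτ
  have hcoeff (p : MvPolynomial (Fin N) K) : coeff 0 (τ p) = aeval x p := by
    have : (aeval (0 : Fin N → K)).comp τ = aeval x := by
      ext i
      simp [hτ]
    rw [← this, AlgHom.comp_apply, aeval_zero]
    simp [constantCoeff_eq]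
  set n := 1 - C (aeval x t)⁻¹ * τ t with hn
  have hn0 : coeff 0 n = 0 := by
    rw [hn, coeff_sub, coeff_C_mul, hcoeff, inv_mul_cancel₀ ht]
    simp
  set G := (∑ j ∈ Finset.range (e + 1), n ^ j) * C (aeval x t)⁻¹ with hG
  have hG' : τ F - n ^ (e + 1) * τ F = ∑ i, (G * τ (A i)) * τ (W i) := by
    have h1 : G * τ t = 1 - n ^ (e + 1) := by
      rw [← geom_sum_mul_neg, hG, mul_assoc]
      congr 1
      rw [hn]
      ring
    have h2 := congrArg τ h
    rw [map_mul, map_sum] at h2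
    calc _ = (G * τ t) * τ F := by rw [h1]; ring
      _ = G * ∑ i, τ (A i * W i) := by rw [mul_assoc, h2]
      _ = _ := by simp [Finset.mul_sum, mul_assoc]
  have hlow : homogeneousComponent e (n ^ (e + 1) * τ F) = 0 := by
    rw [homogeneousComponent_mul]
    refine Finset.sum_eq_zero fun y hy => ?_
    rw [Finset.HasAntidiagonal.mem_antidiagonal] at hy
    rw [homogeneousComponent_pow_of_coeff_zero hn0 (by omega), zero_mul]
  have hFsum : F = ∑ y ∈ (Finset.univ : Finset (Fin c)) ×ˢ Finset.Ioo 0 e,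
      homogeneousComponent y.2 (G * τ (A y.1)) *
        homogeneousComponent (e - y.2) (τ (W y.1)) := by
    have h3 := congrArg (homogeneousComponent e) hG'
    rw [map_sub, hlow, sub_zero, homogeneousComponent_translate x hF, map_sum] at h3
    refine h3.trans ?_
    rw [Finset.sum_product]
    refine Finset.sum_congr rfl fun i _ => ?_
    rw [homogeneousComponent_mul,
      Finset.Nat.sum_antidiagonal_eq_sum_range_succ (fun a b =>
        homogeneousComponent a (G * τ (A i)) * homogeneousComponent b (τ (W i)))]
    symm
    refine Finset.sum_subset (fun j hj => ?_) fun j hj hj' => ?_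
    · simp only [Finset.mem_Ioo, Finset.mem_range] at hj ⊢
      omega
    · simp only [Finset.mem_Ioo, Finset.mem_range] at hj hj'
      rcases Nat.eq_zero_or_pos j with rfl | hj0
      · have : constantCoeff (G * τ (A i)) = 0 := by
          rw [map_mul, constantCoeff_eq, hcoeff, hA, mul_zero]
        simp [homogeneousComponent_zero, ← constantCoeff_eq, this]
      · have : e - j = 0 := by omega
        rw [this, homogeneousComponent_zero, hcoeff, hW, C_0, mul_zero]
  rw [hFsum]
  refine HasCollapse.of_sum _ _ _ (by simpa using hk) (fun y hy => ?_) fun y hy => ?_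
  · exact ⟨y.2, by simp at hy; omega, homogeneousComponent_isHomogeneous _ _⟩
  · exact ⟨e - y.2, by simp at hy; omega, homogeneousComponent_isHomogeneous _ _⟩

end MvPolynomial
theorem IsRegularLocal.of_isRegularLocalRing (S : Type*) [CommRing S] [h : IsRegularLocalRing S] :
    IsRegularLocal S := by
  have hfg : Submodule.FG (maximalIdeal S) := (maximalIdeal S).fg_of_isNoetherianRing
  refine ⟨inferInstance, inferInstance, hfg.finite_generators.toFinset, ?_, ?_⟩
  · rw [Set.Finite.coe_toFinset]
    have := (maximalIdeal S).span_generators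
    rw [← Ideal.submodule_span_eq, this]
    exact maximalIdeal.isMaximal S
  · rw [← Set.ncard_eq_toFinset_card _ hfg.finite_generators, hfg.generators_ncard]
    exact h.spanFinrank_maximalIdeal

/-- An element of `𝔪 \ 𝔪²` is part of a minimal generating set of `𝔪`. -/
theorem IsLocalRing.exists_span_insert_eq_maximalIdeal {L : Type*} [CommRing L] [IsLocalRing L]
    [IsNoetherianRing L] {f : L} (hf : f ∈ maximalIdeal L) (hf2 : f ∉ maximalIdeal L ^ 2) :
    ∃ T : Set L, T.Finite ∧ Ideal.span (insert f T) = maximalIdeal L ∧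
      T.ncard + 1 ≤ (maximalIdeal L).spanFinrank := by
  classical
  set m := maximalIdeal L
  set v : CotangentSpace L := m.toCotangent ⟨f, hf⟩ with hv
  have hv0 : v ≠ 0 := by
    rw [hv, Ne, Ideal.toCotangent_eq_zero]
    exact hf2
  have hli : LinearIndepOn (ResidueField L) id ({v} : Set (CotangentSpace L)) :=
    LinearIndepOn.singleton hv0
  set B := hli.extend (Set.subset_univ _) with hB
  let b : Module.Basis B (ResidueField L) (CotangentSpace L) := Module.Basis.extend hli
  have hvB : v ∈ B := hli.subset_extend _ rfl
  have hspan : Submodule.span (ResidueField L) B = ⊤ := by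
    have := b.span_eq
    rwa [Module.Basis.range_extend] at this
  have hfin : B.Finite := Set.finite_coe_iff.1 (Module.Finite.finite_basis b)
  have hcard : B.ncard = m.spanFinrank := by
    rw [spanFinrank_maximalIdeal_eq_finrank_cotangentSpace, Module.finrank_eq_nat_card_basis b]
    rfl
  let g : CotangentSpace L → m := Function.surjInv m.toCotangent_surjective
  have hg (w : CotangentSpace L) : m.toCotangent (g w) = w :=
    Function.surjInv_eq m.toCotangent_surjective w
  let T' : Set m := g '' (B \ {v})
  have hT' : Submodule.span L (insert (⟨f, hf⟩ : m) T') = ⊤ := by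
    rw [← CotangentSpace.span_image_eq_top_iff, Set.image_insert_eq, ← hspan]
    congr 1
    rw [Set.image_image]
    rw [Set.image_congr (fun w _ => hg w), Set.image_id', ← hv, Set.insert_sdiff_singleton,
      Set.insert_eq_of_mem hvB]
  refine ⟨Subtype.val '' T', ((hfin.sdiff).image _).image _, ?_, ?_⟩
  · have := congrArg (Submodule.map m.subtype) hT'
    rw [Submodule.map_span, Submodule.map_top, Submodule.range_subtype,
      Set.image_insert_eq] at this
    exact this
  · rw [← hcard, ← Set.ncard_sdiff_singleton_add_one hvB hfin]
    gcongr
    exact (Set.ncard_image_le ((hfin.sdiff).image _)).trans (Set.ncard_image_le hfin.sdiff)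

/-- If `F` does not lie in the square of the maximal ideal of the regular ring `R_P`, where `P` is
the preimage of `p`, then `(R/F)_p` is regular. -/
theorem isRegularLocalRing_quotient_of_notMem_sq {R : Type*} [CommRing R] [IsRegularRing R]
    (F : R) (p : Ideal (R ⧸ Ideal.span {F})) [p.IsPrime]
    (P : Ideal R) [P.IsPrime] (hP : P = p.comap (Ideal.Quotient.mk (Ideal.span {F})))
    (hF : algebraMap R (Localization.AtPrime P) F ∉
      maximalIdeal (Localization.AtPrime P) ^ 2) :
    IsRegularLocalRing (Localization.AtPrime p) := by
  set mk := Ideal.Quotient.mk (Ideal.span {F})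
  have hmkF : mk F = 0 := Ideal.Quotient.eq_zero_iff_mem.2 (Ideal.mem_span_singleton_self F)
  have hFP : F ∈ P := by rw [hP, Ideal.mem_comap, hmkF]; exact zero_mem _
  have hPmap : P.map mk = p := by
    rw [hP, Ideal.map_comap_of_surjective _ Ideal.Quotient.mk_surjective]
  have hFm : algebraMap R (Localization.AtPrime P) F ∈ maximalIdeal (Localization.AtPrime P) := by
    rw [← Localization.AtPrime.map_eq_maximalIdeal]
    exact Ideal.mem_map_of_mem _ hFP
  obtain ⟨T, hTfin, hTspan, hTcard⟩ := exists_span_insert_eq_maximalIdeal hFm hF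
  set φ := Localization.localRingHom P p mk hP
  have hφ : φ.comp (algebraMap R _) = (algebraMap _ (Localization.AtPrime p)).comp mk := by
    ext x
    exact Localization.localRingHom_to_map P p mk hP x
  have hpmap : p.map (algebraMap _ (Localization.AtPrime p)) =
      (P.map mk).map (algebraMap _ (Localization.AtPrime p)) := by
    rw [hPmap]
  have hmax : maximalIdeal (Localization.AtPrime p) = Ideal.span (φ '' T) := by
    rw [← Localization.AtPrime.map_eq_maximalIdeal, hpmap, Ideal.map_map, ← hφ,
      ← Ideal.map_map, Localization.AtPrime.map_eq_maximalIdeal, ← hTspan, Ideal.map_span,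
      Set.image_insert_eq]
    have : φ (algebraMap R _ F) = 0 := by
      rw [← RingHom.comp_apply, hφ, RingHom.comp_apply, hmkF, map_zero]
    rw [this, Ideal.span_insert_zero]
  apply IsRegularLocalRing.of_spanFinrank_maximalIdeal_le
  rw [IsLocalization.AtPrime.ringKrullDim_eq_height p]
  have hh : P.height ≤ p.height + 1 := by
    have := Ideal.height_le_height_add_one_of_mem hFP
    rwa [hPmap] at this
  have hreg : ((maximalIdeal (Localization.AtPrime P)).spanFinrank : ℕ∞) = P.height := by
    have := (IsRegularRing.isRegularLocalRing_localization P).spanFinrank_maximalIdeal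
    rw [IsLocalization.AtPrime.ringKrullDim_eq_height P] at this
    exact_mod_cast this
  have h1 : (maximalIdeal (Localization.AtPrime p)).spanFinrank ≤ T.ncard := by
    rw [hmax]
    exact (Submodule.spanFinrank_span_le_ncard_of_finite (hTfin.image _)).trans
      (Set.ncard_image_le hTfin)
  have h2 : ((maximalIdeal (Localization.AtPrime p)).spanFinrank : ℕ∞) + 1 ≤ p.height + 1 := by
    refine le_trans ?_ hh
    rw [← hreg]
    exact_mod_cast (by omega)
  have h3 := (ENat.add_le_add_iff_right ENat.one_ne_top).1 h2
  exact_mod_cast h3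

/-- Clearing denominators in an expression for an element of `𝔪²` in `R_P`. -/
theorem exists_mul_eq_sum_of_mem_maximalIdeal_sq {R : Type*} [CommRing R] [IsDomain R]
    [IsNoetherianRing R] (P : Ideal R) [P.IsPrime] {F : R}
    (hF : algebraMap R (Localization.AtPrime P) F ∈ maximalIdeal (Localization.AtPrime P) ^ 2) :
    ∃ (t : R) (A W : Fin (maximalIdeal (Localization.AtPrime P)).spanFinrank → R), t ∉ P ∧
      (∀ i, A i ∈ P) ∧ (∀ i, W i ∈ P) ∧ t * F = ∑ i, A i * W i := by
  set L := Localization.AtPrime P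
  set m := maximalIdeal L
  have hfg : Submodule.FG m := m.fg_of_isNoetherianRing
  have : Finite m.generators := hfg.finite_generators
  let e : Fin m.spanFinrank ≃ m.generators :=
    (Finite.equivFinOfCardEq (by rw [← hfg.generators_ncard]; rfl)).symm
  let w (i : Fin m.spanFinrank) : L := e i
  have hw : Ideal.span (Set.range w) = m := by
    have : Set.range w = m.generators := by
      change Set.range (Subtype.val ∘ e) = _
      rw [Set.range_comp, e.range_eq_univ, Set.image_univ, Subtype.range_coe]
    rw [this]
    exact m.span_generators
  rw [pow_two] at hF
  have hF' : algebraMap R L F ∈ m • Submodule.span L (Set.range w) := by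
    change _ ∈ m • Ideal.span (Set.range w)
    rwa [hw]
  rw [Submodule.mem_ideal_smul_span_iff_exists_sum] at hF'
  obtain ⟨a, ha, hsum⟩ := hF'
  obtain ⟨s, hs⟩ := IsLocalization.exist_integer_multiples_of_finite P.primeCompl
    (Sum.elim a w)
  choose B hB using hs
  have hwm (i) : w i ∈ m := hw ▸ Ideal.subset_span ⟨i, rfl⟩
  have hmem {b : R} (hb : algebraMap R L b ∈ m) : b ∈ P := by
    rwa [← IsLocalization.AtPrime.to_map_mem_maximal_iff L P b]
  refine ⟨s * s, fun i => B (.inl i), fun i => B (.inr i), ?_, fun i => hmem ?_,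
    fun i => hmem ?_, ?_⟩
  · exact (s * s).2
  · rw [hB, Algebra.smul_def]
    exact Ideal.mul_mem_left _ _ (ha i)
  · rw [hB, Algebra.smul_def]
    exact Ideal.mul_mem_left _ _ (hwm i)
  · apply IsLocalization.injective L P.primeCompl_le_nonZeroDivisors
    rw [map_sum, map_mul, ← hsum, Finsupp.sum_fintype _ _ (by simp), Finset.mul_sum]
    refine Finset.sum_congr rfl fun i _ => ?_
    rw [map_mul, map_mul, hB, hB, smul_eq_mul, Algebra.smul_def, Algebra.smul_def]
    exact mul_mul_mul_comm _ _ _ _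

/-- With `A_2(η) = η + 2` and `A_d(η) = d ↑^(d²-d-1) (3^η)` for `d ≥ 3`:
for every `d ≥ 2` and every nonzero form `F` of positive degree at most `d` whose
strength is at least `A_d(η)`, the ring `R/FR` satisfies Serre's condition `R_η`. -/
theorem strength_implies_serre {K : Type*} [Field K] [IsAlgClosed K]
    (η : ℕ) (hη : 2 ≤ η) (d : ℕ) (hd : 2 ≤ d) {N : ℕ}
    (F : MvPolynomial (Fin N) K) (hF : F ≠ 0)
    (e : ℕ) (he : 0 < e) (hed : e ≤ d) (hhom : F.IsHomogeneous e)
    (hstr : ¬ HasCollapse (if d = 2 then η + 2 else knuth d (d ^ 2 - d - 1) (3 ^ η)) F) :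
    SerreReg η (MvPolynomial (Fin N) K ⧸ Ideal.span {F}) := by
  intro p hp
  rw [← PrimeSpectrum.height_eq_orderHeight] at hp
  set P := p.asIdeal.comap (Ideal.Quotient.mk (Ideal.span {F})) with hP
  by_cases hsq : algebraMap _ (Localization.AtPrime P) F ∈
      maximalIdeal (Localization.AtPrime P) ^ 2
  · refine absurd ?_ hstr
    obtain ⟨t, A, W, ht, hA, hW, h⟩ := exists_mul_eq_sum_of_mem_maximalIdeal_sq P hsq
    obtain ⟨x, hx, hxt⟩ : ∃ x ∈ zeroLocus K P, aeval x t ≠ 0 := by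
      by_contra! hcon
      exact ht (by rwa [← IsPrime.vanishingIdeal_zeroLocus (K := K) P])
    refine HasCollapse.of_mul_eq_sum hhom h x (fun i => hx _ (hA i)) (fun i => hx _ (hW i)) hxt
      (le_trans (Nat.mul_le_mul_right _ ?_) (mul_le_strength_bound hd hed))
    have hFP : F ∈ P := by
      rw [hP, Ideal.mem_comap,
        Ideal.Quotient.eq_zero_iff_mem.2 (Ideal.mem_span_singleton_self F)]
      exact zero_mem _
    have hh := Ideal.height_le_height_add_one_of_mem hFP
    rw [hP, Ideal.map_comap_of_surjective _ Ideal.Quotient.mk_surjective, ← hP] at hh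
    have hreg := (IsRegularRing.isRegularLocalRing_localization P).spanFinrank_maximalIdeal
    rw [IsLocalization.AtPrime.ringKrullDim_eq_height P] at hreg
    have hreg' : ((maximalIdeal (Localization.AtPrime P)).spanFinrank : ℕ∞) = P.height := by
      exact_mod_cast hreg
    have := hreg'.le.trans (hh.trans (add_le_add_left hp 1))
    exact_mod_cast this
  · have := isRegularLocalRing_quotient_of_notMem_sq F p.asIdeal P hP hsq
    exact .of_isRegularLocalRing _
end
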